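/- arXiv:1202.0747 — 2 statements merged into one kernel-verified Lean document; each statement's English description precedes it below -/
import Mathlib

section
/- For every positive integer n, M(n,n) ≥ 2·M*(n,n) + n, where M(n,n) is the two-pair merging constant with distinct sources and M*(n,n) is the corresponding constant when the two sources coincide. -/
/-- A finite directed multigraph. -/
structure MultiDigraph where
  V : Type
  E : Type
  fintV : Fintype V
  fintE : Fintype E
  src : E → V
  dst : E → V

namespace MultiDigraph

/-- `p` is a (nonempty) directed path from `u` to `v`, given as its list of edges. -/
def IsPathFrom (G : MultiDigraph) (u v : G.V) (p : List G.E) : Prop :=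
  p ≠ [] ∧ List.Chain' (fun e f => G.dst e = G.src f) p ∧
    (∀ e ∈ p.head?, G.src e = u) ∧ ∀ e ∈ p.getLast?, G.dst e = v

/-- `G` is acyclic: there is no (nonempty) directed path from a vertex to itself. -/
def Acyclic (G : MultiDigraph) : Prop :=
  ∀ (v : G.V) (p : List G.E), ¬ G.IsPathFrom v v p

/-- `α` is a family of `c` pairwise edge-disjoint directed paths from `u` to `v`. -/
def MengerSystem (G : MultiDigraph) (u v : G.V) (c : ℕ) (α : Fin c → List G.E) : Prop :=
  (∀ i, G.IsPathFrom u v (α i)) ∧ ∀ i j, i ≠ j → ∀ e, e ∈ α i → e ∉ α j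

/-- The min-cut between `u` and `v` equals `c`: by Menger's theorem, this means the
maximum number of pairwise edge-disjoint directed paths from `u` to `v` is exactly `c`. -/
def MinCut (G : MultiDigraph) (u v : G.V) (c : ℕ) : Prop :=
  (∃ α : Fin c → List G.E, G.MengerSystem u v c α) ∧
    ¬∃ α : Fin (c + 1) → List G.E, G.MengerSystem u v (c + 1) α

/-- Edge `e` is the starting edge of a merging among paths from (at least) two different
groups: `e` lies on a path of group `i` and on a path of group `j ≠ i`, and there are two
distinct edges immediately ahead of `e` on these two paths.  Mergings are counted without
multiplicity: one merging per such edge `e`. -/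
def MergingEdge (G : MultiDigraph) {l : ℕ} {c : Fin l → ℕ}
    (α : (i : Fin l) → Fin (c i) → List G.E) (e : G.E) : Prop :=
  ∃ i j : Fin l, i ≠ j ∧ ∃ (a : Fin (c i)) (b : Fin (c j)) (f g : G.E),
    f ≠ g ∧ [f, e] <:+: α i a ∧ [g, e] <:+: α j b

/-- The number of mergings among paths from different groups, `|G|_M(α₁,…,α_l)`. -/
noncomputable def mergingCount (G : MultiDigraph) {l : ℕ} {c : Fin l → ℕ}
    (α : (i : Fin l) → Fin (c i) → List G.E) : ℕ :=
  Set.ncard {e : G.E | G.MergingEdge α e}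

end MultiDigraph

open MultiDigraph

/-- `G` is a finite acyclic directed multigraph with designated sources `S i`, pairwise
distinct sinks `R i`, and min-cut `c i` between `S i` and `R i`. -/
def GoodConfig {l : ℕ} (G : MultiDigraph) (S R : Fin l → G.V) (c : Fin l → ℕ) : Prop :=
  G.Acyclic ∧ Function.Injective R ∧ ∀ i, G.MinCut (S i) (R i) (c i)

/-- `M(c₁,…,c_l) ≤ B`: in every acyclic graph with distinct sources, distinct sinks and
the given min-cuts, some choice of Menger path systems yields at most `B` mergings. -/
def MAtMost {l : ℕ} (c : Fin l → ℕ) (B : ℕ) : Prop :=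
  ∀ (G : MultiDigraph) (S R : Fin l → G.V), GoodConfig G S R c → Function.Injective S →
    ∃ α : (i : Fin l) → Fin (c i) → List G.E,
      (∀ i, G.MengerSystem (S i) (R i) (c i) (α i)) ∧ G.mergingCount α ≤ B

/-- `M(c₁,…,c_l) ≥ B`: some acyclic graph with distinct sources, distinct sinks and the
given min-cuts yields at least `B` mergings for every choice of Menger path systems. -/
def MAtLeast {l : ℕ} (c : Fin l → ℕ) (B : ℕ) : Prop :=
  ∃ (G : MultiDigraph) (S R : Fin l → G.V), GoodConfig G S R c ∧ Function.Injective S ∧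
    ∀ α : (i : Fin l) → Fin (c i) → List G.E,
      (∀ i, G.MengerSystem (S i) (R i) (c i) (α i)) → B ≤ G.mergingCount α

/-- `M(c₁,…,c_l) = B`: the largest possible value, over all acyclic graphs with distinct
sources and distinct sinks realizing the min-cuts `c`, of the minimum number of mergings
over all choices of Menger path systems, equals `B`. -/
def MEq {l : ℕ} (c : Fin l → ℕ) (B : ℕ) : Prop := MAtMost c B ∧ MAtLeast c B

/-- `M*(c₁,…,c_l) ≤ B`: as `MAtMost`, but with all sources identical. -/
def MstarAtMost {l : ℕ} (c : Fin l → ℕ) (B : ℕ) : Prop :=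
  ∀ (G : MultiDigraph) (S R : Fin l → G.V), GoodConfig G S R c → (∀ i j, S i = S j) →
    ∃ α : (i : Fin l) → Fin (c i) → List G.E,
      (∀ i, G.MengerSystem (S i) (R i) (c i) (α i)) ∧ G.mergingCount α ≤ B

/-- `M*(c₁,…,c_l) ≥ B`: as `MAtLeast`, but with all sources identical. -/
def MstarAtLeast {l : ℕ} (c : Fin l → ℕ) (B : ℕ) : Prop :=
  ∃ (G : MultiDigraph) (S R : Fin l → G.V), GoodConfig G S R c ∧ (∀ i j, S i = S j) ∧
    ∀ α : (i : Fin l) → Fin (c i) → List G.E,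
      (∀ i, G.MengerSystem (S i) (R i) (c i) (α i)) → B ≤ G.mergingCount α

/-- `M*(c₁,…,c_l) = B`: as `MEq`, but with all sources identical. -/
def MstarEq {l : ℕ} (c : Fin l → ℕ) (B : ℕ) : Prop := MstarAtMost c B ∧ MstarAtLeast c B

/-- The minimum number of mergings over all choices of the Menger path systems, for a
fixed graph with fixed sources, sinks, and min-cuts. -/
noncomputable def minMergings {l : ℕ} (G : MultiDigraph) (S R : Fin l → G.V)
    (c : Fin l → ℕ) : ℕ :=
  sInf {k : ℕ | ∃ α : (i : Fin l) → Fin (c i) → List G.E,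
    (∀ i, G.MengerSystem (S i) (R i) (c i) (α i)) ∧ G.mergingCount α = k}

/-- `M(c₁,…,c_l)`: the supremum, over all finite acyclic directed multigraphs with `l`
distinct sources, `l` distinct sinks and min-cuts `c`, of the minimum number of mergings
over all choices of the Menger path systems. -/
noncomputable def Mnum {l : ℕ} (c : Fin l → ℕ) : ℕ :=
  sSup {k : ℕ | ∃ (G : MultiDigraph) (S R : Fin l → G.V),
    GoodConfig G S R c ∧ Function.Injective S ∧ minMergings G S R c = k}

/-- `M*(c₁,…,c_l)`: as `Mnum`, but over graphs in which all the sources coincide. -/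
noncomputable def MstarNum {l : ℕ} (c : Fin l → ℕ) : ℕ :=
  sSup {k : ℕ | ∃ (G : MultiDigraph) (S R : Fin l → G.V),
    GoodConfig G S R c ∧ (∀ i j, S i = S j) ∧ minMergings G S R c = k}

namespace MB

def Tr {E κ : Type} [LinearOrder E] (c : E → Option κ) (e f : E) : Prop :=
  c e ≠ none ∧ c e = c f ∧ e < f ∧ ∀ g, c g = c e → e < g → g < f → False

def Nx {E κ : Type} [LinearOrder E] (c d : E → Option κ) (u w : E) : Prop :=
  c u ≠ none ∧ c u = c w ∧ d u ≠ none ∧ d w ≠ none ∧ u < w ∧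
    ∀ g, c g = c u → d g ≠ none → u < g → g < w → False

set_option linter.unusedSectionVars false

section
variable {E κ : Type} [LinearOrder E] [Finite E]

theorem exists_next (P : E → Prop) (e g : E) (hg : P g) (h : e < g) :
    ∃ f, P f ∧ e < f ∧ f ≤ g ∧ ∀ k, P k → e < k → k < f → False := by
  obtain ⟨f, hf, hmin⟩ := Set.exists_min_image {f | P f ∧ e < f} id (Set.toFinite _) ⟨g, hg, h⟩
  refine ⟨f, hf.1, hf.2, hmin g ⟨hg, h⟩, fun k hk h1 h2 => ?_⟩
  exact absurd (hmin k ⟨hk, h1⟩) (not_le.mpr h2)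

theorem exists_prev (P : E → Prop) (e g : E) (hg : P g) (h : g < e) :
    ∃ f, P f ∧ f < e ∧ g ≤ f ∧ ∀ k, P k → f < k → k < e → False := by
  obtain ⟨f, hf, hmin⟩ := Set.exists_max_image {f | P f ∧ f < e} id (Set.toFinite _) ⟨g, hg, h⟩
  refine ⟨f, hf.1, hf.2, hmin g ⟨hg, h⟩, fun k hk h1 h2 => ?_⟩
  exact absurd (hmin k ⟨hk, h2⟩) (not_le.mpr h1)

theorem Tr_succ (c : E → Option κ) (e g : E) (h0 : c e ≠ none) (h1 : c g = c e) (h2 : e < g) :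
    ∃ f, Tr c e f ∧ f ≤ g := by
  obtain ⟨f, a, b, b', h⟩ := exists_next (fun x => c x = c e) e g h1 h2
  exact ⟨f, ⟨h0, a.symm, b, h⟩, b'⟩

theorem Tr_pred (c : E → Option κ) (e g : E) (h0 : c e ≠ none) (h1 : c g = c e) (h2 : g < e) :
    ∃ f, Tr c f e ∧ g ≤ f := by
  obtain ⟨f, a, b, b', h⟩ := exists_prev (fun x => c x = c e) e g h1 h2
  exact ⟨f, ⟨by rw [a]; exact h0, a, b, fun k hk => h k (by rw [hk, a])⟩, b'⟩

/-- Rerouting lemma. -/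
theorem exchange (c d : E → Option κ) (U : Set E)
    (hU : ∀ u ∈ U, ∃ w, Nx c d u w)
    (hs : ∀ u ∈ U, ∀ w, Nx c d u w → ∃ u' ∈ U, d u' = d w ∧ u' < w ∧
      ∀ v ∈ U, ∀ w', Nx c d v w' → d w' = d w → u' < w' → w' < w → False)
    (u0 w0 : E) (hu0 : u0 ∈ U) (hw0 : Nx c d u0 w0) (hm : ∀ z, Tr c z w0 → Tr d z w0 → False) :
    ∃ (F : E → E → Prop) (B : E → Prop),
      (∀ e f, F e f → Tr c e f ∨ Tr d e f) ∧
      (∀ e f, B e → F e f → B f) ∧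
      (∀ e f z, F e z → F f z → e = f) ∧
      (∀ s, d s ≠ none → (∀ g, d g = d s → s ≤ g) → B s ∧ ∀ e, ¬ F e s) ∧
      (∀ e, B e → (∀ f, ¬ F e f) → d e ≠ none ∧ ∀ g, d g = d e → g ≤ e) ∧
      ∃ z w, Tr d z w ∧ ¬ Tr c z w ∧ ¬ F z w := by
  let Dead : E → Prop := fun z => ∃ u ∈ U, d u = d z ∧ u < z ∧
    ∀ v ∈ U, ∀ w, Nx c d v w → d w = d z → u < w → w ≤ z → False
  let Aseg : E → Prop := fun z => d z = none ∧ ∃ u ∈ U, ∃ w, Nx c d u w ∧ c z = c u ∧ u < z ∧ z < w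
  let B : E → Prop := fun z => (d z ≠ none ∧ ¬ Dead z) ∨ Aseg z
  let F : E → E → Prop := fun e f => B e ∧
    (((e ∈ U ∨ Aseg e) ∧ Tr c e f) ∨ (d e ≠ none ∧ e ∉ U ∧ Tr d e f))
  -- c-steps
  have hc : ∀ e f, (e ∈ U ∨ Aseg e) → Tr c e f →
      ∃ u ∈ U, ∃ w, Nx c d u w ∧ u ≤ e ∧ e < w ∧ f ≤ w ∧ c f = c u := by
    rintro e f (he | ⟨h1, u, hu, w, hw, h2, h3, h4⟩) ⟨t1, t2, t3, t4⟩
    · obtain ⟨w, hw⟩ := hU e he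
      refine ⟨e, he, w, hw, le_rfl, hw.2.2.2.2.1, ?_, t2.symm⟩
      by_contra! h
      exact t4 w hw.2.1.symm hw.2.2.2.2.1 h
    · refine ⟨u, hu, w, hw, h3.le, h4, ?_, by rw [← t2, h2]⟩
      by_contra! h
      exact t4 w (by rw [h2, hw.2.1]) h4 h
  have hcw : ∀ e f, (e ∈ U ∨ Aseg e) → Tr c e f → d f ≠ none → ∃ u ∈ U, Nx c d u f := by
    intro e f h1 h2 h3
    obtain ⟨u, hu, w, hw, a1, a2, a3, a4⟩ := hc e f h1 h2
    rcases a3.lt_or_eq with h | h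
    · exact (hw.2.2.2.2.2 f a4 h3 (a1.trans_lt h2.2.2.1) h).elim
    · exact ⟨u, hu, h ▸ hw⟩
  have hpre : ∀ u ∈ U, ∀ w, Nx c d u w → ∀ z, Tr d z w → z ∈ U ∨ Dead z := by
    intro u hu w hw z hz
    obtain ⟨u', hu', b1, b2, b3⟩ := hs u hu w hw
    have h1 : u' ≤ z := by
      by_contra! h
      exact hz.2.2.2 u' (by rw [b1, hz.2.1]) h b2
    rcases h1.lt_or_eq with h | h
    · right
      refine ⟨u', hu', by rw [b1, hz.2.1], h, fun v hv w' hw' q1 q2 q3 => ?_⟩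
      exact b3 v hv w' hw' (by rw [q1, hz.2.1]) q2 (q3.trans_lt hz.2.2.1)
    · left; exact h ▸ hu'
  have hnD : ∀ z, d z ≠ none → B z → ¬ Dead z := by
    rintro z hz (h | h)
    · exact h.2
    · exact absurd h.1 hz
  refine ⟨F, B, ?_, ?_, ?_, ?_, ?_, ?_⟩
  · rintro e f ⟨_, h | h⟩
    · exact Or.inl h.2
    · exact Or.inr h.2.2
  · rintro e f he ⟨_, ⟨h, t⟩ | ⟨h1, h2, t⟩⟩
    · by_cases hf : d f = none
      · right
        obtain ⟨u, hu, w, hw, a1, a2, a3, a4⟩ := hc e f h t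
        refine ⟨hf, u, hu, w, hw, a4, a1.trans_lt t.2.2.1, lt_of_le_of_ne a3 ?_⟩
        rintro rfl
        exact hw.2.2.2.1 hf
      · left
        obtain ⟨u, hu, hw⟩ := hcw e f h t hf
        refine ⟨hf, ?_⟩
        rintro ⟨u', hu', q1, q2, q3⟩
        exact q3 u hu f hw rfl q2 le_rfl
    · left
      refine ⟨by rw [← t.2.1]; exact h1, ?_⟩
      rintro ⟨u', hu', q1, q2, q3⟩
      have h3 : u' ≤ e := by
        by_contra! h
        exact t.2.2.2 u' (by rw [q1, t.2.1]) h q2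
      have h4 : u' < e := lt_of_le_of_ne h3 (by rintro rfl; exact h2 hu')
      refine hnD e h1 he ⟨u', hu', by rw [q1, t.2.1], h4, fun v hv w hw r1 r2 r3 => ?_⟩
      exact q3 v hv w hw (by rw [r1, t.2.1]) r2 (r3.trans t.2.2.1.le)
  · have uniq : ∀ (k : E → Option κ) e f z, Tr k e z → Tr k f z → e = f := by
      intro k e f z h1 h2
      rcases lt_trichotomy e f with h | h | h
      · exact (h1.2.2.2 f (by rw [h2.2.1, h1.2.1]) h h2.2.2.1).elim
      · exact h
      · exact (h2.2.2.2 e (by rw [h2.2.1, h1.2.1]) h h1.2.2.1).elim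
    have mix : ∀ e f z, (e ∈ U ∨ Aseg e) → Tr c e z → B f → d f ≠ none → f ∉ U → Tr d f z → False := by
      intro e f z h1 h2 h3 h4 h5 h6
      obtain ⟨u, hu, hw⟩ := hcw e z h1 h2 (by rw [← h6.2.1]; exact h4)
      rcases hpre u hu z hw f h6 with h | h
      · exact h5 h
      · exact hnD f h4 h3 h
    rintro e f z ⟨he, ⟨h1, t1⟩ | ⟨h1, h1', t1⟩⟩ ⟨hf, ⟨h2, t2⟩ | ⟨h2, h2', t2⟩⟩
    · exact uniq c e f z t1 t2
    · exact (mix e f z h1 t1 hf h2 h2' t2).elim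
    · exact (mix f e z h2 t2 he h1 h1' t1).elim
    · exact uniq d e f z t1 t2
  · intro s hs1 hs2
    refine ⟨Or.inl ⟨hs1, ?_⟩, ?_⟩
    · rintro ⟨u', hu', q1, q2, q3⟩
      exact absurd (hs2 u' q1) (not_le.mpr q2)
    · rintro e ⟨he, ⟨h1, t1⟩ | ⟨h1, h1', t1⟩⟩
      · obtain ⟨u, hu, hw⟩ := hcw e s h1 t1 hs1
        obtain ⟨u', hu', b1, b2, b3⟩ := hs u hu s hw
        exact absurd (hs2 u' b1) (not_le.mpr b2)
      · exact absurd (hs2 e t1.2.1) (not_le.mpr t1.2.2.1)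
  · intro e he hF
    by_cases h : e ∈ U ∨ Aseg e
    · exfalso
      have : ∃ f, Tr c e f := by
        rcases h with h | ⟨h1, u, hu, w, hw, h2, h3, h4⟩
        · obtain ⟨w, hw⟩ := hU e h
          obtain ⟨f, hf, _⟩ := Tr_succ c e w hw.1 hw.2.1.symm hw.2.2.2.2.1
          exact ⟨f, hf⟩
        · obtain ⟨f, hf, _⟩ := Tr_succ c e w (by rw [h2]; exact hw.1) (by rw [h2, hw.2.1]) h4
          exact ⟨f, hf⟩
      obtain ⟨f, hf⟩ := this
      exact hF f ⟨he, Or.inl ⟨h, hf⟩⟩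
    · push Not at h
      have hd : d e ≠ none := by
        rcases he with he | he
        · exact he.1
        · exact absurd he h.2
      refine ⟨hd, fun g hg => ?_⟩
      by_contra! hlt
      obtain ⟨f, hf, _⟩ := Tr_succ d e g hd hg hlt
      exact hF f ⟨he, Or.inr ⟨hd, h.1, hf⟩⟩
  · obtain ⟨u', hu', b1, b2, b3⟩ := hs u0 hu0 w0 hw0
    obtain ⟨z, hz, _⟩ := Tr_pred d w0 u' hw0.2.2.2.1 b1 b2
    refine ⟨z, w0, hz, fun h => hm z h hz, ?_⟩
    rintro ⟨he, ⟨h1, t1⟩ | ⟨h1, h1', t1⟩⟩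
    · exact hm z t1 hz
    · rcases hpre u0 hu0 w0 hw0 z hz with h | h
      · exact h1' h
      · exact hnD z h1 he h

theorem Nx_uniq (c d : E → Option κ) {x x' y : E} (h : Nx c d x y) (h' : Nx c d x' y) : x = x' := by
  rcases lt_trichotomy x x' with q | q | q
  · exact (h.2.2.2.2.2 x' (by rw [h'.2.1, h.2.1]) h'.2.2.1 q h'.2.2.2.2.1).elim
  · exact q
  · exact (h'.2.2.2.2.2 x (by rw [h'.2.1, h.2.1]) h.2.2.1 q h.2.2.2.2.1).elim

theorem Nx_uniq' (c d : E → Option κ) {x y y' : E} (h : Nx c d x y) (h' : Nx c d x y') : y = y' := by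
  rcases lt_trichotomy y y' with q | q | q
  · exact (h'.2.2.2.2.2 y (by rw [h.2.1]) h.2.2.2.1 h.2.2.2.2.1 q).elim
  · exact q
  · exact (h.2.2.2.2.2 y' (by rw [h'.2.1]) h'.2.2.2.1 h'.2.2.2.2.1 q).elim

/-- What the rerouting lemma provides. -/
def Reroute (c d : E → Option κ) : Prop :=
  ∃ (F : E → E → Prop) (B : E → Prop),
      (∀ e f, F e f → Tr c e f ∨ Tr d e f) ∧
      (∀ e f, B e → F e f → B f) ∧
      (∀ e f z, F e z → F f z → e = f) ∧
      (∀ s, d s ≠ none → (∀ g, d g = d s → s ≤ g) → B s ∧ ∀ e, ¬ F e s) ∧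
      (∀ e, B e → (∀ f, ¬ F e f) → d e ≠ none ∧ ∀ g, d g = d e → g ≤ e) ∧
      ∃ z w, Tr d z w ∧ ¬ Tr c z w ∧ ¬ F z w

/-- Zigzag closing lemma. -/
theorem zigzag (c d : E → Option κ) (x y : ℕ → E) (N : ℕ) (hN : 0 < N)
    (hB : ∀ i < N, Nx d c (x i) (y i)) (hA : ∀ i < N, Nx c d (x i) (y (i + 1)))
    (hd : d (y 0) = d (y N)) (hle : y 0 ≤ y N)
    (hm : ∀ i ≤ N, ∀ z, Tr c z (y i) → Tr d z (y i) → False) : Reroute c d := by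
  classical
  have hex : ∃ q, 0 < q ∧ q ≤ N ∧ d (y 0) = d (y q) ∧ y 0 ≤ y q := ⟨N, hN, le_rfl, hd, hle⟩
  obtain ⟨q0, qN, qd, qle⟩ := Nat.find_spec hex
  have qmin : ∀ m, 0 < m → m < Nat.find hex → d (y 0) = d (y m) → y 0 ≤ y m → False :=
    fun m h1 h2 h3 h4 => Nat.find_min hex h2 ⟨h1, h2.le.trans qN, h3, h4⟩
  generalize Nat.find hex = q at *
  refine exchange c d {u | ∃ i < q, u = x i} ?_ ?_ (x 0) (y 1) ⟨0, q0, rfl⟩ (hA 0 hN) (hm 1 (by omega))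
  · rintro u ⟨i, hi, rfl⟩
    exact ⟨_, hA i (by omega)⟩
  · rintro u ⟨i, hi, rfl⟩ w hw
    obtain rfl := Nx_uniq' c d (hA i (by omega)) hw
    by_cases hiq : i + 1 < q
    · have hb := hB (i + 1) (by omega)
      refine ⟨x (i + 1), ⟨i + 1, hiq, rfl⟩, hb.2.1, hb.2.2.2.2.1, ?_⟩
      rintro v - w' hw' h1 h2 h3
      exact hb.2.2.2.2.2 w' (by rw [h1, hb.2.1]) (by rw [← hw'.2.1]; exact hw'.1) h2 h3
    · obtain rfl : i + 1 = q := by omega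
      have hb := hB 0 hN
      refine ⟨x 0, ⟨0, q0, rfl⟩, by rw [hb.2.1, qd], hb.2.2.2.2.1.trans_le qle, ?_⟩
      rintro v ⟨k, hk, rfl⟩ w' hw' h1 h2 h3
      obtain rfl := Nx_uniq' c d (hA k (by omega)) hw'
      have hne : k + 1 < i + 1 := by
        rcases Nat.lt_or_ge (k + 1) (i + 1) with h | h
        · exact h
        · have : k = i := by omega
          subst this
          exact absurd h3 (lt_irrefl _)
      refine qmin (k + 1) (by omega) hne (by rw [h1, qd]) ?_
      by_contra! hlt
      exact hb.2.2.2.2.2 _ (by rw [h1, hb.2.1, qd]) (by rw [← hw'.2.1]; exact hw'.1) h2 hlt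

/-- no long zigzags in a minimal situation -/
theorem no_long [Fintype κ] (c d : E → Option κ) (h1 : ¬ Reroute c d) (h2 : ¬ Reroute d c)
    (x y : ℕ → E) (N : ℕ) (hN : Fintype.card (Option κ × Option κ) ≤ N)
    (hB : ∀ i < N, Nx d c (x i) (y i)) (hA : ∀ i < N, Nx c d (x i) (y (i + 1)))
    (hm : ∀ i ≤ N, ∀ z, Tr c z (y i) → Tr d z (y i) → False) : False := by
  obtain ⟨k, l, hkl, he⟩ := Fintype.exists_ne_map_eq_of_card_lt
    (fun i : Fin (N + 1) => (c (y i), d (y i))) (by simpa using Nat.lt_succ_of_le hN)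
  wlog hlt : k < l generalizing k l
  · exact this l k hkl.symm he.symm (lt_of_le_of_ne (not_lt.mp hlt) hkl.symm)
  simp only [Prod.mk.injEq] at he
  obtain ⟨k, hk⟩ := k
  obtain ⟨l, hl⟩ := l
  simp only [Fin.mk_lt_mk] at hlt he
  rcases le_total (y k) (y l) with h | h
  · refine h1 (zigzag c d (fun i => x (k + i)) (fun i => y (k + i)) (l - k) (by omega)
      (fun i hi => hB _ (by omega)) (fun i hi => hA _ (by omega)) ?_ ?_ (fun i hi => hm _ (by omega)))
    · simpa [Nat.add_sub_cancel' hlt.le] using he.2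
    · simpa [Nat.add_sub_cancel' hlt.le] using h
  · refine h2 (zigzag d c (fun i => x (l - 1 - i)) (fun i => y (l - i)) (l - k) (by omega)
      (fun i hi => ?_) (fun i hi => ?_) ?_ ?_ (fun i hi z a b => hm _ (by omega) z b a))
    · have := hA (l - 1 - i) (by omega)
      rwa [show l - 1 - i + 1 = l - i by omega] at this
    · have := hB (l - 1 - i) (by omega)
      show Nx d c (x (l - 1 - i)) (y (l - (i + 1)))
      rwa [show l - (i + 1) = l - 1 - i by omega]
    · have : l - (l - k) = k := by omega
      simp [this, he.1]
    · have : l - (l - k) = k := by omega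
      simp [this, h]

/-- counting lemma -/
theorem count_chains (M : Set E) (Φ : E → E → Prop) (K t : ℕ)
    (hinj : ∀ y y' z, Φ y z → Φ y' z → y = y')
    (hM : ∀ y ∈ M, ∀ z, Φ y z → z ∈ M)
    (hlong : ∀ y : ℕ → E, y 0 ∈ M → (∀ i < K, Φ (y i) (y (i + 1))) → False)
    (hterm : {y ∈ M | ∀ z, ¬ Φ y z}.ncard ≤ t) : M.ncard ≤ K * t := by
  classical
  let F : E → E := fun y => if h : ∃ z, Φ y z then h.choose else y
  have hF : ∀ y, (∃ z, Φ y z) → Φ y (F y) := by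
    intro y h
    simp only [F, dif_pos h]
    exact h.choose_spec
  have hFM : ∀ y ∈ M, F y ∈ M := by
    intro y hy
    by_cases h : ∃ z, Φ y z
    · exact hM y hy _ (hF y h)
    · simpa [F, dif_neg h] using hy
  have hFMi : ∀ k, ∀ y ∈ M, F^[k] y ∈ M := by
    intro k
    induction k with
    | zero => intro y hy; exact hy
    | succ k ih => intro y hy; rw [Function.iterate_succ_apply']; exact hFM _ (ih y hy)
  have hex : ∀ y ∈ M, ∃ k, k < K ∧ ∀ z, ¬ Φ (F^[k] y) z := by
    intro y hy
    by_contra! h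
    refine hlong (fun i => F^[i] y) hy fun i hi => ?_
    show Φ (F^[i] y) (F^[i+1] y)
    rw [Function.iterate_succ_apply']
    exact hF _ (h i hi)
  let T : Set E := {y ∈ M | ∀ z, ¬ Φ y z}
  let k : E → ℕ := fun y => if h : ∃ k, k < K ∧ ∀ z, ¬ Φ (F^[k] y) z then Nat.find h else 0
  have hk : ∀ y ∈ M, k y < K ∧ (∀ z, ¬ Φ (F^[k y] y) z) ∧ ∀ j < k y, ∃ z, Φ (F^[j] y) z := by
    intro y hy
    have h := hex y hy
    have e : k y = Nat.find h := by simp only [k, dif_pos h]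
    rw [e]
    refine ⟨(Nat.find_spec h).1, (Nat.find_spec h).2, fun j hj => ?_⟩
    have := Nat.find_min h hj
    by_contra! hc
    exact this ⟨hj.trans (Nat.find_spec h).1, hc⟩
  have hback : ∀ j y y', (∀ i < j, ∃ z, Φ (F^[i] y) z) → (∀ i < j, ∃ z, Φ (F^[i] y') z) →
      F^[j] y = F^[j] y' → y = y' := by
    intro j
    induction j with
    | zero => intro y y' _ _ h; exact h
    | succ j ih =>
      intro y y' h1 h2 h
      rw [Function.iterate_succ_apply', Function.iterate_succ_apply'] at h
      refine ih y y' (fun i hi => h1 i (by omega)) (fun i hi => h2 i (by omega)) ?_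
      have a := hF _ (h1 j (by omega))
      have b := hF _ (h2 j (by omega))
      rw [← h] at b
      exact hinj _ _ _ a b
  have hle : M.ncard ≤ ((Set.Iio K) ×ˢ T).ncard := by
    refine Set.ncard_le_ncard_of_injOn (fun y => (k y, F^[k y] y)) ?_ ?_ ((Set.finite_Iio K).prod (Set.toFinite _))
    · intro y hy
      exact ⟨(hk y hy).1, hFMi _ y hy, (hk y hy).2.1⟩
    · intro y hy y' hy' h
      simp only [Prod.mk.injEq] at h
      refine hback (k y) y y' (hk y hy).2.2 ?_ ?_
      · rw [h.1]; exact (hk y' hy').2.2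
      · rw [h.2, h.1]
  rw [Set.ncard_prod] at hle
  have : (Set.Iio K).ncard = K := by
    rw [← Finset.coe_Iio, Set.ncard_coe_finset]; simp
  rw [this] at hle
  exact hle.trans (Nat.mul_le_mul_left _ hterm)

theorem run_bound [Fintype κ] (c d : E → Option κ) (h1 : ¬ Reroute c d) (h2 : ¬ Reroute d c) :
    {y | c y ≠ none ∧ d y ≠ none ∧ ∀ z, Tr c z y → Tr d z y → False}.ncard ≤
      Fintype.card (Option κ × Option κ) * Fintype.card (Option κ ⊕ Option κ) := by
  classical
  refine count_chains _ (fun y y' => ∃ x, Nx d c x y ∧ Nx c d x y') _ _ ?_ ?_ ?_ ?_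
  · rintro y y' z ⟨x, a, b⟩ ⟨x', a', b'⟩
    obtain rfl := Nx_uniq c d b b'
    exact Nx_uniq' d c a a'
  · rintro y ⟨y1, y2, y3⟩ z ⟨x, a, b⟩
    refine ⟨by rw [← b.2.1]; exact b.1, b.2.2.2.1, fun t p q => ?_⟩
    have e1 : t = x := by
      have ht : c t ≠ none := p.1
      have hd : d t ≠ none := q.1
      rcases lt_trichotomy t x with h | h | h
      · exact (p.2.2.2 x (by rw [b.2.1, p.2.1]) h b.2.2.2.2.1).elim
      · exact h
      · exact (b.2.2.2.2.2 t (by rw [b.2.1, p.2.1]) hd h p.2.2.1).elim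
    subst e1
    have e2 : y = z := by
      rcases lt_trichotomy y z with h | h | h
      · exact (q.2.2.2 y (by rw [a.2.1]) a.2.2.2.2.1 h).elim
      · exact h
      · exact (a.2.2.2.2.2 z (by rw [q.2.1]) (by rw [← p.2.1]; exact p.1) q.2.2.1 h).elim
    subst e2
    exact y3 t p q
  · intro y hy hΦ
    have : ∀ i, ∃ x, i < Fintype.card (Option κ × Option κ) → Nx d c x (y i) ∧ Nx c d x (y (i + 1)) := by
      intro i
      by_cases hi : i < Fintype.card (Option κ × Option κ)
      · obtain ⟨x, hx⟩ := hΦ i hi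
        exact ⟨x, fun _ => hx⟩
      · exact ⟨y 0, fun h => absurd h hi⟩
    choose x hx using this
    refine no_long c d h1 h2 x y _ le_rfl (fun i hi => (hx i hi).1) (fun i hi => (hx i hi).2) ?_
    intro i
    induction i with
    | zero => intro _; exact hy.2.2
    | succ i ih =>
      intro hi t p q
      have b := (hx i (by omega)).2
      have a := (hx i (by omega)).1
      have e1 : t = x i := by
        have ht : c t ≠ none := p.1
        have hd : d t ≠ none := q.1
        rcases lt_trichotomy t (x i) with h | h | h
        · exact (p.2.2.2 (x i) (by rw [b.2.1, p.2.1]) h b.2.2.2.2.1).elim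
        · exact h
        · exact (b.2.2.2.2.2 t (by rw [b.2.1, p.2.1]) hd h p.2.2.1).elim
      subst e1
      have e2 : y i = y (i + 1) := by
        rcases lt_trichotomy (y i) (y (i + 1)) with h | h | h
        · exact (q.2.2.2 (y i) (by rw [a.2.1]) a.2.2.2.2.1 h).elim
        · exact h
        · exact (a.2.2.2.2.2 (y (i + 1)) (by rw [q.2.1]) (by rw [← p.2.1]; exact p.1) q.2.2.1 h).elim
      rw [← e2] at p q
      exact ih (by omega) _ p q
  · rw [← Nat.card_eq_fintype_card, ← Set.ncard_univ]
    let g : E → Option κ ⊕ Option κ := fun y =>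
      if h : ∃ x, Nx d c x y then Sum.inr (c h.choose) else Sum.inl (d y)
    refine Set.ncard_le_ncard_of_injOn g (fun _ _ => Set.mem_univ _) ?_ (Set.toFinite _)
    rintro y ⟨⟨y1, y2, y3⟩, y4⟩ y' ⟨⟨z1, z2, z3⟩, z4⟩ hg
    have first : ∀ a b : E, c a ≠ none → d a ≠ none → d b ≠ none → c b ≠ none → d a = d b → a < b → ∃ x, Nx d c x b := by
      intro a b ha ha' hb hb' hab hlt
      obtain ⟨f, hf, f1, f2, f3⟩ := exists_prev (fun x => d x = d b ∧ c x ≠ none) b a ⟨hab, ha⟩ hlt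
      exact ⟨f, by rw [hf.1]; exact hb, hf.1, hf.2, hb', f1, fun k k1 k2 => f3 k ⟨by rw [k1, hf.1], k2⟩⟩
    have last : ∀ a b : E, c a ≠ none → d a ≠ none → d b ≠ none → c b ≠ none → c a = c b → a < b → ∃ x, Nx c d a x := by
      intro a b ha ha' hb hb' hab hlt
      obtain ⟨f, hf, f1, f2, f3⟩ := exists_next (fun x => c x = c a ∧ d x ≠ none) a b ⟨hab.symm, hb⟩ hlt
      exact ⟨f, ha, hf.1.symm, ha', hf.2, f1, fun k k1 k2 => f3 k ⟨k1, k2⟩⟩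
    by_cases h : ∃ x, Nx d c x y <;> by_cases h' : ∃ x, Nx d c x y'
    · simp only [g, dif_pos h, dif_pos h', Sum.inr.injEq] at hg
      have p := h.choose_spec
      have p' := h'.choose_spec
      generalize h.choose = x at *
      generalize h'.choose = x' at *
      rcases lt_trichotomy x x' with q | q | q
      · obtain ⟨w, hw⟩ := last x x' p.2.2.1 p.1 p'.1 p'.2.2.1 hg q
        exact (y4 w ⟨x, p, hw⟩).elim
      · subst q
        exact Nx_uniq' d c p p'
      · obtain ⟨w, hw⟩ := last x' x p'.2.2.1 p'.1 p.1 p.2.2.1 hg.symm q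
        exact (z4 w ⟨x', p', hw⟩).elim
    · simp [g, dif_pos h, dif_neg h'] at hg
    · simp [g, dif_neg h, dif_pos h'] at hg
    · simp only [g, dif_neg h, dif_neg h', Sum.inl.injEq] at hg
      rcases lt_trichotomy y y' with q | q | q
      · exact (h' (first y y' y1 y2 z2 z1 hg q)).elim
      · exact q
      · exact (h (first y' y z1 z2 y2 y1 hg.symm q)).elim

end
end MB
namespace MB

section
variable {E : Type} [LinearOrder E]

theorem infix_sorted {l : List E} (hl : l.Pairwise (· < ·)) {e f : E} (h : [e, f] <:+: l) :
    e ∈ l ∧ f ∈ l ∧ e < f ∧ ∀ g ∈ l, e < g → g < f → False := by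
  obtain ⟨a, b, rfl⟩ := h
  simp only [List.append_assoc, List.cons_append, List.nil_append, List.pairwise_append,
    List.pairwise_cons, List.mem_cons] at hl
  refine ⟨by simp, by simp, hl.2.1.1 f (Or.inl rfl), ?_⟩
  intro g hg h1 h2
  simp only [List.append_assoc, List.cons_append, List.nil_append, List.mem_append, List.mem_cons] at hg
  rcases hg with h | h | h | h
  · exact lt_asymm h1 (hl.2.2 g h e (Or.inl rfl))
  · exact h1.ne' h
  · exact h2.ne h
  · exact lt_asymm h2 (hl.2.1.2.1 g h)

theorem sorted_infix {l : List E} (hl : l.Pairwise (· < ·)) {e f : E} (he : e ∈ l) (hf : f ∈ l)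
    (hef : e < f) (h : ∀ g ∈ l, e < g → g < f → False) : [e, f] <:+: l := by
  obtain ⟨a, b, rfl⟩ := List.append_of_mem he
  simp only [List.pairwise_append, List.pairwise_cons, List.mem_cons] at hl
  have hfb : f ∈ b := by
    simp only [List.mem_append, List.mem_cons] at hf
    rcases hf with h | h | h
    · exact (lt_asymm hef (hl.2.2 f h e (Or.inl rfl))).elim
    · exact (hef.ne' h).elim
    · exact h
  cases b with
  | nil => simp at hfb
  | cons g b =>
    have hg : f = g := by
      by_contra hne
      have hfb' : f ∈ b := by
        rcases List.mem_cons.mp hfb with h | h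
        · exact absurd h hne
        · exact h
      exact h g (by simp) (hl.2.1.1 g (by simp)) ((List.pairwise_cons.mp hl.2.1.2).1 f hfb')
    subst hg
    exact ⟨a, b, by simp⟩

theorem sorted_head {l : List E} (hl : l.Pairwise (· < ·)) {e : E} (he : e ∈ l.head?) :
    e ∈ l ∧ ∀ g ∈ l, e ≤ g := by
  cases l with
  | nil => simp at he
  | cons a l =>
    simp only [List.head?_cons, Option.mem_def, Option.some.injEq] at he
    subst he
    refine ⟨by simp, fun g hg => ?_⟩
    rcases List.mem_cons.mp hg with h | h
    · exact h.ge
    · exact ((List.pairwise_cons.mp hl).1 g h).le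

theorem sorted_last {l : List E} (hl : l.Pairwise (· < ·)) {e : E} (he : e ∈ l)
    (h : ∀ g ∈ l, g ≤ e) : e ∈ l.getLast? := by
  obtain ⟨a, b, rfl⟩ := List.append_of_mem he
  simp only [List.pairwise_append, List.pairwise_cons, List.mem_cons] at hl
  cases b with
  | nil => simp
  | cons g b =>
    exact (not_lt.mpr (h g (by simp)) (hl.2.1.1 g (by simp))).elim

end

open Classical in
noncomputable def col {E : Type} {n : ℕ} (α : Fin n → List E) (e : E) : Option (Fin n) :=
  if h : ∃ i, e ∈ α i then some h.choose else none

theorem col_iff {E : Type} {n : ℕ} {α : Fin n → List E}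
    (hα : ∀ i j, i ≠ j → ∀ e, e ∈ α i → e ∉ α j) (e : E) (i : Fin n) :
    col α e = some i ↔ e ∈ α i := by
  unfold col
  constructor
  · intro h
    split_ifs at h with h'
    · simp only [Option.some.injEq] at h
      exact h ▸ h'.choose_spec
  · intro h
    have h' : ∃ i, e ∈ α i := ⟨i, h⟩
    rw [dif_pos h']
    by_contra hne
    exact hα _ i (by simpa using hne) e h'.choose_spec h

theorem col_Tr {E : Type} [LinearOrder E] {n : ℕ} {α : Fin n → List E}
    (hα : ∀ i j, i ≠ j → ∀ e, e ∈ α i → e ∉ α j) (hs : ∀ i, (α i).Pairwise (· < ·)) (e f : E) :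
    Tr (col α) e f ↔ ∃ i, [e, f] <:+: α i := by
  constructor
  · rintro ⟨h1, h2, h3, h4⟩
    obtain ⟨i, hi⟩ := Option.ne_none_iff_exists'.mp h1
    refine ⟨i, sorted_infix (hs i) ((col_iff hα e i).1 hi) ((col_iff hα f i).1 (h2 ▸ hi)) h3 ?_⟩
    intro g hg
    exact h4 g (by rw [hi, col_iff hα]; exact hg)
  · rintro ⟨i, h⟩
    obtain ⟨a, b, c, d⟩ := infix_sorted (hs i) h
    have ha := (col_iff hα e i).2 a
    have hb := (col_iff hα f i).2 b
    refine ⟨by simp [ha], by rw [ha, hb], c, fun g hg => d g ?_⟩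
    rw [ha] at hg
    exact (col_iff hα g i).1 hg

theorem exists_order (G : MultiDigraph) (hG : G.Acyclic) :
    ∃ _ : LinearOrder G.E, ∀ e f, G.dst e = G.src f → e < f := by
  classical
  have := G.fintE
  let r : G.E → G.E → Prop := fun e f => G.dst e = G.src f
  have hp : ∀ e f, Relation.TransGen r e f → ∃ p, G.IsPathFrom (G.src e) (G.src f) p := by
    intro e f h
    induction h with
    | single h =>
      refine ⟨[e], by simp, List.isChain_singleton _, by simp, ?_⟩
      simpa using h
    | tail hab hbc ih =>
      obtain ⟨p, h1, h2, h3, h4⟩ := ih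
      rename_i b c
      refine ⟨p ++ [b], by simp, ?_, ?_, ?_⟩
      · refine List.IsChain.append h2 (by simp) ?_
        intro x hx y hy
        simp at hy
        subst hy
        exact h4 x hx
      · intro x hx
        cases p with
        | nil => exact absurd rfl h1
        | cons a p => exact h3 x (by simpa using hx)
      · simpa using hbc
  have hirr : ∀ e, ¬ Relation.TransGen r e e := fun e h => by
    obtain ⟨p, hp⟩ := hp e e h
    exact hG _ p hp
  let ht : G.E → ℕ := fun e => (Finset.univ.filter (fun f => Relation.TransGen r f e)).card
  have hht : ∀ e f, r e f → ht e < ht f := by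
    intro e f h
    apply Finset.card_lt_card
    rw [Finset.ssubset_iff_of_subset]
    · refine ⟨e, ?_, ?_⟩
      · simpa using Relation.TransGen.single h
      · simpa using hirr e
    · intro x hx
      simp only [Finset.mem_filter, Finset.mem_univ, true_and] at hx ⊢
      exact hx.tail h
  let em : G.E → ℕ ×ₗ Fin (Fintype.card G.E) := fun e => toLex (ht e, Fintype.equivFin G.E e)
  have hem : Function.Injective em := by
    intro a b h
    have := congrArg (fun x => (ofLex x).2) h
    exact (Fintype.equivFin G.E).injective this
  refine ⟨LinearOrder.lift' em hem, fun e f h => ?_⟩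
  show em e < em f
  exact Prod.Lex.toLex_lt_toLex.mpr (Or.inl (hht e f h))

theorem sys_sorted (G : MultiDigraph) [LinearOrder G.E] (ho : ∀ e f, G.dst e = G.src f → e < f)
    {u v : G.V} {n : ℕ} {α : Fin n → List G.E} (h : G.MengerSystem u v n α) (i : Fin n) :
    (α i).Pairwise (· < ·) := by
  have h1 := (h.1 i).2.1
  exact List.isChain_iff_pairwise.mp (List.IsChain.imp (fun a b => ho a b) h1)

theorem decomp (G : MultiDigraph) [LinearOrder G.E] [Finite G.E]
    (ho : ∀ e f, G.dst e = G.src f → e < f)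
    {u v u' v' : G.V} {n : ℕ} {α β : Fin n → List G.E} (hα : G.MengerSystem u' v' n α)
    (h : G.MengerSystem u v n β)
    (F : G.E → G.E → Prop) (B : G.E → Prop)
    (h1 : ∀ e f, F e f → Tr (col α) e f ∨ Tr (col β) e f)
    (h2 : ∀ e f, B e → F e f → B f)
    (h3 : ∀ e f z, F e z → F f z → e = f)
    (h4 : ∀ s, col β s ≠ none → (∀ g, col β g = col β s → s ≤ g) → B s ∧ ∀ e, ¬ F e s)
    (h5 : ∀ e, B e → (∀ f, ¬ F e f) → col β e ≠ none ∧ ∀ g, col β g = col β e → g ≤ e) :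
    ∃ β' : Fin n → List G.E, G.MengerSystem u v n β' ∧ ∀ i e f, [e, f] <:+: β' i → F e f := by
  have hadj : ∀ e f, F e f → G.dst e = G.src f := by
    intro e f hF
    have inf : ∀ {u v : G.V} {γ : Fin n → List G.E}, G.MengerSystem u v n γ → Tr (col γ) e f →
        G.dst e = G.src f := by
      intro u v γ hγ ht
      obtain ⟨i, hi⟩ := (col_Tr hγ.2 (sys_sorted G ho hγ) e f).1 ht
      have := List.IsChain.infix (hγ.1 i).2.1 hi
      simpa using this
    rcases h1 e f hF with h' | h'
    · exact inf hα h'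
    · exact inf h h'
  have hpath : ∀ e, B e → ∃ p : List G.E, p.IsChain F ∧ p.head? = some e ∧
      ∀ x ∈ p.getLast?, G.dst x = v := by
    intro e
    induction e using WellFoundedGT.induction with
    | ind e ih =>
    intro he
    by_cases hf : ∃ f, F e f
    · obtain ⟨f, hf⟩ := hf
      obtain ⟨p, p1, p2, p3⟩ := ih f (ho _ _ (hadj _ _ hf)) (h2 e f he hf)
      cases p with
      | nil => simp at p2
      | cons a p =>
        simp only [List.head?_cons, Option.some.injEq] at p2
        subst p2
        refine ⟨e :: a :: p, by simp [hf, p1], by simp, ?_⟩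
        simpa using p3
    · push Not at hf
      obtain ⟨q1, q2⟩ := h5 e he hf
      refine ⟨[e], by simp, by simp, ?_⟩
      intro x hx
      simp at hx
      subst hx
      obtain ⟨i, hi⟩ := Option.ne_none_iff_exists'.mp q1
      refine (h.1 i).2.2.2 e (sorted_last (sys_sorted G ho h i) ((col_iff h.2 e i).1 hi) ?_)
      intro g hg
      exact q2 g (by rw [hi]; exact (col_iff h.2 g i).2 hg)
  have hst : ∀ i, ∃ s, (β i).head? = some s := by
    intro i
    cases hh : β i with
    | nil => exact absurd hh (h.1 i).1
    | cons a l => exact ⟨a, rfl⟩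
  choose s hs using hst
  have hs' : ∀ i, s i ∈ β i ∧ ∀ g ∈ β i, s i ≤ g := fun i => sorted_head (sys_sorted G ho h i) (hs i)
  have hs4 : ∀ i, B (s i) ∧ ∀ e, ¬ F e (s i) := by
    intro i
    have hi := (col_iff h.2 (s i) i).2 (hs' i).1
    refine h4 (s i) (by simp [hi]) fun g hg => (hs' i).2 g ?_
    rw [hi] at hg
    exact (col_iff h.2 g i).1 hg
  choose p p1 p2 p3 using fun i => hpath (s i) (hs4 i).1
  have hreach : ∀ i, ∀ e ∈ p i, Relation.ReflTransGen F (s i) e := by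
    intro i e he
    have key : ∀ (l : List G.E) (a : G.E), (a :: l).IsChain F → ∀ e ∈ a :: l, Relation.ReflTransGen F a e := by
      intro l
      induction l with
      | nil => intro a _ e he; simp at he; subst he; exact .refl
      | cons b l ih =>
        intro a hc e he
        rw [List.isChain_cons_cons] at hc
        rcases List.mem_cons.mp he with h | h
        · subst h; exact .refl
        · exact Relation.ReflTransGen.head hc.1 (ih b hc.2 e h)
    have q1 := p1 i
    have q2 := p2 i
    cases hp : p i with
    | nil => rw [hp] at he; simp at he
    | cons a l =>
      rw [hp] at q1 q2 he
      simp only [List.head?_cons, Option.some.injEq] at q2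
      rw [← q2]
      exact key l a q1 e he
  refine ⟨p, ⟨fun i => ⟨?_, ?_, ?_, p3 i⟩, ?_⟩, ?_⟩
  · intro hp
    have q2 := p2 i
    rw [hp] at q2
    simp at q2
  · exact List.IsChain.imp hadj (p1 i)
  · intro e he
    rw [p2 i] at he
    simp only [Option.mem_def, Option.some.injEq] at he
    subst he
    exact (h.1 i).2.2.1 _ (hs i)
  · intro i j hij e hei hej
    have a := hreach i e hei
    have b := hreach j e hej
    have heq : s i = s j := by
      have a' := Relation.reflTransGen_swap.mpr a
      have b' := Relation.reflTransGen_swap.mpr b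
      rcases Relation.ReflTransGen.total_of_right_unique (fun x y z hx hy => h3 y z x hx hy) a' b' with t | t
      · rcases Relation.ReflTransGen.cases_head t with q | ⟨q, q1, q2⟩
        · exact q
        · exact ((hs4 i).2 q q1).elim
      · rcases Relation.ReflTransGen.cases_head t with q | ⟨q, q1, q2⟩
        · exact q.symm
        · exact ((hs4 j).2 q q1).elim
    exact h.2 i j hij (s i) (hs' i).1 (heq ▸ (hs' j).1)
  · intro i e f hi
    have := List.IsChain.infix (p1 i) hi
    simpa using this

/-- transitions used by a pair of systems -/
def trs {E : Type} {n : ℕ} (α β : Fin n → List E) : Set (E × E) :=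
  {t | (∃ i, [t.1, t.2] <:+: α i) ∨ ∃ i, [t.1, t.2] <:+: β i}

theorem trs_comm {E : Type} {n : ℕ} (α β : Fin n → List E) : trs α β = trs β α := by
  ext t; simp only [trs, Set.mem_ofPred_eq]; exact or_comm

theorem cheaper (G : MultiDigraph) [LinearOrder G.E] [Finite G.E]
    (ho : ∀ e f, G.dst e = G.src f → e < f)
    {u v u' v' : G.V} {n : ℕ} {α β : Fin n → List G.E} (hα : G.MengerSystem u' v' n α)
    (h : G.MengerSystem u v n β) (hr : Reroute (col α) (col β)) :
    ∃ β' : Fin n → List G.E, G.MengerSystem u v n β' ∧ (trs α β').ncard < (trs α β).ncard := by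
  obtain ⟨F, B, h1, h2, h3, h4, h5, z, w, h6, h7, h8⟩ := hr
  obtain ⟨β', hβ', hF⟩ := decomp G ho hα h F B h1 h2 h3 h4 h5
  have ta := col_Tr hα.2 (sys_sorted G ho hα)
  have tb := col_Tr h.2 (sys_sorted G ho h)
  refine ⟨β', hβ', Set.ncard_lt_ncard ?_ (Set.toFinite _)⟩
  rw [Set.ssubset_iff_of_subset]
  · refine ⟨(z, w), Or.inr ((tb z w).1 h6), ?_⟩
    rintro (hh | ⟨i, hh⟩)
    · exact h7 ((ta z w).2 hh)
    · exact h8 (hF i z w hh)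
  · rintro ⟨e, f⟩ (hh | ⟨i, hh⟩)
    · exact Or.inl hh
    · rcases h1 e f (hF i e f hh) with q | q
      · exact Or.inl ((ta e f).1 q)
      · exact Or.inr ((tb e f).1 q)

def bd (n : ℕ) : ℕ := Fintype.card (Option (Fin n) × Option (Fin n)) * Fintype.card (Option (Fin n) ⊕ Option (Fin n))

theorem exists_good_pair (G : MultiDigraph) (hG : G.Acyclic) {u v u' v' : G.V} {n : ℕ}
    (h : ∃ α, G.MengerSystem u v n α) (h' : ∃ α, G.MengerSystem u' v' n α) :
    ∃ α β, G.MengerSystem u v n α ∧ G.MengerSystem u' v' n β ∧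
      {e : G.E | ∃ (a b : Fin n) (f g : G.E), f ≠ g ∧ [f, e] <:+: α a ∧ [g, e] <:+: β b}.ncard ≤ bd n := by
  classical
  have := G.fintE
  obtain ⟨_, ho⟩ := exists_order G hG
  obtain ⟨α0, hα0⟩ := h
  obtain ⟨β0, hβ0⟩ := h'
  have hex : ∃ k, ∃ α β, G.MengerSystem u v n α ∧ G.MengerSystem u' v' n β ∧ (trs α β).ncard = k :=
    ⟨_, α0, β0, hα0, hβ0, rfl⟩
  obtain ⟨α, β, hα, hβ, hk⟩ := Nat.find_spec hex
  refine ⟨α, β, hα, hβ, ?_⟩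
  have r1 : ¬ Reroute (col α) (col β) := by
    intro hr
    obtain ⟨β', hβ', hlt⟩ := cheaper G ho hα hβ hr
    exact Nat.find_min hex (hk ▸ hlt) ⟨α, β', hα, hβ', rfl⟩
  have r2 : ¬ Reroute (col β) (col α) := by
    intro hr
    obtain ⟨α', hα', hlt⟩ := cheaper G ho hβ hα hr
    rw [trs_comm, trs_comm β α] at hlt
    exact Nat.find_min hex (hk ▸ hlt) ⟨α', β, hα', hβ, rfl⟩
  refine le_trans (Set.ncard_le_ncard ?_ (Set.toFinite _)) (run_bound (col α) (col β) r1 r2)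
  rintro e ⟨a, b, f, g, hfg, hf, hg⟩
  have ta := col_Tr hα.2 (sys_sorted G ho hα)
  have tb := col_Tr hβ.2 (sys_sorted G ho hβ)
  have hf' := (ta f e).2 ⟨a, hf⟩
  have hg' := (tb g e).2 ⟨b, hg⟩
  refine ⟨hf'.2.1 ▸ hf'.1, hg'.2.1 ▸ hg'.1, fun z hz hz' => hfg ?_⟩
  have uniq : ∀ (k : G.E → Option (Fin n)) e f z, Tr k e z → Tr k f z → e = f := by
    intro k e f z h1 h2
    rcases lt_trichotomy e f with h | h | h
    · exact (h1.2.2.2 f (by rw [h2.2.1, h1.2.1]) h h2.2.2.1).elim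
    · exact h
    · exact (h2.2.2.2 e (by rw [h2.2.1, h1.2.1]) h h1.2.2.1).elim
  rw [uniq _ f z e hf' hz, uniq _ g z e hg' hz']

/-- Glue two systems. -/
def pair {E : Type} {n : ℕ} (α β : Fin n → List E) : (i : Fin 2) → Fin (![n, n] i) → List E
  | 0 => α
  | 1 => β

theorem mergingEdge_iff (G : MultiDigraph) {n : ℕ} (α : (i : Fin 2) → Fin (![n, n] i) → List G.E) (e : G.E) :
    G.MergingEdge α e ↔ ∃ (a b : Fin n) (f g : G.E), f ≠ g ∧ [f, e] <:+: α 0 a ∧ [g, e] <:+: α 1 b := by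
  constructor
  · rintro ⟨i, j, hij, a, b, f, g, h1, h2, h3⟩
    fin_cases i <;> fin_cases j
    · exact absurd rfl hij
    · exact ⟨a, b, f, g, h1, h2, h3⟩
    · exact ⟨b, a, g, f, h1.symm, h3, h2⟩
    · exact absurd rfl hij
  · rintro ⟨a, b, f, g, h1, h2, h3⟩
    exact ⟨0, 1, by simp, a, b, f, g, h1, h2, h3⟩

theorem bdd (n : ℕ) : BddAbove {k : ℕ | ∃ (G : MultiDigraph) (S R : Fin 2 → G.V),
    GoodConfig G S R ![n, n] ∧ Function.Injective S ∧ minMergings G S R ![n, n] = k} := by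
  refine ⟨bd n, ?_⟩
  rintro k ⟨G, S, R, ⟨hG, hR, hc⟩, hS, rfl⟩
  obtain ⟨α, β, hα, hβ, hle⟩ := exists_good_pair G hG (hc 0).1 (hc 1).1
  refine le_trans (Nat.sInf_le ⟨pair α β, ?_, rfl⟩) ?_
  · intro i
    fin_cases i
    · exact hα
    · exact hβ
  · unfold MultiDigraph.mergingCount
    simp only [mergingEdge_iff]
    exact hle

end MB
namespace MB

/-- walks, possibly empty -/
def Wk (G : MultiDigraph) : G.V → G.V → List G.E → Prop
  | u, v, [] => u = v
  | u, v, e :: p => G.src e = u ∧ Wk G (G.dst e) v p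

theorem isPath_iff (G : MultiDigraph) (u v : G.V) (p : List G.E) :
    G.IsPathFrom u v p ↔ p ≠ [] ∧ Wk G u v p := by
  induction p generalizing u with
  | nil => simp [MultiDigraph.IsPathFrom]
  | cons e p ih =>
    cases p with
    | nil => 
      constructor
      · rintro ⟨h1, h2, h3, h4⟩
        exact ⟨h1, h3 e rfl, h4 e rfl⟩
      · rintro ⟨h1, h2, h3⟩
        refine ⟨h1, List.isChain_singleton _, ?_, ?_⟩
        · intro x hx; simp at hx; subst hx; exact h2
        · intro x hx; simp at hx; subst hx; exact h3
    | cons f p =>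
      have := ih (G.dst e)
      constructor
      · rintro ⟨h1, h2, h3, h4⟩
        have h2' := List.isChain_cons_cons.mp h2
        refine ⟨by simp, h3 e rfl, (this.1 ⟨by simp, h2'.2, ?_, ?_⟩).2⟩
        · intro x hx; simp at hx; subst hx; exact h2'.1.symm
        · intro x hx; exact h4 x (by simpa using hx)
      · rintro ⟨h1, h2, h3⟩
        obtain ⟨q1, q2, q3, q4⟩ := this.2 ⟨by simp, h3⟩
        refine ⟨by simp, List.isChain_cons_cons.mpr ⟨(q3 f rfl).symm, q2⟩, ?_, ?_⟩
        · intro x hx; simp at hx; subst hx; exact h2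
        · intro x hx; exact q4 x (by simpa using hx)

theorem Wk_append (G : MultiDigraph) (u v w : G.V) (p q : List G.E) (h1 : Wk G u v p)
    (h2 : Wk G v w q) : Wk G u w (p ++ q) := by
  induction p generalizing u with
  | nil => cases h1; exact h2
  | cons e p ih => exact ⟨h1.1, ih _ h1.2⟩

theorem acyclic_of_rank (G : MultiDigraph) {X : Type} [Preorder X] (h : G.E → X)
    (hh : ∀ e f, G.dst e = G.src f → h e < h f) : G.Acyclic := by
  rintro v p ⟨h1, h2, h3, h4⟩
  have hc : (p.map h).Pairwise (· < ·) := by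
    apply List.isChain_iff_pairwise.mp
    rw [List.isChain_map]
    exact List.IsChain.imp hh h2
  have hl : p.getLast h1 ∈ p.getLast? := by simp [List.getLast?_eq_some_getLast h1]
  have hd := h4 _ hl
  cases p with
  | nil => exact h1 rfl
  | cons a p =>
    have ha := h3 a rfl
    have hlt := hh _ a (hd.trans ha.symm)
    rcases List.mem_cons.mp (List.getLast_mem h1) with q | q
    · rw [q] at hlt
      exact lt_irrefl _ hlt
    · rw [List.map_cons, List.pairwise_cons] at hc
      exact lt_asymm hlt (hc.1 _ (List.mem_map_of_mem q))

theorem exists_rank (G : MultiDigraph) (hG : G.Acyclic) :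
    ∃ h : G.E → ℤ, ∀ e f, G.dst e = G.src f → h e < h f := by
  classical
  have := G.fintE
  obtain ⟨_, ho⟩ := exists_order G hG
  refine ⟨fun e => ((Finset.univ.filter (· < e)).card : ℤ), fun e f hef => ?_⟩
  have hlt := ho e f hef
  simp only [Nat.cast_lt]
  apply Finset.card_lt_card
  rw [Finset.ssubset_iff_of_subset]
  · exact ⟨e, by simpa using hlt, by simp⟩
  · intro x hx
    simp only [Finset.mem_filter, Finset.mem_univ, true_and] at hx ⊢
    exact hx.trans hlt

inductive BV (V : Type) : Type
  | p (i : Fin 2)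
  | l (v : V)
  | r (v : V)

inductive BE (E : Type) (n : ℕ) : Type
  | st (i : Fin 2) (k : Fin n)
  | lf (e : E)
  | cn (k : Fin n)
  | rt (e : E)

instance {V : Type} [Finite V] : Finite (BV V) := by
  refine Finite.of_injective (β := Fin 2 ⊕ V ⊕ V) (fun x => match x with
    | .p i => Sum.inl i
    | .l v => Sum.inr (Sum.inl v)
    | .r v => Sum.inr (Sum.inr v)) ?_
  rintro (a | a | a) (b | b | b) h <;> simp_all

instance {E : Type} {n : ℕ} [Finite E] : Finite (BE E n) := by
  refine Finite.of_injective (β := (Fin 2 × Fin n) ⊕ E ⊕ E ⊕ Fin n) (fun x => match x with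
    | .st i k => Sum.inl (i, k)
    | .lf v => Sum.inr (Sum.inl v)
    | .rt v => Sum.inr (Sum.inr (Sum.inl v))
    | .cn k => Sum.inr (Sum.inr (Sum.inr k))) ?_
  rintro (⟨a, a'⟩ | a | a | a) (⟨b, b'⟩ | b | b | b) h <;> simp_all

/-- reversed copy of `G`, glued to a copy of `G` through `n` edges -/
noncomputable abbrev Big (G : MultiDigraph) (s : G.V) (R : Fin 2 → G.V) (n : ℕ) : MultiDigraph where
  V := BV G.V
  E := BE G.E n
  fintV := by
    have := G.fintV
    exact Fintype.ofFinite _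
  fintE := by
    have := G.fintE
    exact Fintype.ofFinite _
  src := fun e => match e with
    | .st i _ => .p i
    | .lf e => .l (G.dst e)
    | .cn _ => .l s
    | .rt e => .r (G.src e)
  dst := fun e => match e with
    | .st i _ => .l (R i)
    | .lf e => .l (G.src e)
    | .cn _ => .r s
    | .rt e => .r (G.dst e)

section
variable (G : MultiDigraph) (s : G.V) (R : Fin 2 → G.V) (n : ℕ)

theorem big_acyclic (hG : G.Acyclic) : (Big G s R n).Acyclic := by
  obtain ⟨h, hh⟩ := exists_rank G hG
  refine acyclic_of_rank (Big G s R n) (X := ℕ ×ₗ ℤ) (fun e => match e with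
    | .st _ _ => toLex (0, 0)
    | .lf e => toLex (1, - h e)
    | .cn _ => toLex (2, 0)
    | .rt e => toLex (3, h e)) ?_
  rintro (⟨a, a'⟩ | a | a | a) (⟨b, b'⟩ | b | b | b) hab <;>
    simp [Big, Prod.Lex.toLex_lt_toLex] at hab ⊢
  · exact hh _ _ hab.symm
  · exact hh _ _ hab

theorem wk_right (u w : G.V) (q : List (BE G.E n)) (h : Wk (Big G s R n) (.r u) (.r w) q) :
    ∃ b : List G.E, q = b.map .rt ∧ Wk G u w b := by
  induction q generalizing u with
  | nil => 
    cases h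
    exact ⟨[], rfl, rfl⟩
  | cons e q ih =>
    obtain ⟨h1, h2⟩ := h
    cases e with
    | st i k => simp [Big] at h1
    | lf e => simp [Big] at h1
    | cn k => simp [Big] at h1
    | rt e =>
      obtain ⟨b, hb, hb'⟩ := ih _ h2
      simp [Big] at h1
      exact ⟨e :: b, by simp [hb], h1, hb'⟩

theorem wk_right' (u w : G.V) (b : List G.E) (h : Wk G u w b) :
    Wk (Big G s R n) (.r u) (.r w) (b.map .rt) := by
  induction b generalizing u with
  | nil => cases h; rfl
  | cons e b ih => exact ⟨congrArg BV.r h.1, ih _ h.2⟩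

theorem wk_left (u w : G.V) (q : List (BE G.E n)) (h : Wk (Big G s R n) (.l u) (.r w) q) :
    ∃ (a : List G.E) (j : Fin n) (b : List G.E), q = a.map .lf ++ .cn j :: b.map .rt ∧
      Wk G s u a.reverse ∧ Wk G s w b := by
  induction q generalizing u with
  | nil => cases h
  | cons e q ih =>
    obtain ⟨h1, h2⟩ := h
    cases e with
    | st i k => simp [Big] at h1
    | rt e => simp [Big] at h1
    | cn k =>
      simp [Big] at h1
      obtain ⟨b, hb, hb'⟩ := wk_right G s R n s w q h2
      exact ⟨[], k, b, by simp [hb], h1, hb'⟩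
    | lf e =>
      simp [Big] at h1
      obtain ⟨a, j, b, hq, ha, hb⟩ := ih _ h2
      refine ⟨e :: a, j, b, by simp [hq], ?_, hb⟩
      rw [List.reverse_cons]
      exact Wk_append G _ _ _ _ _ ha ⟨rfl, h1⟩

theorem wk_left' (u v : G.V) (a : List G.E) (h : Wk G v u a) :
    Wk (Big G s R n) (.l u) (.l v) (a.reverse.map .lf) := by
  induction a generalizing v with
  | nil => cases h; rfl
  | cons e a ih =>
    rw [List.reverse_cons, List.map_append]
    refine Wk_append _ _ _ _ _ _ (ih _ h.2) ⟨rfl, congrArg BV.l h.1⟩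

theorem big_path (i : Fin 2) (w : G.V) (q : List (BE G.E n))
    (h : (Big G s R n).IsPathFrom (.p i) (.r w) q) :
    ∃ (k : Fin n) (a : List G.E) (j : Fin n) (b : List G.E),
      q = .st i k :: (a.map .lf ++ .cn j :: b.map .rt) ∧
      Wk G s (R i) a.reverse ∧ Wk G s w b := by
  rw [isPath_iff] at h
  cases q with
  | nil => exact absurd rfl h.1
  | cons e q =>
    obtain ⟨-, h1, h2⟩ := h
    cases e with
    | lf e => simp [Big] at h1
    | rt e => simp [Big] at h1
    | cn e => simp [Big] at h1
    | st i' k =>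
      simp [Big] at h1
      subst h1
      obtain ⟨a, j, b, hq, ha, hb⟩ := wk_left G s R n _ w q h2
      exact ⟨k, a, j, b, by simp [hq], ha, hb⟩

theorem big_minCut (i : Fin 2) (h : G.MinCut s (R i) n) :
    (Big G s R n).MinCut (.p i) (.r (R i)) n := by
  constructor
  · obtain ⟨α, hα1, hα2⟩ := h.1
    refine ⟨fun x => .st i x :: ((α x).reverse.map .lf ++ .cn x :: (α x).map .rt), ?_, ?_⟩
    · intro x
      rw [isPath_iff]
      have hx := ((isPath_iff _ _ _ _).1 (hα1 x)).2
      refine ⟨by simp, rfl, ?_⟩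
      refine Wk_append _ _ _ _ _ _ (wk_left' G s R n _ _ _ hx) ⟨rfl, wk_right' G s R n _ _ _ hx⟩
    · intro x y hxy e hx hy
      cases e with
      | st i' k => simp at hx hy; exact hxy (hx.2.symm.trans hy.2)
      | cn k => simp at hx hy; exact hxy (hx.symm.trans hy)
      | lf e => simp at hx hy; exact hα2 x y hxy e hx hy
      | rt e => simp at hx hy; exact hα2 x y hxy e hx hy
  · rintro ⟨α, hα1, hα2⟩
    choose k a j b hq ha hb using fun x => big_path G s R n i _ _ (hα1 x)
    obtain ⟨x, y, hxy, he⟩ := Fintype.exists_ne_map_eq_of_card_lt j (by simp)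
    refine hα2 x y hxy (.cn (j x)) ?_ ?_
    · rw [hq]; simp
    · rw [hq, he]; simp

theorem big_system (i : Fin 2) (hne : s ≠ R i) (α : Fin n → List (BE G.E n))
    (h : (Big G s R n).MengerSystem (.p i) (.r (R i)) n α) :
    ∃ (k : Fin n → Fin n) (a : Fin n → List G.E) (j : Fin n → Fin n) (b : Fin n → List G.E),
      (∀ x, α x = .st i (k x) :: ((a x).map .lf ++ .cn (j x) :: (b x).map .rt)) ∧
      Function.Surjective j ∧ G.MengerSystem s (R i) n (fun x => (a x).reverse) ∧
      G.MengerSystem s (R i) n b := by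
  obtain ⟨hα1, hα2⟩ := h
  choose k a j b hq ha hb using fun x => big_path G s R n i _ _ (hα1 x)
  refine ⟨k, a, j, b, hq, ?_, ⟨?_, ?_⟩, ⟨?_, ?_⟩⟩
  · apply Finite.surjective_of_injective
    intro x y he
    by_contra hxy
    refine hα2 x y hxy (.cn (j x)) ?_ ?_
    · rw [hq]; simp
    · rw [hq, he]; simp
  · intro x
    rw [isPath_iff]
    refine ⟨fun h0 => ?_, ha x⟩
    have h0 : (a x).reverse = [] := h0
    have := ha x
    rw [h0] at this
    exact hne this
  · intro x y hxy e hx hy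
    simp only [List.mem_reverse] at hx hy
    refine hα2 x y hxy (.lf e) ?_ ?_
    · rw [hq]; simp [hx]
    · rw [hq]; simp [hy]
  · intro x
    rw [isPath_iff]
    refine ⟨fun h0 => ?_, hb x⟩
    have := hb x
    rw [h0] at this
    exact hne this
  · intro x y hxy e hx hy
    refine hα2 x y hxy (.rt e) ?_ ?_
    · rw [hq]; simp [hx]
    · rw [hq]; simp [hy]

theorem exists_pred {E : Type} (h e : E) (l : List E) (he : e ∈ l) : ∃ f, [f, e] <:+: h :: l := by
  induction l generalizing h with
  | nil => simp at he
  | cons a l ih =>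
    by_cases hea : e = a
    · subst hea
      exact ⟨h, [], l, by simp⟩
    · obtain ⟨f, hf⟩ := ih a (by simpa [hea] using he)
      exact ⟨f, hf.trans (List.suffix_cons h _).isInfix⟩

/-- counting ends versus starts of a partial injection -/
theorem ends_le_starts {X : Type} [Finite X] (Y : Set X) (A : X → X → Prop)
    (hu : ∀ e f f', A e f → A e f' → f = f') :
    {e ∈ Y | ∀ f ∈ Y, ¬ A e f}.ncard ≤ {f ∈ Y | ∀ e ∈ Y, ¬ A e f}.ncard := by
  classical
  have h1 : {e ∈ Y | ∀ f ∈ Y, ¬ A e f}.ncard + {e ∈ Y | ∃ f ∈ Y, A e f}.ncard = Y.ncard := by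
    rw [← Set.ncard_union_eq _ (Set.toFinite _) (Set.toFinite _)]
    · congr 1; ext e
      constructor
      · rintro (h | h) <;> exact h.1
      · intro h
        by_cases h' : ∃ f ∈ Y, A e f
        · exact Or.inr ⟨h, h'⟩
        · push Not at h'
          exact Or.inl ⟨h, h'⟩
    · rw [Set.disjoint_left]
      rintro e ⟨_, h⟩ ⟨_, f, hf, h'⟩
      exact h f hf h'
  have h2 : {f ∈ Y | ∀ e ∈ Y, ¬ A e f}.ncard + {f ∈ Y | ∃ e ∈ Y, A e f}.ncard = Y.ncard := by
    rw [← Set.ncard_union_eq _ (Set.toFinite _) (Set.toFinite _)]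
    · congr 1; ext e
      constructor
      · rintro (h | h) <;> exact h.1
      · intro h
        by_cases h' : ∃ f ∈ Y, A f e
        · exact Or.inr ⟨h, h'⟩
        · push Not at h'
          exact Or.inl ⟨h, h'⟩
    · rw [Set.disjoint_left]
      rintro e ⟨_, h⟩ ⟨_, f, hf, h'⟩
      exact h f hf h'
  have h3 : {f ∈ Y | ∃ e ∈ Y, A e f}.ncard ≤ {e ∈ Y | ∃ f ∈ Y, A e f}.ncard := by
    refine Set.ncard_le_ncard_of_injOn
      (fun f => if h : ∃ e ∈ Y, A e f then h.choose else f) ?_ ?_ (Set.toFinite _)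
    · rintro f ⟨hf, h⟩
      simp only [dif_pos h]
      exact ⟨h.choose_spec.1, f, hf, h.choose_spec.2⟩
    · rintro f ⟨hf, h⟩ f' ⟨hf', h'⟩ heq
      simp only [dif_pos h, dif_pos h'] at heq
      have a := h.choose_spec.2
      have b := h'.choose_spec.2
      rw [← heq] at b
      exact hu _ _ _ a b
  omega

theorem succ_uniq (H : MultiDigraph) (hH : H.Acyclic) {u v : H.V} {m : ℕ} {α : Fin m → List H.E}
    (h : H.MengerSystem u v m α) {e f f' : H.E} {i j : Fin m} (h1 : [e, f] <:+: α i)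
    (h2 : [e, f'] <:+: α j) : f = f' := by
  obtain ⟨_, ho⟩ := exists_order H hH
  have t := col_Tr h.2 (sys_sorted H ho h)
  have a := (t e f).2 ⟨i, h1⟩
  have b := (t e f').2 ⟨j, h2⟩
  rcases lt_trichotomy f f' with q | q | q
  · exact (b.2.2.2 f a.2.1.symm a.2.2.1 q).elim
  · exact q
  · exact (a.2.2.2 f' b.2.1.symm b.2.2.1 q).elim

theorem adj_of_infix (H : MultiDigraph) {u v : H.V} {m : ℕ} {α : Fin m → List H.E}
    (h : H.MengerSystem u v m α) {e f : H.E} {i : Fin m} (h1 : [e, f] <:+: α i) :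
    H.dst e = H.src f := by
  have := List.IsChain.infix (h.1 i).2.1 h1
  simpa using this

theorem infix_map {X Y : Type} (g : X → Y) {e f : X} {l : List X} (h : [e, f] <:+: l) :
    [g e, g f] <:+: l.map g := by
  obtain ⟨a, b, rfl⟩ := h
  exact ⟨a.map g, b.map g, by simp⟩

theorem infix_rev {X : Type} {e f : X} {l : List X} (h : [e, f] <:+: l.reverse) :
    [f, e] <:+: l := by
  obtain ⟨a, b, hab⟩ := h
  refine ⟨b.reverse, a.reverse, ?_⟩
  rw [← List.reverse_reverse l, ← hab]
  simp

theorem big_count (hG : G.Acyclic) (hne : ∀ i, s ≠ R i) (m : ℕ)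
    (hm : ∀ α β : Fin n → List G.E, G.MengerSystem s (R 0) n α → G.MengerSystem s (R 1) n β →
      m ≤ {e : G.E | ∃ (a b : Fin n) (f g : G.E), f ≠ g ∧ [f, e] <:+: α a ∧ [g, e] <:+: β b}.ncard)
    (α β : Fin n → List (BE G.E n))
    (hα : (Big G s R n).MengerSystem (.p 0) (.r (R 0)) n α)
    (hβ : (Big G s R n).MengerSystem (.p 1) (.r (R 1)) n β) :
    2 * m + n ≤ {e : BE G.E n | ∃ (a b : Fin n) (f g : BE G.E n),
      f ≠ g ∧ [f, e] <:+: α a ∧ [g, e] <:+: β b}.ncard := by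
  classical
  have := G.fintE
  obtain ⟨k, a, j, b, hq, hj, ha, hb⟩ := big_system G s R n 0 (hne 0) α hα
  obtain ⟨k', a', j', b', hq', hj', ha', hb'⟩ := big_system G s R n 1 (hne 1) β hβ
  have hH := big_acyclic G s R n hG
  set MR : Set G.E := {e : G.E | ∃ (x y : Fin n) (f g : G.E), f ≠ g ∧ [f, e] <:+: b x ∧ [g, e] <:+: b' y} with hMR
  set ML : Set G.E := {e : G.E | ∃ (x y : Fin n) (f g : G.E), f ≠ g ∧ [f, e] <:+: (a x).reverse ∧ [g, e] <:+: (a' y).reverse} with hML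
  have cR : m ≤ MR.ncard := hm b b' hb hb'
  have cL : m ≤ ML.ncard := hm _ _ ha ha'
  let Y : Set (BE G.E n) := {e | (∀ f, e ≠ .rt f) ∧ (∀ i k, e ≠ .st i k) ∧ (∃ x, e ∈ α x) ∧ ∃ y, e ∈ β y}
  let A : BE G.E n → BE G.E n → Prop := fun e f => (∃ x, [e, f] <:+: α x) ∧ ∃ y, [e, f] <:+: β y
  have hes := ends_le_starts Y A (fun e f f' h1 h2 => by
    obtain ⟨⟨x, hx⟩, -⟩ := h1
    obtain ⟨⟨x', hx'⟩, -⟩ := h2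
    exact succ_uniq (Big G s R n) hH hα hx hx')
  have inL : ∀ x e f, [e, f] <:+: a x → [BE.lf e, BE.lf f] <:+: α x := by
    intro x e f h
    rw [hq]
    exact (infix_map BE.lf h).trans ⟨[.st 0 (k x)], .cn (j x) :: (b x).map .rt, by simp⟩
  have inL' : ∀ x e f, [e, f] <:+: a' x → [BE.lf e, BE.lf f] <:+: β x := by
    intro x e f h
    rw [hq']
    exact (infix_map BE.lf h).trans ⟨[.st 1 (k' x)], .cn (j' x) :: (b' x).map .rt, by simp⟩
  have inR : ∀ x e f, [e, f] <:+: b x → [BE.rt e, BE.rt f] <:+: α x := by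
    intro x e f h
    rw [hq]
    exact (infix_map BE.rt h).trans ⟨.st 0 (k x) :: ((a x).map .lf ++ [.cn (j x)]), [], by simp⟩
  have inR' : ∀ x e f, [e, f] <:+: b' x → [BE.rt e, BE.rt f] <:+: β x := by
    intro x e f h
    rw [hq']
    exact (infix_map BE.rt h).trans ⟨.st 1 (k' x) :: ((a' x).map .lf ++ [.cn (j' x)]), [], by simp⟩
  have mem_of : ∀ {X : Type} {e f : X} {l : List X}, [e, f] <:+: l → e ∈ l := by
    intro X e f l h
    exact h.subset (by simp)
  -- ends
  have hends : ML.ncard + n ≤ {e ∈ Y | ∀ f ∈ Y, ¬ A e f}.ncard := by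
    have c1 : (BE.lf (n := n) '' ML).ncard = ML.ncard :=
      Set.ncard_image_of_injective _ (fun x y h => by simpa using h)
    have c2 : (Set.range (BE.cn (E := G.E) (n := n))).ncard = n := by
      rw [← Set.image_univ, Set.ncard_image_of_injective _ (fun x y h => by simpa using h)]
      simp [Set.ncard_univ]
    suffices hs : (BE.lf (n := n) '' ML).ncard + (Set.range (BE.cn (E := G.E) (n := n))).ncard ≤
        {e ∈ Y | ∀ f ∈ Y, ¬ A e f}.ncard by omega
    rw [← Set.ncard_union_eq _ (Set.toFinite _) (Set.toFinite _)]
    · refine Set.ncard_le_ncard ?_ (Set.toFinite _)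
      rintro _ (⟨e, ⟨x, y, f, g, hfg, h1, h2⟩, rfl⟩ | ⟨i, rfl⟩)
      · have h1' := inL x _ _ (infix_rev h1)
        have h2' := inL' y _ _ (infix_rev h2)
        refine ⟨⟨by simp, by simp, ⟨x, mem_of h1'⟩, ⟨y, mem_of h2'⟩⟩, ?_⟩
        rintro z - ⟨⟨x', hx'⟩, ⟨y', hy'⟩⟩
        have e1 := succ_uniq (Big G s R n) hH hα h1' hx'
        have e2 := succ_uniq (Big G s R n) hH hβ h2' hy'
        have := e1.trans e2.symm
        simp at this
        exact hfg this
      · refine ⟨⟨by simp, by simp, ?_, ?_⟩, ?_⟩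
        · obtain ⟨x, rfl⟩ := hj i
          exact ⟨x, by rw [hq]; simp⟩
        · obtain ⟨x, rfl⟩ := hj' i
          exact ⟨x, by rw [hq']; simp⟩
        · rintro z ⟨z1, z2, -⟩ ⟨⟨x, hx⟩, -⟩
          have := adj_of_infix (Big G s R n) hα hx
          cases z with
          | st i k => exact z2 i k rfl
          | rt f => exact z1 f rfl
          | lf f => simp [Big] at this
          | cn f => simp [Big] at this
    · rw [Set.disjoint_left]
      rintro _ ⟨e, _, rfl⟩ ⟨i, hi⟩
      simp at hi
  -- starts and right mergings are mergings
  have c3 : (BE.rt (n := n) '' MR).ncard = MR.ncard :=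
      Set.ncard_image_of_injective _ (fun x y h => by simpa using h)
  have hfin : (BE.rt (n := n) '' MR).ncard + {f ∈ Y | ∀ e ∈ Y, ¬ A e f}.ncard ≤
      {e : BE G.E n | ∃ (a b : Fin n) (f g : BE G.E n),
      f ≠ g ∧ [f, e] <:+: α a ∧ [g, e] <:+: β b}.ncard := by
    rw [← Set.ncard_union_eq _ (Set.toFinite _) (Set.toFinite _)]
    · refine Set.ncard_le_ncard ?_ (Set.toFinite _)
      rintro _ (⟨e, ⟨x, y, f, g, hfg, h1, h2⟩, rfl⟩ | ⟨⟨y1, y2, ⟨x, hx⟩, ⟨y, hy⟩⟩, hst⟩)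
      · exact ⟨x, y, .rt f, .rt g, by simpa using hfg, inR _ _ _ h1, inR' _ _ _ h2⟩
      · rename_i e
        have hx2 : ∃ f, [f, e] <:+: α x := by
          have := hx
          rw [hq] at this ⊢
          refine exists_pred _ _ _ ?_
          rcases List.mem_cons.mp this with h | h
          · exact absurd h (y2 _ _)
          · exact h
        have hy2 : ∃ f, [f, e] <:+: β y := by
          have := hy
          rw [hq'] at this ⊢
          refine exists_pred _ _ _ ?_
          rcases List.mem_cons.mp this with h | h
          · exact absurd h (y2 _ _)
          · exact h
        obtain ⟨f, hf⟩ := hx2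
        obtain ⟨g, hg⟩ := hy2
        refine ⟨x, y, f, g, ?_, hf, hg⟩
        rintro rfl
        refine hst f ⟨?_, ?_, ⟨x, mem_of hf⟩, ⟨y, mem_of hg⟩⟩ ⟨⟨x, hf⟩, ⟨y, hg⟩⟩
        · rintro z rfl
          have := adj_of_infix (Big G s R n) hα hf
          cases e with
          | st i k => exact y2 i k rfl
          | rt f => exact y1 f rfl
          | lf f => simp [Big] at this
          | cn f => simp [Big] at this
        · rintro i z rfl
          have p1 := mem_of hf
          have p2 := mem_of hg
          rw [hq] at p1
          rw [hq'] at p2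
          simp at p1 p2
          have := p1.1.symm.trans p2.1
          simp at this
    · rw [Set.disjoint_left]
      rintro _ ⟨e, _, rfl⟩ ⟨⟨h, _⟩, _⟩
      exact h e rfl
  omega

end

/-- the trivial configuration -/
abbrev Triv (n : ℕ) : MultiDigraph where
  V := Option (Fin 2)
  E := Fin 2 × Fin n
  fintV := inferInstance
  fintE := inferInstance
  src := fun _ => none
  dst := fun e => some e.1

theorem triv_good (n : ℕ) : GoodConfig (Triv n) (fun _ => none) (fun i => some i) ![n, n] := by
  refine ⟨?_, fun a b h => by simpa using h, fun i => ?_⟩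
  · refine acyclic_of_rank (Triv n) (X := ℕ) (fun _ => 0) fun e f h => ?_
    simp [Triv] at h
  · have e : ![n, n] i = n := by fin_cases i <;> rfl
    rw [e]
    constructor
    · refine ⟨fun x => [(i, x)], ?_, ?_⟩
      · intro x
        rw [isPath_iff]
        exact ⟨by simp, rfl, rfl⟩
      · intro x y hxy e hx hy
        simp at hx hy
        rw [hx] at hy
        simp at hy
        exact hxy hy
    · rintro ⟨α, h1, h2⟩
      have : ∀ x, ∃ k : Fin n, (i, k) ∈ α x := by
        intro x
        have h := (isPath_iff _ _ _ _).1 (h1 x)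
        cases hx : α x with
        | nil => exact absurd hx h.1
        | cons e p =>
          rw [hx] at h
          cases p with
          | nil =>
            have : some e.1 = some i := h.2.2
            simp at this
            refine ⟨e.2, ?_⟩
            rw [← this]
            simp
          | cons f p =>
            have h3 := h.2.2.1
            simp [Triv] at h3
      choose k hk using this
      obtain ⟨x, y, hxy, he⟩ := Fintype.exists_ne_map_eq_of_card_lt k (by simp)
      exact h2 x y hxy _ (hk x) (he ▸ hk y)

theorem exists_opt (n : ℕ) : ∃ (G : MultiDigraph) (S R : Fin 2 → G.V),
    GoodConfig G S R ![n, n] ∧ (∀ i j, S i = S j) ∧ MstarNum ![n, n] ≤ minMergings G S R ![n, n] := by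
  by_cases hb : BddAbove {k : ℕ | ∃ (G : MultiDigraph) (S R : Fin 2 → G.V),
    GoodConfig G S R ![n, n] ∧ (∀ i j, S i = S j) ∧ minMergings G S R ![n, n] = k}
  · have hne : Set.Nonempty {k : ℕ | ∃ (G : MultiDigraph) (S R : Fin 2 → G.V),
        GoodConfig G S R ![n, n] ∧ (∀ i j, S i = S j) ∧ minMergings G S R ![n, n] = k} :=
      ⟨_, Triv n, fun _ => none, fun i => some i, triv_good n, fun _ _ => rfl, rfl⟩
    obtain ⟨G, S, R, h1, h2, h3⟩ := Nat.sSup_mem hne hb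
    exact ⟨G, S, R, h1, h2, h3.ge⟩
  · refine ⟨Triv n, fun _ => none, fun i => some i, triv_good n, fun _ _ => rfl, ?_⟩
    unfold MstarNum
    rw [Nat.sSup_of_not_bddAbove hb]
    exact Nat.zero_le _

end MB

/-- For every positive integer `n`, `M(n, n) ≥ 2·M*(n, n) + n`. -/
theorem M_ge_two_Mstar_add (n : ℕ) (hn : 0 < n) :
    2 * MstarNum ![n, n] + n ≤ Mnum ![n, n] := by
  obtain ⟨G, S, R, ⟨hG, hR, hc⟩, hS, hle⟩ := MB.exists_opt n
  have hc' : ∀ i, G.MinCut (S 0) (R i) n := by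
    intro i
    have h := hc i
    have e : ![n, n] i = n := by fin_cases i <;> rfl
    rw [e, hS i 0] at h
    exact h
  have hne : ∀ i, S 0 ≠ R i := by
    intro i he
    obtain ⟨α, hα⟩ := (hc' i).1
    have := hα.1 ⟨0, hn⟩
    rw [← he] at this
    exact hG _ _ this
  have hm : ∀ α β : Fin n → List G.E, G.MengerSystem (S 0) (R 0) n α →
      G.MengerSystem (S 0) (R 1) n β → MstarNum ![n, n] ≤
        {e : G.E | ∃ (a b : Fin n) (f g : G.E), f ≠ g ∧ [f, e] <:+: α a ∧ [g, e] <:+: β b}.ncard := by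
    intro α β hα hβ
    refine hle.trans (le_trans (Nat.sInf_le ⟨MB.pair α β, ?_, rfl⟩) ?_)
    · intro i
      fin_cases i
      · exact hα
      · have := hS 1 0
        show G.MengerSystem (S 1) (R 1) n β
        rw [this]
        exact hβ
    · unfold MultiDigraph.mergingCount
      simp only [MB.mergingEdge_iff]
      exact le_rfl
  have hgood : GoodConfig (MB.Big G (S 0) R n) (fun i => .p i) (fun i => .r (R i)) ![n, n] := by
    refine ⟨MB.big_acyclic G _ R n hG, fun i j h => hR (by simpa using h), fun i => ?_⟩
    have e : ![n, n] i = n := by fin_cases i <;> rfl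
    rw [e]
    exact MB.big_minCut G _ R n i (hc' i)
  have hbig : 2 * MstarNum ![n, n] + n ≤
      minMergings (MB.Big G (S 0) R n) (fun i => .p i) (fun i => .r (R i)) ![n, n] := by
    refine le_csInf ?_ ?_
    · choose α hα using fun i => (hgood.2.2 i).1
      exact ⟨_, α, hα, rfl⟩
    · rintro k ⟨α, hα, rfl⟩
      unfold MultiDigraph.mergingCount
      simp only [MB.mergingEdge_iff]
      exact MB.big_count G (S 0) R n hG hne _ hm (α 0) (α 1) (hα 0) (hα 1)
  exact hbig.trans (le_csSup (MB.bdd n) ⟨_, _, _, hgood, fun i j h => by simpa using h, rfl⟩)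
end

section
/- For every integer n ≥ 2, M(n,n) ≥ M*(n+1,n+1) + M*(n-1,n-1) + (n-1), where M(n,n) is the two-pair merging constant with distinct sources and M* denotes the corresponding constant when the sources coincide. -/
open MultiDigraph

namespace MP
open MultiDigraph

def wk (G : MultiDigraph) : G.V → List G.E → G.V → Prop
  | u, [], v => u = v
  | u, e :: p, v => G.src e = u ∧ wk G (G.dst e) p v

theorem wk_append {G : MultiDigraph} {u v : G.V} {p q : List G.E} :
    wk G u (p ++ q) v ↔ ∃ w, wk G u p w ∧ wk G w q v := by
  induction p generalizing u with
  | nil => simp [wk]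
  | cons e p ih => simp [wk, ih, and_assoc]

theorem isPath_iff {G : MultiDigraph} {u v : G.V} {p : List G.E} :
    G.IsPathFrom u v p ↔ p ≠ [] ∧ wk G u p v := by
  unfold IsPathFrom List.Chain'
  induction p generalizing u with
  | nil => simp
  | cons e p ih =>
    cases p with
    | nil => simp [wk]
    | cons f p =>
      have := @ih (G.dst e)
      simp only [ne_eq, reduceCtorEq, not_false_eq_true, true_and, List.head?_cons,
        Option.mem_def, Option.some.injEq, forall_eq', List.getLast?_cons_cons] at this ⊢
      rw [wk, ← this]
      simp only [List.isChain_cons_cons]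
      constructor
      · rintro ⟨⟨h1, h2⟩, h3, h4⟩
        exact ⟨h3, h2, h1.symm, h4⟩
      · rintro ⟨h3, h2, h1, h4⟩
        exact ⟨⟨h1.symm, h2⟩, h3, h4⟩

def Rk (G : MultiDigraph) (r : G.V → ℕ) : Prop := ∀ e, r (G.src e) < r (G.dst e)

theorem wk_rank {G : MultiDigraph} {r : G.V → ℕ} (hr : Rk G r) {u v : G.V} {p : List G.E}
    (h : wk G u p v) :
    r u ≤ r v ∧ (p ≠ [] → r u < r v) ∧ ∀ e ∈ p, r u ≤ r (G.src e) ∧ r (G.dst e) ≤ r v := by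
  induction p generalizing u with
  | nil => simp [wk] at *; simp [h]
  | cons e p ih =>
    obtain ⟨h1, h2⟩ := h
    obtain ⟨a, b, c⟩ := ih h2
    have := hr e
    subst h1
    refine ⟨by omega, fun _ => by omega, ?_⟩
    intro f hf
    rcases List.mem_cons.1 hf with rfl | hf
    · exact ⟨le_rfl, a⟩
    · have := c f hf
      omega

theorem wk_nodup {G : MultiDigraph} {r : G.V → ℕ} (hr : Rk G r) {u v : G.V} {p : List G.E}
    (h : wk G u p v) : p.Nodup := by
  induction p generalizing u with
  | nil => simp
  | cons e p ih =>
    obtain ⟨h1, h2⟩ := h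
    refine List.nodup_cons.2 ⟨fun he => ?_, ih h2⟩
    have := ((wk_rank hr h2).2.2 e he).1
    have := hr e
    omega

theorem exists_rank {G : MultiDigraph} (h : G.Acyclic) : ∃ r, Rk G r := by
  classical
  have := G.fintV
  let s : G.V → G.V → Prop := fun u v => ∃ e, G.src e = u ∧ G.dst e = v
  have key : ∀ u v, Relation.TransGen s u v → ∃ p, p ≠ [] ∧ wk G u p v := by
    intro u v huv
    induction huv with
    | single hs => obtain ⟨e, h1, h2⟩ := hs; exact ⟨[e], by simp, h1, h2⟩
    | tail _ hs ih =>
      obtain ⟨e, h1, h2⟩ := hs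
      obtain ⟨p, hp, hw⟩ := ih
      exact ⟨p ++ [e], by simp, wk_append.2 ⟨_, hw, h1, h2⟩⟩
  refine ⟨fun v => Set.ncard {w | Relation.TransGen s w v}, fun e => ?_⟩
  have hs : s (G.src e) (G.dst e) := ⟨e, rfl, rfl⟩
  apply Set.ncard_lt_ncard _ (Set.toFinite _)
  refine ⟨fun w hw => Relation.TransGen.tail hw hs, fun hsub => ?_⟩
  have : Relation.TransGen s (G.src e) (G.src e) :=
    hsub (show G.src e ∈ {w | Relation.TransGen s w (G.dst e)} from Relation.TransGen.single hs)
  obtain ⟨p, hp⟩ := key _ _ this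
  exact h _ p (isPath_iff.2 hp)

theorem acyclic_of_rank {G : MultiDigraph} {r} (hr : Rk G r) : G.Acyclic := by
  intro v p hp
  rw [isPath_iff] at hp
  exact lt_irrefl _ ((wk_rank hr hp.2).2.1 hp.1)

theorem nd_split {E : Type*} {P Q P' Q' : List E} {e : E} (h : (P ++ e :: Q).Nodup)
    (h' : P ++ e :: Q = P' ++ e :: Q') : P = P' ∧ Q = Q' := by
  induction P generalizing P' with
  | nil =>
    cases P' with
    | nil => simpa using h'
    | cons a P' =>
      simp at h' h
      obtain ⟨rfl, rfl⟩ := h'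
      simp at h
  | cons b P ih =>
    cases P' with
    | nil =>
      simp at h' h
      obtain ⟨rfl, rfl⟩ := h'
      simp at h
    | cons a P' =>
      simp only [List.cons_append, List.cons.injEq] at h'
      obtain ⟨rfl, h2⟩ := h'
      have := ih (List.nodup_cons.1 h).2 h2
      simp [this]

theorem infix2_split {E : Type*} {L R : List E} {x g e : E} (h : [g, e] <:+: L ++ x :: R) :
    [g, e] <:+: L ++ [x] ∨ [g, e] <:+: x :: R := by
  induction L with
  | nil => right; simpa using h
  | cons b L ih =>
    rw [List.cons_append, List.infix_cons_iff] at h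
    rcases h with h | h
    · left
      cases L with
      | nil =>
        simp at h ⊢
        simp [h]
      | cons c L =>
        simp at h ⊢
        obtain ⟨rfl, rfl⟩ := h
        exact List.IsPrefix.isInfix (by simp)
    · rcases ih h with h | h
      · left; rw [List.cons_append, List.infix_cons_iff]; exact Or.inr h
      · exact Or.inr h

theorem wk_infix {G : MultiDigraph} {u v : G.V} {p : List G.E} (h : wk G u p v) {f e : G.E}
    (hi : [f, e] <:+: p) : G.dst f = G.src e := by
  obtain ⟨s, t, rfl⟩ := hi
  simp [wk_append, wk] at h
  obtain ⟨_, h⟩ := h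
  exact h.1.symm

theorem wk_mem_split {G : MultiDigraph} {u v : G.V} {P Q : List G.E} {e : G.E}
    (h : wk G u (P ++ e :: Q) v) : wk G u P (G.src e) ∧ wk G (G.dst e) Q v := by
  simp [wk_append, wk] at h
  exact h

theorem wk_pred {G : MultiDigraph} {u v : G.V} {p : List G.E} {e : G.E}
    (h : wk G u p v) (he : e ∈ p) : (∃ q, p = e :: q ∧ G.src e = u) ∨ ∃ f, [f, e] <:+: p := by
  obtain ⟨P, Q, rfl⟩ := List.append_of_mem he
  rcases List.eq_nil_or_concat P with rfl | ⟨P', f, rfl⟩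
  · exact Or.inl ⟨Q, rfl, h.1⟩
  · exact Or.inr ⟨f, P', Q, by simp⟩

theorem wk_succ {G : MultiDigraph} {u v : G.V} {p : List G.E} {e : G.E}
    (h : wk G u p v) (he : e ∈ p) : G.dst e = v ∨ ∃ f, [e, f] <:+: p := by
  obtain ⟨P, Q, rfl⟩ := List.append_of_mem he
  have := (wk_mem_split h).2
  cases Q with
  | nil => exact Or.inl this
  | cons f Q => exact Or.inr ⟨f, P, Q, by simp⟩

section fam
variable {G : MultiDigraph} {u v : G.V} {c : ℕ} {α : Fin c → List G.E}

theorem M_wk (h : G.MengerSystem u v c α) (i) : wk G u (α i) v := (isPath_iff.1 (h.1 i)).2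
theorem M_ne (h : G.MengerSystem u v c α) (i) : α i ≠ [] := (isPath_iff.1 (h.1 i)).1
theorem M_nd (hG : G.Acyclic) (h : G.MengerSystem u v c α) (i) : (α i).Nodup :=
  let ⟨_, hr⟩ := exists_rank hG
  wk_nodup hr (M_wk h i)
theorem M_idx (h : G.MengerSystem u v c α) {i j} {e} (hi : e ∈ α i) (hj : e ∈ α j) : i = j := by
  by_contra hne
  exact h.2 i j hne e hi hj

theorem infix_nd_pred {E : Type*} {p : List E} (hp : p.Nodup) {f g e : E} (h1 : [f, e] <:+: p)
    (h2 : [g, e] <:+: p) : f = g := by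
  obtain ⟨s, t, rfl⟩ := h1
  obtain ⟨s', t', h⟩ := h2
  have h' : (s ++ [f]) ++ e :: t = (s' ++ [g]) ++ e :: t' := by simpa using h.symm
  have := (nd_split (by simpa using hp) h').1
  simp at this
  exact this.2

theorem infix_nd_succ {E : Type*} {p : List E} (hp : p.Nodup) {f g e : E} (h1 : [e, f] <:+: p)
    (h2 : [e, g] <:+: p) : f = g := by
  obtain ⟨s, t, rfl⟩ := h1
  obtain ⟨s', t', h⟩ := h2
  have h' : s ++ e :: (f :: t) = s' ++ e :: (g :: t') := by simpa using h.symm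
  have := (nd_split (by simpa using hp) h').2
  simp at this
  exact this.1

theorem inf_l {E : Type*} {p : List E} {f e : E} (h : [f, e] <:+: p) : f ∈ p :=
  h.subset (by simp)
theorem inf_r {E : Type*} {p : List E} {f e : E} (h : [f, e] <:+: p) : e ∈ p :=
  h.subset (by simp)

theorem M_pu (hG : G.Acyclic) (h : G.MengerSystem u v c α) {i j} {f g e}
    (h1 : [f, e] <:+: α i) (h2 : [g, e] <:+: α j) : f = g := by
  obtain rfl := M_idx h (inf_r h1) (inf_r h2)
  exact infix_nd_pred (M_nd hG h i) h1 h2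

theorem M_su (hG : G.Acyclic) (h : G.MengerSystem u v c α) {i j} {f g e}
    (h1 : [e, f] <:+: α i) (h2 : [e, g] <:+: α j) : f = g := by
  obtain rfl := M_idx h (inf_l h1) (inf_l h2)
  exact infix_nd_succ (M_nd hG h i) h1 h2
end fam
end MP

namespace MP
open MultiDigraph

def mg {E ι κ : Type*} (α : ι → List E) (β : κ → List E) : Set E :=
  {e | ∃ a b f g, f ≠ g ∧ [f, e] <:+: α a ∧ [g, e] <:+: β b}

def inn {E ι : Type*} (α : ι → List E) (e : E) : Prop := ∃ i, e ∈ α i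

theorem mg_comm {E ι κ : Type*} (α : ι → List E) (β : κ → List E) : mg α β = mg β α := by
  ext e
  constructor <;> rintro ⟨a, b, f, g, h, h1, h2⟩ <;> exact ⟨b, a, g, f, h.symm, h2, h1⟩

def Dto {E ι κ : Type*} (α : ι → List E) (β : κ → List E) (y z : E) : Prop :=
  y ∈ mg α β ∧ z ∈ mg α β ∧ ∃ x T i j, List.Sublist [x, y] (β j) ∧
    (x :: (T ++ [z])) <:+: α i ∧ ∀ e ∈ T, ¬ inn β e

theorem exists_last {E : Type*} (Y : Set E) {l : List E} (h : ∃ y ∈ Y, y ∈ l) :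
    ∃ M y C, l = M ++ y :: C ∧ y ∈ Y ∧ ∀ e ∈ C, e ∉ Y := by
  induction l with
  | nil => simp at h
  | cons b l ih =>
    by_cases h' : ∃ y ∈ Y, y ∈ l
    · obtain ⟨M, y, C, rfl, h1, h2⟩ := ih h'
      exact ⟨b :: M, y, C, rfl, h1, h2⟩
    · obtain ⟨y, hy, hyl⟩ := h
      rcases List.mem_cons.1 hyl with rfl | hyl
      · exact ⟨[], y, l, rfl, hy, fun e he hY => h' ⟨e, hY, he⟩⟩
      · exact absurd ⟨y, hy, hyl⟩ h'

theorem exists_first {E : Type*} (Y : Set E) {l : List E} (h : ∃ y ∈ Y, y ∈ l) :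
    ∃ M y C, l = M ++ y :: C ∧ y ∈ Y ∧ ∀ e ∈ M, e ∉ Y := by
  obtain ⟨M, y, C, h1, h2, h3⟩ := exists_last Y (l := l.reverse) (by simpa using h)
  refine ⟨C.reverse, y, M.reverse, ?_, h2, by simpa using h3⟩
  have := congrArg List.reverse h1
  simpa using this

theorem sub_mem {E : Type*} {M C : List E} {x w y : E}
    (h : List.Sublist [x, w] (M ++ y :: C)) (hw : w ∉ C) : x ∈ M := by
  rw [List.sublist_append_iff] at h
  obtain ⟨l1, l2, h1, h2, h3⟩ := h
  cases l1 with
  | nil =>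
    simp at h1
    subst h1
    exfalso
    cases h3 with
    | cons _ h => exact hw (h.subset (by simp))
    | cons_cons _ h => exact hw (h.subset (by simp))
  | cons a l1 =>
    simp at h1
    obtain ⟨rfl, _⟩ := h1
    exact h2.subset (by simp)

theorem first_unique {E : Type*} {p : List E} (hp : p.Nodup) (B : E → Prop) {e z z' : E}
    {T T' : List E} (h : (e :: (T ++ [z])) <:+: p) (h' : (e :: (T' ++ [z'])) <:+: p)
    (hz : B z) (hz' : B z') (hT : ∀ e ∈ T, ¬ B e) (hT' : ∀ e ∈ T', ¬ B e) : z = z' := by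
  obtain ⟨s, t, rfl⟩ := h
  obtain ⟨s', t', h⟩ := h'
  have h' : s ++ e :: (T ++ z :: t) = s' ++ e :: (T' ++ z' :: t') := by simpa using h.symm
  have h2 := (nd_split (by simpa using hp) h').2
  clear h h' hp
  induction T generalizing T' with
  | nil =>
    cases T' with
    | nil => simp at h2; exact h2.1
    | cons a T' =>
      simp at h2
      exact absurd hz (h2.1 ▸ hT' a (by simp))
  | cons b T ih =>
    cases T' with
    | nil =>
      simp at h2
      exact absurd hz' (h2.1 ▸ hT b (by simp))
    | cons a T' =>
      simp at h2
      exact ih (fun e he => hT e (by simp [he])) (fun e he => hT' e (by simp [he])) h2.2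

theorem exists_periodic {J : Type*} [Finite J] [Nonempty J] (g : J → J) :
    ∃ P : Set J, P.Nonempty ∧ (∀ j ∈ P, g j ∈ P) ∧ Set.InjOn g P := by
  refine ⟨Function.periodicPts g, ?_, ?_, (Function.bijOn_periodicPts g).injOn⟩
  · obtain ⟨x⟩ := ‹Nonempty J›
    obtain ⟨m, n, hne, hmn⟩ := Finite.exists_ne_map_eq_of_infinite (fun n : ℕ => g^[n] x)
    wlog h : m < n generalizing m n
    · exact this n m hne.symm hmn.symm (by omega)
    refine ⟨g^[m] x, n - m, by omega, ?_⟩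
    show g^[n-m] (g^[m] x) = g^[m] x
    rw [← Function.iterate_add_apply, Nat.sub_add_cancel h.le]
    exact hmn.symm
  · exact fun j hj => (Function.bijOn_periodicPts g).mapsTo hj

theorem wf_Dto {G : MultiDigraph} (hG : G.Acyclic) {u v u' v' : G.V} {c c' : ℕ}
    {α : Fin c → List G.E} {β : Fin c' → List G.E} (hα : G.MengerSystem u v c α)
    (hβ : G.MengerSystem u' v' c' β)
    (hmin : ∀ β', G.MengerSystem u' v' c' β' → (mg α β).ncard ≤ (mg α β').ncard) :
    WellFounded (Dto α β) := by
  classical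
  have := G.fintE
  rw [WellFounded.wellFounded_iff_has_min]
  by_contra hcon
  push Not at hcon
  obtain ⟨Y, hYne, hY⟩ := hcon
  let J := {j : Fin c' // ∃ y ∈ Y, y ∈ β j}
  have hd : ∀ j : J, ∃ M y C, β j.1 = M ++ y :: C ∧ y ∈ Y ∧ ∀ e ∈ C, e ∉ Y :=
    fun j => exists_last Y j.2
  choose M y C hβj hyY hC using hd
  have hp : ∀ j : J, ∃ (k : J) (A : List G.E) (x : G.E) (B T : List G.E) (i : Fin c),
      M k = A ++ x :: B ∧ (x :: (T ++ [y j])) <:+: α i ∧ (∀ e ∈ T, ¬ inn β e) ∧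
      y j ∈ mg α β := by
    intro j
    obtain ⟨w, hwY, hw1, hw2, x, T, i, k, hs, hinf, hT⟩ := hY _ (hyY j)
    have hwk : w ∈ β k := hs.subset (by simp)
    let k' : J := ⟨k, w, hwY, hwk⟩
    have : x ∈ M k' := by
      have h1 : List.Sublist [x, w] (β k'.1) := hs
      rw [hβj k'] at h1
      exact sub_mem h1 (fun h => hC k' w h hwY)
    obtain ⟨A, B, hAB⟩ := List.append_of_mem this
    exact ⟨k', A, x, B, T, i, hAB, hinf, hT, hw2⟩
  choose g A x B T I hM hinf hT hymg using hp
  have hJ : Nonempty J := by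
    obtain ⟨y0, hy0⟩ := hYne
    obtain ⟨w, hwY, hw1, hw2, _⟩ := hY _ hy0
    obtain ⟨a, b, f, g, _, _, h⟩ := hw2
    exact ⟨⟨b, y0, hy0, inf_r h⟩⟩
  obtain ⟨P, hPne, hPg, hinj⟩ := exists_periodic g
  have hdec : ∀ j, β (g j).1 = A j ++ x j :: (B j ++ y (g j) :: C (g j)) := by
    intro j
    rw [hβj, hM j]; simp
  let nw : J → List G.E := fun j => A j ++ x j :: (T j ++ y j :: C j)
  let β' : Fin c' → List G.E := fun j =>
    if h : ∃ hj : (∃ y ∈ Y, y ∈ β j), (⟨j, hj⟩ : J) ∈ P then nw ⟨j, h.1⟩ else β j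
  have e1 : ∀ j : J, j ∈ P → β' j.1 = nw j := by
    intro j hj
    exact dif_pos ⟨j.2, hj⟩
  have e2 : ∀ j : Fin c', (∃ j' : J, j'.1 = j ∧ j' ∈ P) ∨ β' j = β j ∧ ∀ j' ∈ P, j'.1 ≠ j := by
    intro j
    by_cases h : ∃ hj : (∃ y ∈ Y, y ∈ β j), (⟨j, hj⟩ : J) ∈ P
    · exact Or.inl ⟨⟨j, h.1⟩, rfl, h.2⟩
    · refine Or.inr ⟨dif_neg h, ?_⟩
      rintro j' hj' rfl
      exact h ⟨j'.2, hj'⟩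
  have mA : ∀ j e, e ∈ A j ++ [x j] → e ∈ β (g j).1 := by
    intro j e he
    rw [hdec]; simp at he ⊢; tauto
  have mC : ∀ j e, e ∈ y j :: C j → e ∈ β j.1 := by
    intro j e he
    rw [hβj]; simp at he ⊢; tauto
  have mAC : ∀ j e, e ∈ A j ++ [x j] → e ∈ y (g j) :: C (g j) → False := by
    intro j e h1 h2
    have := M_nd hG hβ (g j).1
    rw [hdec] at this
    have h3 : ((A j ++ [x j]) ++ (B j ++ y (g j) :: C (g j))).Nodup := by simpa using this
    exact (List.disjoint_of_nodup_append h3) h1 (by simp at h2 ⊢; tauto)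
  have mN : ∀ j e, e ∈ nw j → e ∈ A j ++ [x j] ∨ e ∈ T j ∨ e ∈ y j :: C j := by
    intro j e he
    simp [nw] at he ⊢; tauto
  have hTT : ∀ j k e, e ∈ T j → e ∈ T k → j = k := by
    intro j k e hj hk
    obtain ⟨s, t, hs⟩ := List.append_of_mem hj
    obtain ⟨s', t', hs'⟩ := List.append_of_mem hk
    have h1 := hinf j
    have h2 := hinf k
    have hIe : I j = I k := M_idx hα (e := e) (h1.subset (by simp [hj])) (h2.subset (by simp [hk]))
    rw [← hIe] at h2
    have i1 : (e :: (t ++ [y j])) <:+: α (I j) := by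
      refine List.IsInfix.trans ⟨x j :: s, [], ?_⟩ h1
      simp [hs]
    have i2 : (e :: (t' ++ [y k])) <:+: α (I j) := by
      refine List.IsInfix.trans ⟨x k :: s', [], ?_⟩ h2
      simp [hs']
    have := first_unique (M_nd hG hα (I j)) (inn β) i1 i2 ⟨j.1, mC j _ (by simp)⟩
      ⟨k.1, mC k _ (by simp)⟩ (fun e he => hT j e (by simp [hs, he]))
      (fun e he => hT k e (by simp [hs', he]))
    have h5 := mC k (y k) (by simp)
    rw [← this] at h5
    exact Subtype.ext (M_idx hβ (mC j (y j) (by simp)) h5)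
  have hM' : G.MengerSystem u' v' c' β' := by
    constructor
    · intro j
      rcases e2 j with ⟨j, rfl, hj⟩ | ⟨h, _⟩
      · rw [e1 j hj, isPath_iff]
        refine ⟨by simp [nw], ?_⟩
        have h1 := M_wk hβ (g j).1
        rw [hdec] at h1
        have h2 := M_wk hβ j.1
        rw [hβj] at h2
        have h3 := M_wk hα (I j)
        obtain ⟨s, t, hs⟩ := hinf j
        rw [← hs] at h3
        have h4 : wk G u (s ++ x j :: (T j ++ y j :: t)) v := by simpa using h3
        have h5 := (wk_mem_split (P := T j) (wk_mem_split h4).2).1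
        exact wk_append.2 ⟨_, (wk_mem_split h1).1, rfl, wk_append.2 ⟨_, h5, rfl,
          (wk_mem_split h2).2⟩⟩
      · rw [h]; exact hβ.1 j
    · intro j k hjk e hej hek
      rcases e2 j with ⟨j, rfl, hj⟩ | ⟨h, hj⟩ <;> rcases e2 k with ⟨k, rfl, hk⟩ | ⟨h', hk⟩
      · rw [e1 j hj] at hej
        rw [e1 k hk] at hek
        have hgj : g j ≠ g k := fun h => hjk (congrArg _ (hinj hj hk h))
        rcases mN _ _ hej with h1 | h1 | h1 <;> rcases mN _ _ hek with h2 | h2 | h2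
        · exact hgj (Subtype.ext (M_idx hβ (mA _ _ h1) (mA _ _ h2)))
        · exact hT _ _ h2 ⟨_, mA _ _ h1⟩
        · have : g j = k := Subtype.ext (M_idx hβ (mA _ _ h1) (mC _ _ h2))
          rw [← this] at h2
          exact mAC _ _ h1 h2
        · exact hT _ _ h1 ⟨_, mA _ _ h2⟩
        · exact hjk (congrArg _ (hTT _ _ _ h1 h2))
        · exact hT _ _ h1 ⟨_, mC _ _ h2⟩
        · have : g k = j := Subtype.ext (M_idx hβ (mA _ _ h2) (mC _ _ h1))
          rw [← this] at h1
          exact mAC _ _ h2 h1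
        · exact hT _ _ h2 ⟨_, mC _ _ h1⟩
        · exact hjk (M_idx hβ (mC _ _ h1) (mC _ _ h2))
      · rw [e1 j hj] at hej
        rw [h'] at hek
        rcases mN _ _ hej with h1 | h1 | h1
        · exact hk _ (hPg j hj) (M_idx hβ (mA _ _ h1) hek)
        · exact hT _ _ h1 ⟨_, hek⟩
        · exact hjk (M_idx hβ (mC _ _ h1) hek)
      · rw [e1 k hk] at hek
        rw [h] at hej
        rcases mN _ _ hek with h1 | h1 | h1
        · exact hj _ (hPg k hk) (M_idx hβ (mA _ _ h1) hej)
        · exact hT _ _ h1 ⟨_, hej⟩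
        · exact hjk (M_idx hβ hej (mC _ _ h1))
      · rw [h] at hej
        rw [h'] at hek
        exact hjk (M_idx hβ hej hek)
  have hsub : mg α β' ⊆ mg α β := by
    rintro e ⟨i, j, f, f', hne, h1, h2⟩
    rcases e2 j with ⟨j, rfl, hj⟩ | ⟨h, hj⟩
    · rw [e1 j hj] at h2
      rcases infix2_split h2 with h2 | h2
      · refine ⟨i, (g j).1, f, f', hne, h1, h2.trans ?_⟩
        rw [hdec]
        exact ⟨[], B j ++ y (g j) :: C (g j), by simp⟩
      · rw [← List.cons_append] at h2
        rcases infix2_split h2 with h2 | h2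
        · exact absurd (M_pu hG hα h1 (h2.trans (by simpa using hinf j))) hne
        · refine ⟨i, j.1, f, f', hne, h1, h2.trans ?_⟩
          rw [hβj]
          exact ⟨M j, [], by simp⟩
    · rw [h] at h2
      exact ⟨i, j, f, f', hne, h1, h2⟩
  obtain ⟨j0, hj0⟩ := hPne
  have hlt : (mg α β').ncard < (mg α β).ncard := by
    apply Set.ncard_lt_ncard _ (Set.toFinite _)
    refine ⟨hsub, fun hsup => ?_⟩
    obtain ⟨i, j, f, f', hne, h1, h2⟩ := hsup (hymg j0)
    obtain ⟨w, s, hw⟩ : ∃ w s, x j0 :: T j0 = s ++ [w] := by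
      rcases List.eq_nil_or_concat (x j0 :: T j0) with h | ⟨s, w, h⟩
      · simp at h
      · exact ⟨w, s, by simpa using h⟩
    have i1 : [w, y j0] <:+: x j0 :: (T j0 ++ [y j0]) := by
      rw [← List.cons_append, hw]
      exact ⟨s, [], by simp⟩
    have i2 : [w, y j0] <:+: β' j0.1 := by
      rw [e1 j0 hj0]
      exact i1.trans ⟨A j0, C j0, by simp [nw]⟩
    exact hne ((M_pu hG hα h1 (i1.trans (hinf j0))).trans (M_pu hG hM' i2 h2))
  exact absurd (hmin β' hM') (not_le.2 hlt)
end MP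

namespace MP
open MultiDigraph

def stp {E ι κ : Type*} (α : ι → List E) (β : κ → List E) (y z : E) : Prop :=
  y ∈ mg α β ∧ z ∈ mg α β ∧ ∃ x U T i j, (x :: (U ++ [y])) <:+: β j ∧ (∀ e ∈ U, ¬ inn α e) ∧
    (x :: (T ++ [z])) <:+: α i ∧ ∀ e ∈ T, ¬ inn β e

theorem stp_Dto {E ι κ : Type*} {α : ι → List E} {β : κ → List E} {y z : E}
    (h : stp α β y z) : Dto α β y z := by
  obtain ⟨h1, h2, x, U, T, i, j, h3, h4, h5, h6⟩ := h
  exact ⟨h1, h2, x, T, i, j, List.Sublist.trans (by simp) h3.sublist, h5, h6⟩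

theorem stp_swap {E ι κ : Type*} {α : ι → List E} {β : κ → List E} {y z : E}
    (h : stp α β y z) : stp β α z y := by
  obtain ⟨h1, h2, x, U, T, i, j, h3, h4, h5, h6⟩ := h
  rw [mg_comm] at h1 h2
  exact ⟨h2, h1, x, T, U, j, i, h5, h6, h3, h4⟩

theorem split_first {E : Type*} (B : E → Prop) {z z' : E} {T T' t t' : List E}
    (h2 : T ++ z :: t = T' ++ z' :: t')
    (hz : B z) (hz' : B z') (hT : ∀ e ∈ T, ¬ B e) (hT' : ∀ e ∈ T', ¬ B e) : z = z' := by
  induction T generalizing T' with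
  | nil =>
    cases T' with
    | nil => simp at h2; exact h2.1
    | cons a T' =>
      simp at h2
      exact absurd hz (h2.1 ▸ hT' a (by simp))
  | cons b T ih =>
    cases T' with
    | nil =>
      simp at h2
      exact absurd hz' (h2.1 ▸ hT b (by simp))
    | cons a T' =>
      simp at h2
      exact ih h2.2 (fun e he => hT e (by simp [he])) (fun e he => hT' e (by simp [he]))

theorem split_last {E : Type*} (B : E → Prop) {z z' : E} {T T' t t' : List E}
    (h2 : T ++ z :: t = T' ++ z' :: t')
    (hz : B z) (hz' : B z') (hT : ∀ e ∈ t, ¬ B e) (hT' : ∀ e ∈ t', ¬ B e) : z = z' := by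
  have := congrArg List.reverse h2
  simp only [List.reverse_append, List.reverse_cons, List.append_assoc, List.singleton_append]
    at this
  exact split_first B this hz hz' (by simpa using hT) (by simpa using hT')

theorem last_unique {E : Type*} {p : List E} (hp : p.Nodup) (B : E → Prop) {y x x' : E}
    {T T' : List E} (h : (x :: (T ++ [y])) <:+: p) (h' : (x' :: (T' ++ [y])) <:+: p)
    (hz : B x) (hz' : B x') (hT : ∀ e ∈ T, ¬ B e) (hT' : ∀ e ∈ T', ¬ B e) : x = x' := by
  have h1 := List.reverse_infix.2 h
  have h2 := List.reverse_infix.2 h'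
  simp only [List.reverse_append, List.reverse_cons, List.reverse_nil, List.nil_append,
    List.append_assoc, List.singleton_append, List.cons_append] at h1 h2
  exact first_unique (List.nodup_reverse.2 hp) B h1 h2 hz hz' (by simpa using hT)
    (by simpa using hT')

theorem sub_trans {E : Type*} {p : List E} (hp : p.Nodup) {x y z : E}
    (h : List.Sublist [x, y] p) (h' : List.Sublist [y, z] p) : List.Sublist [x, z] p := by
  obtain ⟨P, Q, rfl⟩ := List.append_of_mem (h.subset (show y ∈ [x, y] by simp))
  have hy : y ∉ Q ∧ y ∉ P := by
    rw [List.nodup_append] at hp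
    refine ⟨(List.nodup_cons.1 hp.2.1).1, fun hP => hp.2.2 y hP y (by simp) rfl⟩
  have hx := sub_mem h hy.1
  have hz : z ∈ Q := by
    have := h'.reverse
    simp only [List.reverse_append, List.reverse_cons, List.append_assoc, List.singleton_append,
      List.reverse_nil, List.nil_append] at this
    simpa using sub_mem this (by simpa using hy.2)
  show List.Sublist ([x] ++ [z]) (P ++ y :: Q)
  exact List.Sublist.append (by simpa using hx) (by simp [hz])

theorem order3 {E : Type*} {p : List E} {y z : E} (hy : y ∈ p) (hz : z ∈ p) :
    y = z ∨ List.Sublist [y, z] p ∨ List.Sublist [z, y] p := by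
  obtain ⟨P, Q, rfl⟩ := List.append_of_mem hy
  rcases List.mem_append.1 hz with h | h
  · right; right
    show List.Sublist ([z] ++ [y]) (P ++ y :: Q)
    exact List.Sublist.append (by simpa using h) (by simp)
  · rcases List.mem_cons.1 h with h | h
    · exact Or.inl h.symm
    · right; left
      exact (List.Sublist.cons_cons y (by simpa using h)).trans (List.sublist_append_right _ _)

theorem sub_rank {G : MultiDigraph} {r : G.V → ℕ} (hr : Rk G r) {u v : G.V} {p : List G.E}
    (h : wk G u p v) {x y : G.E} (hs : List.Sublist [x, y] p) : r (G.src x) < r (G.src y) := by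
  obtain ⟨P, Q, rfl⟩ := List.append_of_mem (hs.subset (show x ∈ [x, y] by simp))
  have hn := wk_nodup hr h
  have hx : x ∉ P := by
    rw [List.nodup_append] at hn
    exact fun hP => hn.2.2 x hP x (by simp) rfl
  have hz : y ∈ Q := by
    have := hs.reverse
    simp only [List.reverse_append, List.reverse_cons, List.append_assoc, List.singleton_append,
      List.reverse_nil, List.nil_append] at this
    simpa using sub_mem this (by simpa using hx)
  have := (wk_rank hr (wk_mem_split h).2).2.2 y hz
  have := hr x
  omega

section
variable {G : MultiDigraph} {u v u' v' : G.V} {c c' : ℕ}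
    {α : Fin c → List G.E} {β : Fin c' → List G.E}

theorem tg_swap {E : Type*} {r : E → E → Prop} {a b} (h : Relation.TransGen r a b) :
    Relation.TransGen (Function.swap r) b a := by
  induction h with
  | single h => exact .single h
  | tail _ h ih => exact .head h ih

theorem rtg_swap {E : Type*} {r : E → E → Prop} {a b} (h : Relation.ReflTransGen r a b) :
    Relation.ReflTransGen (Function.swap r) b a := by
  induction h with
  | refl => exact .refl
  | tail _ h ih => exact .head h ih

theorem stp_same (hG : G.Acyclic) (hβ : G.MengerSystem u' v' c' β)
    (hwf : WellFounded (Dto α β)) {y y' : G.E} (h : Relation.TransGen (stp α β) y y') {j}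
    (hj : y ∈ β j) (ho : y = y' ∨ List.Sublist [y, y'] (β j)) : False := by
  have hy' : y' ∈ mg α β := by
    cases h with
    | single h => exact h.2.1
    | tail _ h => exact h.2.1
  obtain ⟨z, hz, hzy⟩ := Relation.TransGen.head'_iff.1 h
  have hD : Dto α β y' z := by
    obtain ⟨h1, h2, x, T, i, k, h3, h5, h6⟩ := stp_Dto hz
    have hk : k = j := M_idx hβ (h3.subset (show y ∈ [x, y] by simp)) hj
    subst hk
    refine ⟨hy', h2, x, T, i, k, ?_, h5, h6⟩
    rcases ho with rfl | ho
    · exact h3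
    · exact sub_trans (M_nd hG hβ k) h3 ho
  have hT : Relation.TransGen (Dto α β) y' y' :=
    Relation.TransGen.head' hD (Relation.ReflTransGen.mono (fun _ _ => stp_Dto) _ _ hzy)
  have : ∀ y', ¬ Relation.TransGen (Dto α β) y' y' := fun y' hh => by
    exact (hwf.transGen).irrefl.irrefl y' hh
  exact this _ hT

theorem stp_col (hG : G.Acyclic) (hα : G.MengerSystem u v c α) (hβ : G.MengerSystem u' v' c' β)
    (hwf : WellFounded (Dto α β)) (hwf' : WellFounded (Dto β α)) {y y' : G.E}
    (h : Relation.TransGen (stp α β) y y') {i j}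
    (hi : y ∈ α i) (hi' : y' ∈ α i) (hj : y ∈ β j) (hj' : y' ∈ β j) : False := by
  obtain ⟨r, hr⟩ := exists_rank hG
  have hsw : Relation.TransGen (stp β α) y' y := by
    exact Relation.TransGen.mono (fun _ _ => stp_swap) _ _ (tg_swap h)
  rcases order3 hj hj' with h1 | h1 | h1
  · exact stp_same hG hβ hwf h hj (Or.inl h1)
  · exact stp_same hG hβ hwf h hj (Or.inr h1)
  · rcases order3 hi hi' with h2 | h2 | h2
    · exact stp_same hG hβ hwf h hj (Or.inl h2)
    · have := sub_rank hr (M_wk hα i) h2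
      have := sub_rank hr (M_wk hβ j) h1
      omega
    · exact stp_same hG hα hwf' hsw hi' (Or.inr h2)

theorem stp_fun (hG : G.Acyclic) (hα : G.MengerSystem u v c α) (hβ : G.MengerSystem u' v' c' β)
    {y z z'} (h : stp α β y z) (h' : stp α β y z') : z = z' := by
  obtain ⟨h1, h2, x, U, T, i, j, h3, h4, h5, h6⟩ := h
  obtain ⟨h1', h2', x', U', T', i', j', h3', h4', h5', h6'⟩ := h'
  obtain rfl : j = j' := M_idx hβ (h3.subset (show y ∈ _ by simp)) (h3'.subset (by simp))
  have ix : inn α x := ⟨i, h5.subset (by simp)⟩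
  have ix' : inn α x' := ⟨i', h5'.subset (by simp)⟩
  obtain rfl := last_unique (M_nd hG hβ j) (inn α) h3 h3' ix ix' h4 h4'
  obtain rfl : i = i' := M_idx hα (h5.subset (show x ∈ _ by simp)) (h5'.subset (by simp))
  obtain ⟨_, b, _, _, _, _, hz⟩ := h2
  obtain ⟨_, b', _, _, _, _, hz'⟩ := h2'
  exact first_unique (M_nd hG hα i) (inn β) h5 h5' ⟨b, inf_r hz⟩ ⟨b', inf_r hz'⟩ h6 h6'

def tag (α : Fin c → List G.E) (β : Fin c' → List G.E) (y : G.E) : Fin c' ⊕ Fin c ⊕ Fin c' → Prop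
  | .inl j => inn α y ∧ ∃ P Q, β j = P ++ y :: Q ∧ ∀ e ∈ P, ¬ inn α e
  | .inr (.inl i) => inn α y ∧ ∃ x U j P Q, (x :: (U ++ [y])) <:+: β j ∧ (∀ e ∈ U, ¬ inn α e) ∧
      α i = P ++ x :: Q ∧ ∀ e ∈ Q, ¬ inn β e
  | .inr (.inr k) => inn α y ∧ ∃ x U T i j z q, (x :: (U ++ [y])) <:+: β j ∧
      (∀ e ∈ U, ¬ inn α e) ∧ (x :: (T ++ [z])) <:+: α i ∧ (∀ e ∈ T, ¬ inn β e) ∧ β k = z :: q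

theorem tag_unique (hG : G.Acyclic) (hα : G.MengerSystem u v c α)
    (hβ : G.MengerSystem u' v' c' β) {y y' τ} (h : tag α β y τ) (h' : tag α β y' τ) : y = y' := by
  rcases τ with j | i | k
  · obtain ⟨hy, P, Q, h1, h2⟩ := h
    obtain ⟨hy', P', Q', h1', h2'⟩ := h'
    exact split_first (inn α) (h1.symm.trans h1') hy hy' h2 h2'
  · obtain ⟨hy, x, U, j, P, Q, h1, h2, h3, h4⟩ := h
    obtain ⟨hy', x', U', j', P', Q', h1', h2', h3', h4'⟩ := h'
    obtain rfl := split_last (inn β) (h3.symm.trans h3') ⟨j, h1.subset (by simp)⟩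
      ⟨j', h1'.subset (by simp)⟩ h4 h4'
    obtain rfl : j = j' := M_idx hβ (h1.subset (show x ∈ _ by simp)) (h1'.subset (by simp))
    exact first_unique (M_nd hG hβ j) (inn α) h1 h1' hy hy' h2 h2'
  · obtain ⟨hy, x, U, T, i, j, z, q, h1, h2, h3, h4, h5⟩ := h
    obtain ⟨hy', x', U', T', i', j', z', q', h1', h2', h3', h4', h5'⟩ := h'
    obtain ⟨rfl, _⟩ : z = z' ∧ q = q' := by simpa using h5.symm.trans h5'
    obtain rfl : i = i' := M_idx hα (h3.subset (show z ∈ _ by simp)) (h3'.subset (by simp))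
    obtain rfl := last_unique (M_nd hG hα i) (inn β) h3 h3' ⟨j, h1.subset (by simp)⟩
      ⟨j', h1'.subset (by simp)⟩ h4 h4'
    obtain rfl : j = j' := M_idx hβ (h1.subset (show x ∈ _ by simp)) (h1'.subset (by simp))
    exact first_unique (M_nd hG hβ j) (inn α) h1 h1' hy hy' h2 h2'

theorem last_pair {E : Type*} (x z : E) (T : List E) :
    ∃ v, [v, z] <:+: x :: (T ++ [z]) ∧ ((v = x ∧ T = []) ∨ v ∈ T) := by
  rcases List.eq_nil_or_concat T with rfl | ⟨s, w, rfl⟩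
  · exact ⟨x, by simp, by simp⟩
  · exact ⟨w, ⟨x :: s, [], by simp⟩, by simp⟩

theorem tag_exists (hG : G.Acyclic) (hα : G.MengerSystem u v c α)
    (hβ : G.MengerSystem u' v' c' β) {y} (hy : y ∈ mg α β) (hn : ∀ z, ¬ stp α β y z) :
    ∃ τ, tag α β y τ := by
  have hy0 := hy
  obtain ⟨i0, j, f, g, hne, hf, hg⟩ := hy
  have hyα : inn α y := ⟨i0, inf_r hf⟩
  obtain ⟨P', Q', hd⟩ := List.append_of_mem (inf_r hg)
  by_cases hP : ∃ e ∈ {e | inn α e}, e ∈ P'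
  swap
  · push Not at hP
    exact ⟨.inl j, hyα, P', Q', hd, fun e he hh => hP e hh he⟩
  obtain ⟨M, x, U, rfl, ⟨i, hxi⟩, hU⟩ := exists_last _ hP
  have hxU : (x :: (U ++ [y])) <:+: β j := ⟨M, Q', by simp [hd]⟩
  obtain ⟨P, Q, hd'⟩ := List.append_of_mem hxi
  by_cases hQ : ∃ e ∈ {e | inn β e}, e ∈ Q
  swap
  · push Not at hQ
    exact ⟨.inr (.inl i), hyα, x, U, j, P, Q, hxU, hU, hd', fun e he hh => hQ e hh he⟩
  obtain ⟨T, z, C, rfl, ⟨k, hzk⟩, hT⟩ := exists_first _ hQ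
  have hxT : (x :: (T ++ [z])) <:+: α i := ⟨P, C, by simp [hd']⟩
  rcases wk_pred (M_wk hβ k) hzk with ⟨q, hq, _⟩ | ⟨w, hw⟩
  · exact ⟨.inr (.inr k), hyα, x, U, T, i, j, z, q, hxU, hU, hxT, hT, hq⟩
  exfalso
  obtain ⟨v0, hv, hv'⟩ := last_pair x z T
  have hvz := hv.trans hxT
  by_cases hvw : v0 = w
  · subst hvw
    rcases hv' with ⟨rfl, rfl⟩ | hv'
    · cases U with
      | nil =>
        obtain rfl := M_su hG hβ hw hxU
        exact hne ((M_pu hG hα hf hvz).trans (M_pu hG hβ hw hg))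
      | cons a U =>
        have : [v0, a] <:+: β j := List.IsInfix.trans ⟨[], U ++ [y], by simp⟩ hxU
        obtain rfl := M_su hG hβ hw this
        exact hU z (by simp) ⟨i, inf_r hvz⟩
    · exact hT _ hv' ⟨k, inf_l hw⟩
  · exact hn z ⟨hy0, ⟨i, k, v0, w, hvw, hvz, hw⟩, x, U, T, i, j, hxU, hU, hxT, hT⟩

theorem fin_bound (hG : G.Acyclic) (hα : G.MengerSystem u v c α)
    (hβ : G.MengerSystem u' v' c' β)
    (hwf : WellFounded (Dto α β)) (hwf' : WellFounded (Dto β α)) :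
    (mg α β).ncard ≤ Nat.card (Fin c × Fin c' × (Fin c' ⊕ Fin c ⊕ Fin c')) := by
  have key : ∀ y, y ∈ mg α β → ∃ t τ, Relation.ReflTransGen (stp α β) y t ∧ tag α β t τ := by
    intro y
    induction y using hwf'.induction with
    | _ y ih =>
      intro hy
      by_cases hn : ∃ z, stp α β y z
      · obtain ⟨z, hz⟩ := hn
        obtain ⟨t, τ, h1, h2⟩ := ih z (stp_Dto (stp_swap hz)) hz.2.1
        exact ⟨t, τ, h1.head hz, h2⟩
      · push Not at hn
        obtain ⟨τ, hτ⟩ := tag_exists hG hα hβ hy hn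
        exact ⟨y, τ, .refl, hτ⟩
  have key2 : ∀ y : mg α β, ∃ q : Fin c × Fin c' × (Fin c' ⊕ Fin c ⊕ Fin c'),
      y.1 ∈ α q.1 ∧ y.1 ∈ β q.2.1 ∧ ∃ t, Relation.ReflTransGen (stp α β) y t ∧ tag α β t q.2.2 := by
    intro y
    obtain ⟨t, τ, h⟩ := key y.1 y.2
    obtain ⟨i, j, _, _, _, hf, hg⟩ := y.2
    exact ⟨(i, j, τ), inf_r hf, inf_r hg, t, h⟩
  choose F hF using key2
  refine Nat.card_le_card_of_injective F fun y y' hyy => ?_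
  obtain ⟨h1, h2, t, h3, h4⟩ := hF y
  obtain ⟨h1', h2', t', h3', h4'⟩ := hF y'
  rw [← hyy] at h1' h2' h4'
  obtain rfl := tag_unique hG hα hβ h4 h4'
  have hru : Relator.RightUnique (Function.swap (stp α β)) := by
    intro a b b' hb hb'
    exact stp_fun hG hβ hα (stp_swap hb) (stp_swap hb')
  have s1 := rtg_swap h3
  have s2 := rtg_swap h3'
  rcases Relation.ReflTransGen.total_of_right_unique hru s1 s2 with h | h
  · have h := rtg_swap h
    rcases Relation.reflTransGen_iff_eq_or_transGen.1 h with h | h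
    · exact Subtype.ext h
    · exact (stp_col hG hα hβ hwf hwf' h h1' h1 h2' h2).elim
  · have h := rtg_swap h
    rcases Relation.reflTransGen_iff_eq_or_transGen.1 h with h | h
    · exact Subtype.ext h.symm
    · exact (stp_col hG hα hβ hwf hwf' h h1 h1' h2 h2').elim
end
end MP

namespace MP
open MultiDigraph

def Star (G : MultiDigraph) (S : G.V) (R : Fin 2 → G.V) (c B : ℕ) : Prop :=
  G.Acyclic ∧ R 0 ≠ R 1 ∧
    (∃ A : Fin 2 → Fin c → List G.E, ∀ t, G.MengerSystem S (R t) c (A t)) ∧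
    ∀ A : Fin 2 → Fin c → List G.E, (∀ t, G.MengerSystem S (R t) c (A t)) →
      B ≤ (mg (A 0) (A 1)).ncard

theorem vec2 (n : ℕ) : ![n, n] = fun _ : Fin 2 => n := by
  funext i; fin_cases i <;> rfl

theorem mc_eq {G : MultiDigraph} {c : ℕ} (A : Fin 2 → Fin c → List G.E) :
    G.mergingCount (l := 2) (c := fun _ => c) A = (mg (A 0) (A 1)).ncard := by
  unfold mergingCount
  congr 1
  ext e
  constructor
  · rintro ⟨i, j, hij, a, b, f, g, hfg, h1, h2⟩
    fin_cases i <;> fin_cases j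
    · exact absurd rfl hij
    · exact ⟨a, b, f, g, hfg, h1, h2⟩
    · exact ⟨b, a, g, f, hfg.symm, h2, h1⟩
    · exact absurd rfl hij
  · rintro ⟨a, b, f, g, hfg, h1, h2⟩
    exact ⟨0, 1, by simp, a, b, f, g, hfg, h1, h2⟩

theorem le_Mnum {n B : ℕ} (h : MAtLeast (fun _ : Fin 2 => n) B) : B ≤ Mnum (fun _ : Fin 2 => n) := by
  classical
  obtain ⟨G, S, R, hG, hS, hB⟩ := h
  have h1 : B ≤ minMergings G S R (fun _ : Fin 2 => n) := by
    refine le_csInf ?_ ?_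
    · have := fun i => (hG.2.2 i).1
      choose A hA using this
      exact ⟨_, A, hA, rfl⟩
    · rintro k ⟨A, hA, rfl⟩
      exact hB A hA
  refine h1.trans (le_csSup ?_ ⟨G, S, R, hG, hS, rfl⟩)
  refine ⟨Nat.card (Fin n × Fin n × (Fin n ⊕ Fin n ⊕ Fin n)), ?_⟩
  rintro k ⟨G, S, R, hG, hS, rfl⟩
  have hne : {k : ℕ | ∃ α : (i : Fin 2) → Fin n → List G.E,
    (∀ i, G.MengerSystem (S i) (R i) n (α i)) ∧ G.mergingCount (c := fun _ => n) α = k}.Nonempty := by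
    have := fun i => (hG.2.2 i).1
    choose A hA using this
    exact ⟨_, A, hA, rfl⟩
  obtain ⟨A, hA, hk⟩ := Nat.sInf_mem hne
  have hmin : ∀ A' : Fin 2 → Fin n → List G.E, (∀ i, G.MengerSystem (S i) (R i) n (A' i)) →
      (mg (A 0) (A 1)).ncard ≤ (mg (A' 0) (A' 1)).ncard := by
    intro A' hA'
    rw [← mc_eq, ← mc_eq, hk]
    exact Nat.sInf_le ⟨A', hA', rfl⟩
  have w1 : WellFounded (Dto (A 0) (A 1)) := by
    refine wf_Dto hG.1 (hA 0) (hA 1) fun β' hβ' => ?_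
    have := hmin ![A 0, β'] (by intro i; fin_cases i; exacts [hA 0, hβ'])
    simpa using this
  have w2 : WellFounded (Dto (A 1) (A 0)) := by
    refine wf_Dto hG.1 (hA 1) (hA 0) fun β' hβ' => ?_
    have := hmin ![β', A 1] (by intro i; fin_cases i; exacts [hβ', hA 1])
    rw [mg_comm (A 1), mg_comm (A 1)]
    simpa using this
  have := fin_bound hG.1 (hA 0) (hA 1) w1 w2
  rw [← mc_eq, hk] at this
  exact this

theorem star_triv (c : ℕ) : ∃ G S R, Star G S R c 0 := by
  let G : MultiDigraph := ⟨Fin 3, Fin 2 × Fin c, inferInstance, inferInstance, fun _ => 0,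
    fun e => e.1.succ⟩
  refine ⟨G, (0 : Fin 3), fun t => (t.succ : Fin 3), ?_, ?_, ?_, fun _ _ => Nat.zero_le _⟩
  · refine acyclic_of_rank (r := fun v : Fin 3 => v.val) ?_
    intro e
    simp [G]
  · change (Fin.succ 0 : Fin 3) ≠ Fin.succ 1
    decide
  · refine ⟨fun t i => [(t, i)], fun t => ⟨fun i => isPath_iff.2 ⟨by simp, rfl, rfl⟩, ?_⟩⟩
    intro i j hij e h1 h2
    rw [List.mem_singleton] at h1 h2
    rw [h1] at h2
    exact hij (Prod.ext_iff.1 h2).2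

theorem star_exists (c : ℕ) : ∃ G S R, Star G S R c (MstarNum (fun _ : Fin 2 => c)) := by
  by_cases h0 : MstarNum (fun _ : Fin 2 => c) = 0
  · rw [h0]; exact star_triv c
  have hmem : MstarNum (fun _ : Fin 2 => c) ∈ {k : ℕ | ∃ (G : MultiDigraph) (S R : Fin 2 → G.V),
    GoodConfig G S R (fun _ => c) ∧ (∀ i j, S i = S j) ∧ minMergings G S R (fun _ => c) = k} := by
    apply Nat.sSup_mem
    · by_contra h
      rw [Set.not_nonempty_iff_eq_empty] at h
      apply h0
      unfold MstarNum
      rw [h]; simp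
    · by_contra h
      exact h0 (Nat.sSup_of_not_bddAbove h)
  obtain ⟨G, S, R, hG, hS, hk⟩ := hmem
  refine ⟨G, S 0, R, hG.1, fun h => by simpa using hG.2.1 h, ?_, ?_⟩
  · have := fun i => (hG.2.2 i).1
    choose A hA using this
    exact ⟨A, fun t => by rw [hS 0 t]; exact hA t⟩
  · intro A hA
    rw [← hk, ← mc_eq]
    exact Nat.sInf_le ⟨A, fun t => by rw [hS t 0]; exact hA t, rfl⟩
end MP

namespace MP
open MultiDigraph

def StarD (G : MultiDigraph) (S : G.V) (R : Fin 2 → G.V) (c B : ℕ) (d : Fin c → G.E) : Prop :=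
  Star G S R c B ∧ Function.Injective d ∧ ∀ e, G.src e = S ↔ ∃ i, e = d i

def addS (G : MultiDigraph) (S : G.V) (c : ℕ) : MultiDigraph :=
  ⟨Option G.V, Fin c ⊕ G.E, (have := G.fintV; inferInstance), (have := G.fintE; inferInstance),
    Sum.elim (fun _ => none) (fun e => some (G.src e)),
    Sum.elim (fun _ => some S) (fun e => some (G.dst e))⟩

theorem addS_wk {G : MultiDigraph} {S : G.V} {c : ℕ} {p : List (Fin c ⊕ G.E)} {u v : G.V} :
    wk (addS G S c) (some u) p (some v) ↔ ∃ q, p = q.map Sum.inr ∧ wk G u q v := by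
  induction p generalizing u with
  | nil =>
    constructor
    · intro h
      exact ⟨[], rfl, Option.some_injective _ h⟩
    · rintro ⟨q, h1, h2⟩
      cases q with
      | nil => exact congrArg some h2
      | cons => simp at h1
  | cons e p ih =>
    constructor
    · rintro ⟨h1, h2⟩
      rcases e with i | e
      · exact absurd h1 (by simp [addS])
      · obtain ⟨q, rfl, hq⟩ := ih.1 h2
        exact ⟨e :: q, rfl, Option.some_injective _ h1, hq⟩
    · rintro ⟨q, h1, h2⟩
      cases q with
      | nil => simp at h1
      | cons e' q =>
        simp only [List.map_cons, List.cons.injEq] at h1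
        obtain ⟨rfl, rfl⟩ := h1
        exact ⟨congrArg some h2.1, ih.2 ⟨q, rfl, h2.2⟩⟩

theorem infix_map2 {E F : Type*} (φ : E → F) {p : List E} {f e : E} (h : [f, e] <:+: p) :
    [φ f, φ e] <:+: p.map φ := by
  obtain ⟨s, t, rfl⟩ := h
  exact ⟨s.map φ, t.map φ, by simp⟩

theorem addS_starD {G : MultiDigraph} {S R} {c B : ℕ} (hc : 0 < c) (h : Star G S R c B) :
    StarD (addS G S c) none (fun t => some (R t)) c B Sum.inl := by
  obtain ⟨hG, hR, ⟨A, hA⟩, hB⟩ := h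
  refine ⟨⟨?_, fun h => hR (Option.some_injective _ h), ?_, ?_⟩, Sum.inl_injective, ?_⟩
  · obtain ⟨r, hr⟩ := exists_rank hG
    refine acyclic_of_rank (r := fun v : Option G.V => v.elim 0 (fun v => r v + 1)) ?_
    rintro (i | e)
    · simp [addS]
    · have := hr e
      simp [addS, this]
  · refine ⟨fun t k => Sum.inl k :: (A t k).map Sum.inr, fun t => ⟨fun k => isPath_iff.2
      ⟨by simp, rfl, addS_wk.2 ⟨_, rfl, M_wk (hA t) k⟩⟩, ?_⟩⟩
    intro i j hij (e : Fin c ⊕ G.E) (h1 : e ∈ (Sum.inl i :: (A t i).map Sum.inr : List (Fin c ⊕ G.E)))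
      (h2 : e ∈ (Sum.inl j :: (A t j).map Sum.inr : List (Fin c ⊕ G.E)))
    rcases e with k | e
    · simp at h1 h2
      exact hij (h1.symm.trans h2)
    · simp at h1 h2
      exact (hA t).2 i j hij e h1 h2
  · intro A' hA'
    have key : ∀ t k, ∃ i q, A' t k = Sum.inl i :: q.map Sum.inr ∧ wk G S q (R t) := by
      intro t k
      have h1 := M_wk (hA' t) k
      have h2 := M_ne (hA' t) k
      cases hp : A' t k with
      | nil => exact absurd hp h2
      | cons e p =>
        rw [hp] at h1
        obtain ⟨h3, h4⟩ := h1
        rcases e with i | e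
        · obtain ⟨q, rfl, hq⟩ := addS_wk.1 h4
          exact ⟨i, q, rfl, hq⟩
        · exact absurd h3 (by simp [addS])
    choose s q hq hw using key
    have := hB q fun t => ⟨fun k => isPath_iff.2 ⟨?_, hw t k⟩, ?_⟩
    · refine this.trans ?_
      rw [← Set.ncard_image_of_injective _ (Sum.inr_injective (α := Fin c))]
      refine Set.ncard_le_ncard ?_ (@Set.toFinite _ _ (@Finite.of_fintype _
        (@Subtype.fintype _ _ (Classical.decPred _) (addS G S c).fintE)))
      rintro _ ⟨e, ⟨a, b, f, g, hfg, h1, h2⟩, rfl⟩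
      refine ⟨a, b, Sum.inr f, Sum.inr g, fun h => hfg (Sum.inr_injective h), ?_, ?_⟩
      · rw [hq]
        exact List.infix_cons (infix_map2 Sum.inr h1)
      · rw [hq]
        exact List.infix_cons (infix_map2 Sum.inr h2)
    · intro h0
      have := hw t k
      rw [h0] at this
      have hh : S = R t := this
      exact hG _ _ (hh ▸ (hA t).1 ⟨0, hc⟩ : G.IsPathFrom (R t) (R t) (A t ⟨0, hc⟩))
    · intro i j hij e h1 h2
      refine (hA' t).2 i j hij (Sum.inr e) ?_ ?_
      · rw [hq]; exact List.mem_cons_of_mem _ (List.mem_map_of_mem h1)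
      · rw [hq]; exact List.mem_cons_of_mem _ (List.mem_map_of_mem h2)
  · rintro (i | e)
    · simp [addS]
    · simp [addS]

section contr
open Classical in
noncomputable def con (G : MultiDigraph) (d0 g : G.E) : MultiDigraph :=
  ⟨G.V, {e : G.E // e ≠ g}, G.fintV, (have := G.fintE; inferInstance), fun e => G.src e.1,
    fun e => if e.1 = d0 then G.dst g else G.dst e.1⟩

variable {G : MultiDigraph} {d0 g : G.E}

theorem con_wk1 {p : List {e : G.E // e ≠ g}} (h : d0 ∉ p.map Subtype.val) {u v : G.V}
    (hw : wk G u (p.map Subtype.val) v) : wk (con G d0 g) u p v := by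
  induction p generalizing u with
  | nil => exact hw
  | cons e p ih =>
    simp only [List.map_cons, List.mem_cons, not_or] at h
    refine ⟨hw.1, ?_⟩
    have : (con G d0 g).dst e = G.dst e.1 := by simp [con, Ne.symm h.1]
    rw [this]
    exact ih h.2 hw.2

open Classical in
noncomputable def psi (d0 : G.E) (e : {e : G.E // e ≠ g}) : List G.E :=
  if e.1 = d0 then [d0, g] else [e.1]

theorem con_wk2 (hdg : G.dst d0 = G.src g) {p : List {e : G.E // e ≠ g}} {u v : G.V}
    (hw : wk (con G d0 g) u p v) : wk G u (p.flatMap (psi d0)) v := by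
  induction p generalizing u with
  | nil => exact hw
  | cons e p ih =>
    obtain ⟨h1, h2⟩ := hw
    have h3 := ih h2
    by_cases he : e.1 = d0
    · have : (con G d0 g).dst e = G.dst g := by simp [con, he]
      rw [this] at h3
      simp only [List.flatMap_cons, psi, he, if_true]
      exact ⟨he ▸ h1, hdg.symm, h3⟩
    · have : (con G d0 g).dst e = G.dst e.1 := by simp [con, he]
      rw [this] at h3
      simp only [List.flatMap_cons, psi, he, if_false]
      exact ⟨h1, h3⟩

theorem mem_psi {p : List {e : G.E // e ≠ g}} {x : G.E} (h : x ∈ p.flatMap (psi d0)) :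
    (∃ e ∈ p, e.1 = x) ∨ (x = g ∧ ∃ e ∈ p, e.1 = d0) := by
  rw [List.mem_flatMap] at h
  obtain ⟨e, he, hx⟩ := h
  by_cases h0 : e.1 = d0
  · simp [psi, h0] at hx
    rcases hx with rfl | rfl
    · exact Or.inl ⟨e, he, h0⟩
    · exact Or.inr ⟨rfl, e, he, h0⟩
  · simp [psi, h0] at hx
    exact Or.inl ⟨e, he, hx.symm⟩

open Classical in
theorem psi_infix {p : List {e : G.E // e ≠ g}} {f e} (h : [f, e] <:+: p) :
    [if f.1 = d0 then g else f.1, e.1] <:+: p.flatMap (psi d0) := by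
  obtain ⟨s, t, rfl⟩ := h
  simp only [List.flatMap_append, List.flatMap_cons, List.flatMap_nil, List.append_nil]
  have h1 : ∃ t, psi d0 e = e.1 :: t := by
    by_cases h : e.1 = d0 <;> simp [psi, h]
  have h2 : ∃ s, psi d0 f = s ++ [if f.1 = d0 then g else f.1] := by
    by_cases h : f.1 = d0
    · exact ⟨[d0], by simp [psi, h]⟩
    · exact ⟨[], by simp [psi, h]⟩
  obtain ⟨t1, ht⟩ := h1
  obtain ⟨s1, hs⟩ := h2
  rw [ht, hs]
  exact ⟨s.flatMap (psi d0) ++ s1, t1 ++ t.flatMap (psi d0), by simp⟩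
end contr

theorem S_nopred {G : MultiDigraph} {r} (hr : Rk G r) {S v : G.V} {p : List G.E} (h : wk G S p v)
    {f e : G.E} (hfe : [f, e] <:+: p) : G.src e ≠ S := by
  intro hs
  have h1 := wk_infix h hfe
  have h2 := ((wk_rank hr h).2.2 f (inf_l hfe)).1
  have := hr f
  rw [h1, hs] at this
  omega

theorem con_starD {G : MultiDigraph} {S R} {c B : ℕ} {d : Fin c → G.E} (h : StarD G S R c B d)
    {A : Fin 2 → Fin c → List G.E} (hA : ∀ t, G.MengerSystem S (R t) c (A t)) {i : Fin c} {g : G.E}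
    (hg : ∀ t, ∃ k, [d i, g] <:+: A t k) :
    ∃ d', StarD (con G (d i) g) S R c B d' := by
  classical
  obtain ⟨⟨hG, hR, -, hB⟩, hd, hS⟩ := h
  obtain ⟨r, hr⟩ := exists_rank hG
  have hdS : ∀ i, G.src (d i) = S := fun i => (hS _).2 ⟨i, rfl⟩
  have hdg : G.dst (d i) = G.src g := by
    obtain ⟨k, hk⟩ := hg 0
    exact wk_infix (M_wk (hA 0) k) hk
  have hgS : G.src g ≠ S := by
    intro h
    have := hr (d i)
    rw [hdg, h, hdS] at this
    omega
  have hdne : ∀ j, d j ≠ g := fun j h => hgS (h ▸ hdS j)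
  have hr' : Rk (con G (d i) g) r := by
    rintro ⟨e, he⟩
    by_cases h : e = d i
    · have := hr (d i)
      have := hr g
      rw [hdg] at *
      simp only [con, h, if_true]
      omega
    · have := hr e
      simpa only [con, h, if_false] using this
  have hG' := acyclic_of_rank hr'
  refine ⟨fun j => ⟨d j, hdne j⟩, ⟨hG', hR, ?_, ?_⟩, ?_, ?_⟩
  · have key : ∀ t k, ∃ p' : List {e : G.E // e ≠ g}, wk (con G (d i) g) S p' (R t) ∧ p' ≠ [] ∧
        ∀ e ∈ p', e.1 ∈ A t k := by
      intro t k
      have hnd := M_nd hG (hA t) k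
      by_cases hk : d i ∈ A t k
      · obtain ⟨k', hk'⟩ := hg t
        obtain rfl := M_idx (hA t) hk (inf_l hk')
        obtain ⟨P, Q, hPQ⟩ := hk'
        have hw := M_wk (hA t) k
        have e1 : A t k = P ++ d i :: g :: Q := by simp [← hPQ]
        rw [e1] at hw hnd
        have hw2 := (wk_mem_split hw).2
        have : g ∉ Q ∧ d i ∉ Q := by
          simp [List.nodup_append] at hnd
          tauto
        have hQ : ∀ x ∈ Q, x ≠ g := fun x hx h => this.1 (h ▸ hx)
        obtain ⟨Q', rfl⟩ : ∃ Q' : List {e : G.E // e ≠ g}, Q'.map Subtype.val = Q :=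
          ⟨Q.pmap Subtype.mk hQ, by simp [List.map_pmap]⟩
        refine ⟨⟨d i, hdne i⟩ :: Q', ⟨hdS i, ?_⟩, by simp, ?_⟩
        · have : (con G (d i) g).dst ⟨d i, hdne i⟩ = G.dst g := by simp [con]
          rw [this]
          exact con_wk1 (by tauto) hw2.2
        · intro e he
          rw [e1]
          rcases List.mem_cons.1 he with rfl | he
          · simp
          · have : e.1 ∈ Q'.map Subtype.val := List.mem_map_of_mem he
            simp only [List.mem_append, List.mem_cons]
            tauto
      · have hgn : g ∉ A t k := by
          intro hgk
          obtain ⟨k', hk'⟩ := hg t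
          obtain rfl := M_idx (hA t) hgk (inf_r hk')
          exact hk (inf_l hk')
        have hQ : ∀ x ∈ A t k, x ≠ g := fun x hx h => hgn (h ▸ hx)
        obtain ⟨Q', hQ'⟩ : ∃ Q' : List {e : G.E // e ≠ g}, Q'.map Subtype.val = A t k :=
          ⟨(A t k).pmap Subtype.mk hQ, by simp [List.map_pmap]⟩
        refine ⟨Q', con_wk1 (by rwa [hQ']) (by rw [hQ']; exact M_wk (hA t) k), ?_, ?_⟩
        · rintro rfl
          exact M_ne (hA t) k hQ'.symm
        · intro e he
          rw [← hQ']
          exact List.mem_map_of_mem he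
    choose A' h1 h2 h3 using key
    refine ⟨A', fun t => ⟨fun k => isPath_iff.2 ⟨h2 t k, h1 t k⟩, ?_⟩⟩
    intro a b hab e ha hb
    exact (hA t).2 a b hab e.1 (h3 t a e ha) (h3 t b e hb)
  · intro A' hA'
    have hM : ∀ t, G.MengerSystem S (R t) c (fun k => (A' t k).flatMap (psi (d i))) := by
      intro t
      refine ⟨fun k => isPath_iff.2 ⟨?_, con_wk2 hdg (M_wk (hA' t) k)⟩, ?_⟩
      · obtain ⟨e, he⟩ := List.exists_mem_of_ne_nil _ (M_ne (hA' t) k)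
        have : ∃ x, x ∈ psi (d i) e := by
          by_cases h : e.1 = d i
          · exact ⟨d i, by simp [psi, h]⟩
          · exact ⟨e.1, by simp [psi, h]⟩
        obtain ⟨x, hx⟩ := this
        exact List.ne_nil_of_mem (List.mem_flatMap.2 ⟨e, he, hx⟩)
      · intro a b hab x ha hb
        rcases mem_psi ha with ⟨e, he, h1⟩ | ⟨h1, e, he, h2⟩ <;>
        rcases mem_psi hb with ⟨e', he', h1'⟩ | ⟨h1', e', he', h2'⟩
        · obtain rfl : e = e' := Subtype.ext (h1.trans h1'.symm)
          exact (hA' t).2 a b hab e he he'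
        · exact e.2 (h1.trans h1')
        · exact e'.2 (h1'.trans h1)
        · obtain rfl : e = e' := Subtype.ext (h2.trans h2'.symm)
          exact (hA' t).2 a b hab e he he'
    refine (hB _ hM).trans ?_
    have himg := Set.ncard_image_of_injective (mg (E := {e : G.E // e ≠ g}) (A' 0) (A' 1))
      (Subtype.val_injective (p := fun e => e ≠ g))
    refine le_of_le_of_eq ?_ himg
    refine Set.ncard_le_ncard ?_ (@Set.toFinite _ _ (@Finite.of_fintype _
        (@Subtype.fintype _ _ (Classical.decPred _) G.fintE)))
    rintro e ⟨a, b, f, h, hfh, h1, h2⟩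
    have hpre : ∀ t k f, [f, g] <:+: (A' t k).flatMap (psi (d i)) → f = d i := by
      intro t k f hf
      rcases mem_psi (inf_r hf) with ⟨e, _, h⟩ | ⟨-, e, he, h⟩
      · exact absurd h e.2
      · obtain ⟨P, Q, hPQ⟩ := List.append_of_mem he
        refine M_pu hG (hM t) hf (j := k) ⟨P.flatMap (psi (d i)), Q.flatMap (psi (d i)), ?_⟩
        simp [hPQ, psi, h]
    have heg : e ≠ g := by
      rintro rfl
      exact hfh ((hpre 0 a f h1).trans (hpre 1 b h h2).symm)
    have hpred : ∀ t k f, [f, e] <:+: (A' t k).flatMap (psi (d i)) →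
        ∃ f' : {e : G.E // e ≠ g}, [f', ⟨e, heg⟩] <:+: A' t k ∧ f = if f'.1 = d i then g else f'.1 := by
      intro t k f hf
      have hmem : (⟨e, heg⟩ : {e : G.E // e ≠ g}) ∈ A' t k := by
        rcases mem_psi (inf_r hf) with ⟨e', he', h⟩ | ⟨h, -⟩
        · subst h; exact he'
        · exact absurd h heg
      rcases wk_pred (M_wk (hA' t) k) hmem with ⟨q, _, hq⟩ | ⟨f', hf'⟩
      · exact absurd hq (S_nopred hr (M_wk (hM t) k) hf)
      · exact ⟨f', hf', M_pu hG (hM t) hf (j := k) (psi_infix hf')⟩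
    obtain ⟨f', hf', rfl⟩ := hpred 0 a f h1
    obtain ⟨h', hh', rfl⟩ := hpred 1 b h h2
    refine ⟨⟨e, heg⟩, ⟨a, b, f', h', ?_, hf', hh'⟩, rfl⟩
    rintro rfl
    exact hfh rfl
  · intro a b hab
    exact hd (Subtype.ext_iff.1 hab)
  · rintro ⟨e, he⟩
    simp only [con, Subtype.mk.injEq]
    exact hS e

def Nrm (G : MultiDigraph) (S : G.V) (R : Fin 2 → G.V) (c : ℕ) (d : Fin c → G.E) : Prop :=
  ∀ A : Fin 2 → Fin c → List G.E, (∀ t, G.MengerSystem S (R t) c (A t)) →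
    ∀ i g, ¬ ∀ t, ∃ k, [d i, g] <:+: A t k

theorem exists_nrm {c B : ℕ} (hc : 0 < c) (h : ∃ G S R, Star G S R c B) :
    ∃ G S R d, StarD G S R c B d ∧ Nrm G S R c d := by
  obtain ⟨G, S, R, h⟩ := h
  have h0 := addS_starD hc h
  suffices H : ∀ N (G : MultiDigraph) S R d, Nat.card G.E = N → StarD G S R c B d →
      ∃ G S R d, StarD G S R c B d ∧ Nrm G S R c d from H _ _ _ _ _ rfl h0
  intro N
  induction N using Nat.strong_induction_on with
  | _ N ih =>
    intro G S R d hN hD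
    by_cases hn : Nrm G S R c d
    · exact ⟨G, S, R, d, hD, hn⟩
    · unfold Nrm at hn
      push Not at hn
      obtain ⟨A, hA, i, g, hg⟩ := hn
      obtain ⟨d', hd'⟩ := con_starD hD hA hg
      refine ih _ ?_ _ _ _ _ rfl hd'
      have := G.fintE
      rw [← hN]
      refine Finite.card_subtype_lt (p := fun e => e ≠ g) (x := g) (by simp)
end MP

namespace MP
open MultiDigraph

theorem claim1 {G : MultiDigraph} (hG : G.Acyclic) {S v v' : G.V} {c : ℕ} (hc : 0 < c)
    {α β : Fin c → List G.E} (hα : G.MengerSystem S v c α) (hβ : G.MengerSystem S v' c β)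
    {d : Fin c → G.E} (hS : ∀ e, G.src e = S ↔ ∃ i, e = d i)
    (h1 : ∀ i, ∃ q, α i = d i :: q) (h2 : ∀ i, ∃ q, β i = d i :: q)
    (hwf : WellFounded (Dto α β))
    (hn : ∀ i g k k', [d i, g] <:+: α k → ¬ [d i, g] <:+: β k') :
    ∃ a, ∀ e ∈ α a, ∀ j, e ∈ β j → e = d a := by
  obtain ⟨r, hr⟩ := exists_rank hG
  by_contra hcon
  push Not at hcon
  have key : ∀ a, ∃ z f, z ∈ mg α β ∧ z ∈ β f ∧ G.src z ≠ S ∧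
      ∃ T, (d a :: (T ++ [z])) <:+: α a ∧ ∀ e ∈ T, ¬ inn β e := by
    intro a
    obtain ⟨e, he, j, hj, hne⟩ := hcon a
    obtain ⟨q, hq⟩ := h1 a
    have heq : e ∈ q := by
      rw [hq] at he
      exact (List.mem_cons.1 he).resolve_left hne
    obtain ⟨T, z, C, rfl, ⟨k, hk⟩, hT⟩ := exists_first {e | inn β e} ⟨e, ⟨j, hj⟩, heq⟩
    have hinf : (d a :: (T ++ [z])) <:+: α a := ⟨[], C, by simp [hq]⟩
    obtain ⟨x, hx, hx'⟩ := last_pair (d a) z T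
    have hxz := hx.trans hinf
    have hzS := S_nopred hr (M_wk hα a) hxz
    rcases wk_pred (M_wk hβ k) hk with ⟨q', _, hq'⟩ | ⟨w, hw⟩
    · exact absurd hq' hzS
    refine ⟨z, k, ⟨a, k, x, w, ?_, hxz, hw⟩, hk, hzS, T, hinf, hT⟩
    rintro rfl
    rcases hx' with ⟨rfl, rfl⟩ | hx'
    · exact hn a z a k hxz hw
    · exact hT x hx' ⟨k, inf_l hw⟩
  choose z f hz hzf hzS T hT hTn using key
  have hD : ∀ a, Dto α β (z a) (z (f a)) := by
    intro a
    refine ⟨hz a, hz _, d (f a), T (f a), f a, f a, ?_, hT _, hTn _⟩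
    obtain ⟨q, hq⟩ := h2 (f a)
    have := hzf a
    rw [hq] at this ⊢
    rcases List.mem_cons.1 this with h | h
    · exact absurd ((hS _).2 ⟨_, h⟩) (hzS a)
    · exact List.Sublist.cons_cons _ (by simpa using h)
  have hfin : Finite G.E := @Finite.of_fintype _ G.fintE
  have hirr : ∀ y, ¬ Relation.TransGen (Dto α β) y y := fun y hh =>
    (hwf.transGen).irrefl.irrefl y hh
  have W : WellFounded (Function.swap (Relation.TransGen (Dto α β))) := by
    have : IsTrans G.E (Function.swap (Relation.TransGen (Dto α β))) :=
      ⟨fun a b c h1 h2 => Relation.TransGen.trans h2 h1⟩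
    have : Std.Irrefl (Function.swap (Relation.TransGen (Dto α β))) := ⟨fun a h => hirr a h⟩
    exact Finite.wellFounded_of_trans_of_irrefl _
  obtain ⟨m, ⟨a, rfl⟩, hm⟩ := W.has_min (Set.range z) ⟨z ⟨0, hc⟩, _, rfl⟩
  exact hm (z (f a)) ⟨_, rfl⟩ (Relation.TransGen.single (hD a))

theorem mg_reindex {E ι κ ι' κ' : Type*} (α : ι → List E) (β : κ → List E) (σ : ι' → ι) (τ : κ' → κ)
    (hσ : Function.Surjective σ) (hτ : Function.Surjective τ) :
    mg (fun i => α (σ i)) (fun j => β (τ j)) = mg α β := by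
  ext e
  constructor
  · rintro ⟨a, b, f, g, h⟩
    exact ⟨_, _, f, g, h⟩
  · rintro ⟨a, b, f, g, h⟩
    obtain ⟨a, rfl⟩ := hσ a
    obtain ⟨b, rfl⟩ := hτ b
    exact ⟨a, b, f, g, h⟩

theorem claimA {G : MultiDigraph} {S : G.V} {R : Fin 2 → G.V} {c B : ℕ} {d : Fin c → G.E}
    (hc : 0 < c) (hD : StarD G S R c B d) (hN : Nrm G S R c d) :
    ∃ A : Fin 2 → Fin c → List G.E, (∀ t, G.MengerSystem S (R t) c (A t)) ∧
      (∀ t i, ∃ q, A t i = d i :: q) ∧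
      ∃ a : Fin 2 → Fin c, ∀ t t', t ≠ t' → ∀ e ∈ A t (a t), ∀ j, e ∈ A t' j → e = d (a t) := by
  classical
  obtain ⟨⟨hG, hR, ⟨A0, hA0⟩, -⟩, hd, hS⟩ := hD
  have hne : {k : ℕ | ∃ A : Fin 2 → Fin c → List G.E, (∀ t, G.MengerSystem S (R t) c (A t)) ∧
      (mg (A 0) (A 1)).ncard = k}.Nonempty := ⟨_, A0, hA0, rfl⟩
  obtain ⟨A, hA, hk⟩ := Nat.sInf_mem hne
  have hmin0 : ∀ A' : Fin 2 → Fin c → List G.E, (∀ t, G.MengerSystem S (R t) c (A' t)) →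
      (mg (A 0) (A 1)).ncard ≤ (mg (A' 0) (A' 1)).ncard := by
    intro A' hA'
    rw [hk]
    exact Nat.sInf_le ⟨A', hA', rfl⟩
  have hh : ∀ t k, ∃ i q, A t k = d i :: q := by
    intro t k
    have h1 := M_wk (hA t) k
    have h2 := M_ne (hA t) k
    cases hp : A t k with
    | nil => exact absurd hp h2
    | cons e p =>
      rw [hp] at h1
      obtain ⟨i, rfl⟩ := (hS e).1 h1.1
      exact ⟨i, p, rfl⟩
  choose s q hq using hh
  have hs : ∀ t, Function.Injective (s t) := by
    intro t k k' h
    refine M_idx (hA t) (e := d (s t k)) ?_ ?_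
    · rw [hq]; simp
    · rw [hq, h]; simp
  have hsu : ∀ t, Function.Surjective (s t) := fun t => Finite.surjective_of_injective (hs t)
  choose σ hσ using hsu
  have hσi : ∀ t, Function.Injective (σ t) := fun t => Function.LeftInverse.injective (hσ t)
  have hσs : ∀ t, Function.Surjective (σ t) := fun t => Finite.surjective_of_injective (hσi t)
  let A2 : Fin 2 → Fin c → List G.E := fun t i => A t (σ t i)
  have hA2 : ∀ t, G.MengerSystem S (R t) c (A2 t) := fun t =>
    ⟨fun i => (hA t).1 _, fun i j hij => (hA t).2 _ _ fun h => hij (hσi t h)⟩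
  have hmin : ∀ A' : Fin 2 → Fin c → List G.E, (∀ t, G.MengerSystem S (R t) c (A' t)) →
      (mg (A2 0) (A2 1)).ncard ≤ (mg (A' 0) (A' 1)).ncard := by
    have : mg (A2 0) (A2 1) = mg (A 0) (A 1) := mg_reindex _ _ _ _ (hσs 0) (hσs 1)
    rw [this]
    exact hmin0
  have hhead : ∀ t i, ∃ q, A2 t i = d i :: q := by
    intro t i
    refine ⟨q t (σ t i), ?_⟩
    show A t (σ t i) = _
    rw [hq, hσ]
  have w1 : WellFounded (Dto (A2 0) (A2 1)) := by
    refine wf_Dto hG (hA2 0) (hA2 1) fun β' hβ' => ?_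
    have := hmin ![A2 0, β'] (by intro i; fin_cases i; exacts [hA2 0, hβ'])
    simpa using this
  have w2 : WellFounded (Dto (A2 1) (A2 0)) := by
    refine wf_Dto hG (hA2 1) (hA2 0) fun β' hβ' => ?_
    have := hmin ![β', A2 1] (by intro i; fin_cases i; exacts [hβ', hA2 1])
    rw [mg_comm (A2 1), mg_comm (A2 1)]
    simpa using this
  have hn : ∀ i g k k', [d i, g] <:+: A2 0 k → ¬ [d i, g] <:+: A2 1 k' := by
    intro i g k k' h1 h2
    refine hN A2 hA2 i g fun t => ?_
    fin_cases t
    exacts [⟨k, h1⟩, ⟨k', h2⟩]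
  obtain ⟨a0, ha0⟩ := claim1 hG hc (hA2 0) (hA2 1) hS (hhead 0) (hhead 1) w1 hn
  obtain ⟨a1, ha1⟩ := claim1 hG hc (hA2 1) (hA2 0) hS (hhead 1) (hhead 0) w2
    (fun i g k k' h1 h2 => hn i g k' k h2 h1)
  refine ⟨A2, hA2, hhead, ![a0, a1], ?_⟩
  intro t t' htt
  fin_cases t <;> fin_cases t'
  · exact absurd rfl htt
  · exact ha0
  · exact ha1
  · exact absurd rfl htt
end MP

namespace MP
open MultiDigraph

theorem exists_iota {m : ℕ} {x y : Fin (m + 2)} (hxy : x ≠ y) :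
    ∃ ι : Fin m → Fin (m + 2), Function.Injective ι ∧ ∀ i, (∃ k, ι k = i) ↔ i ≠ x ∧ i ≠ y := by
  have hcard : (({x, y} : Finset (Fin (m + 2)))ᶜ).card = m := by
    rw [Finset.card_compl, Finset.card_pair hxy]; simp
  refine ⟨Finset.orderEmbOfFin _ hcard, (Finset.orderEmbOfFin _ hcard).injective, fun i => ?_⟩
  have := Finset.range_orderEmbOfFin _ hcard
  have h2 : (∃ k, Finset.orderEmbOfFin _ hcard k = i) ↔ i ∈ Set.range (Finset.orderEmbOfFin _ hcard) :=
    Iff.rfl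
  rw [h2, this]
  simp [and_comm]

theorem exists_choice {m : ℕ} (a : Fin 2 → Fin (m + 2)) :
    ∃ (p : Fin 2 → Fin (m + 2)) (ι : Fin m → Fin (m + 2)), Function.Injective ι ∧
      (∀ t, p t ≠ a t) ∧ ∀ t i, (∃ k, ι k = i) ↔ i ≠ a t ∧ i ≠ p t := by
  by_cases h : a 0 = a 1
  · obtain ⟨y, hy⟩ := exists_ne (a 0)
    obtain ⟨ι, h1, h2⟩ := exists_iota hy.symm
    refine ⟨fun _ => y, ι, h1, ?_, ?_⟩
    · intro t; fin_cases t
      · exact hy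
      · exact h ▸ hy
    · intro t; fin_cases t
      · exact h2
      · simpa [← h] using h2
  · obtain ⟨ι, h1, h2⟩ := exists_iota h
    refine ⟨![a 1, a 0], ι, h1, ?_, ?_⟩
    · intro t; fin_cases t
      · exact Ne.symm h
      · exact h
    · intro t; fin_cases t
      · exact h2
      · intro i
        rw [h2 i]
        exact and_comm

inductive HV (V1 V2 : Type) : Type
  | v1 (x : V1) | v2 (x : V2) | s (t : Fin 2) | dead

inductive HE (E1 E2 : Type) (m : ℕ) : Type
  | e1 (e : E1) | e2 (e : E2) | u (t : Fin 2) (k : Fin m) | P (t : Fin 2)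

instance HV_finite {V1 V2 : Type} [Finite V1] [Finite V2] : Finite (HV V1 V2) := by
  let f : (V1 ⊕ V2) ⊕ (Fin 2 ⊕ Unit) → HV V1 V2 := fun x => match x with
    | .inl (.inl x) => .v1 x
    | .inl (.inr x) => .v2 x
    | .inr (.inl t) => .s t
    | .inr (.inr _) => .dead
  refine Finite.of_surjective f ?_
  rintro (x | x | t | _)
  exacts [⟨.inl (.inl x), rfl⟩, ⟨.inl (.inr x), rfl⟩, ⟨.inr (.inl t), rfl⟩, ⟨.inr (.inr ()), rfl⟩]

instance HE_finite {E1 E2 : Type} {m : ℕ} [Finite E1] [Finite E2] : Finite (HE E1 E2 m) := by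
  let f : (E1 ⊕ E2) ⊕ ((Fin 2 × Fin m) ⊕ Fin 2) → HE E1 E2 m := fun x => match x with
    | .inl (.inl x) => .e1 x
    | .inl (.inr x) => .e2 x
    | .inr (.inl t) => .u t.1 t.2
    | .inr (.inr t) => .P t
  refine Finite.of_surjective f ?_
  rintro (x | x | ⟨t, k⟩ | t)
  exacts [⟨.inl (.inl x), rfl⟩, ⟨.inl (.inr x), rfl⟩, ⟨.inr (.inl (t, k)), rfl⟩,
    ⟨.inr (.inr t), rfl⟩]

structure Cfg (m B1 B2 : ℕ) where
  G1 : MultiDigraph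
  G2 : MultiDigraph
  S : G1.V
  R : Fin 2 → G1.V
  T : G2.V
  Q : Fin 2 → G2.V
  d : Fin (m + 2) → G1.E
  A : Fin 2 → Fin (m + 2) → List G1.E
  a : Fin 2 → Fin (m + 2)
  p : Fin 2 → Fin (m + 2)
  ι : Fin m → Fin (m + 2)
  h1 : StarD G1 S R (m + 2) B1 d
  h2 : Star G2 T Q m B2
  hA : ∀ t, G1.MengerSystem S (R t) (m + 2) (A t)
  hh : ∀ t i, ∃ q, A t i = d i :: q
  ha : ∀ t t', t ≠ t' → ∀ e ∈ A t (a t), ∀ j, e ∈ A t' j → e = d (a t)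
  hι : Function.Injective ι
  hpa : ∀ t, p t ≠ a t
  hr : ∀ t i, (∃ k, ι k = i) ↔ i ≠ a t ∧ i ≠ p t

namespace Cfg
variable {m B1 B2 : ℕ} (X : Cfg m B1 B2)

def keep (e : X.G1.E) : Prop := (∀ t, e ∉ X.A t (X.a t)) ∧ ∀ i, e = X.d i → ∃ k, X.ι k = i

abbrev VV := HV X.G1.V X.G2.V
abbrev EE := HE X.G1.E X.G2.E m

open Classical in
noncomputable def hsrc : X.EE → X.VV
  | .e1 e => if ∃ k, e = X.d (X.ι k) then .v2 X.T else .v1 (X.G1.src e)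
  | .e2 e => .v2 (X.G2.dst e)
  | .u t _ => .s t
  | .P t => .s t

open Classical in
noncomputable def hdst : X.EE → X.VV
  | .e1 e => if X.keep e then .v1 (X.G1.dst e) else .dead
  | .e2 e => .v2 (X.G2.src e)
  | .u t _ => .v2 (X.Q t)
  | .P t => .v1 (X.G1.dst (X.d (X.p t)))

noncomputable abbrev H : MultiDigraph where
  V := X.VV
  E := X.EE
  fintV := (have := @Finite.of_fintype _ X.G1.fintV; have := @Finite.of_fintype _ X.G2.fintV
    Fintype.ofFinite _)
  fintE := (have := @Finite.of_fintype _ X.G1.fintE; have := @Finite.of_fintype _ X.G2.fintE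
    Fintype.ofFinite _)
  src := X.hsrc
  dst := X.hdst

theorem hdS (i) : X.G1.src (X.d i) = X.S := (X.h1.2.2 _).2 ⟨i, rfl⟩
theorem hdinj : Function.Injective X.d := X.h1.2.1
theorem dA {t i j} (h : X.d i ∈ X.A t j) : i = j := by
  obtain ⟨q, hq⟩ := X.hh t i
  exact M_idx (X.hA t) (by rw [hq]; simp) h

theorem keep_iota (k) : X.keep (X.d (X.ι k)) := by
  refine ⟨fun t h => ?_, fun i h => ⟨k, X.hdinj h⟩⟩
  exact ((X.hr t _).1 ⟨k, rfl⟩).1 (X.dA h)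

theorem src_iota (k) : X.hsrc (.e1 (X.d (X.ι k))) = .v2 X.T := by
  simp only [hsrc]
  rw [if_pos ⟨k, rfl⟩]
theorem dst_keep {e} (h : X.keep e) : X.hdst (.e1 e) = .v1 (X.G1.dst e) := by
  simp only [hdst]
  rw [if_pos h]
theorem src_non {e} (h : ∀ i, e ≠ X.d i) : X.hsrc (.e1 e) = .v1 (X.G1.src e) := by
  simp only [hsrc]
  rw [if_neg]
  rintro ⟨k, hk⟩
  exact h _ hk

def ok (e : X.G1.E) : Prop := X.keep e ∧ ∀ i, e ≠ X.d i

theorem dead_wk {p : List X.EE} {y} (h : wk X.H .dead p y) : y = .dead := by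
  cases p with
  | nil => exact Eq.symm h
  | cons e p =>
    have := h.1
    rcases e with e | e | ⟨t, k⟩ | t <;> simp only [hsrc] at this
    · split_ifs at this
    all_goals cases this

theorem e1_cases {e p} {x : X.VV} {y} (h : wk X.H x (.e1 e :: p) (.v1 y)) :
    X.keep e ∧ wk X.H (.v1 (X.G1.dst e)) p (.v1 y) ∧
    ((∃ k, e = X.d (X.ι k)) ∧ x = .v2 X.T ∨ (∀ i, e ≠ X.d i) ∧ x = .v1 (X.G1.src e)) := by
  obtain ⟨h1, h2⟩ := h
  have hk : X.keep e := by
    by_contra hk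
    have : X.H.dst (.e1 e) = .dead := by
      show X.hdst (.e1 e) = _
      simp only [hdst]
      rw [if_neg hk]
    rw [this] at h2
    cases X.dead_wk h2
  refine ⟨hk, ?_, ?_⟩
  · have : X.H.dst (.e1 e) = .v1 (X.G1.dst e) := X.dst_keep hk
    rwa [this] at h2
  · by_cases he : ∃ k, e = X.d (X.ι k)
    · obtain ⟨k, rfl⟩ := he
      exact Or.inl ⟨⟨k, rfl⟩, h1.symm.trans (X.src_iota k)⟩
    · have : ∀ i, e ≠ X.d i := by
        rintro i rfl
        obtain ⟨k, rfl⟩ := hk.2 i rfl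
        exact he ⟨k, rfl⟩
      exact Or.inr ⟨this, h1.symm.trans (X.src_non this)⟩

theorem v1_wk {p : List X.EE} {x y} (h : wk X.H (.v1 x) p (.v1 y)) :
    ∃ q : List X.G1.E, p = q.map .e1 ∧ wk X.G1 x q y ∧ ∀ e ∈ q, X.ok e := by
  induction p generalizing x with
  | nil => exact ⟨[], rfl, by injection h, by simp⟩
  | cons e p ih =>
    rcases e with e | e | ⟨t, k⟩ | t
    · obtain ⟨h1, h2, h3 | h3⟩ := X.e1_cases h
      · cases h3.2
      · obtain ⟨q, rfl, hq, hk⟩ := ih h2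
        refine ⟨e :: q, rfl, ⟨?_, hq⟩, ?_⟩
        · have := h3.2
          injection this with this
          exact this.symm
        · intro e' he'
          rcases List.mem_cons.1 he' with rfl | he'
          · exact ⟨h1, h3.1⟩
          · exact hk _ he'
    all_goals
      have h1 := h.1
      cases h1

theorem v1_wk' {q : List X.G1.E} {x y} (h : wk X.G1 x q y) (hk : ∀ e ∈ q, X.ok e) :
    wk X.H (.v1 x) (q.map .e1) (.v1 y) := by
  induction q generalizing x with
  | nil => exact congrArg HV.v1 h
  | cons e q ih =>
    obtain ⟨h1, h2⟩ := h
    have he := hk e (by simp)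
    refine ⟨(X.src_non he.2).trans (congrArg _ h1), ?_⟩
    have : X.H.dst (.e1 e) = .v1 (X.G1.dst e) := X.dst_keep he.1
    show wk X.H (X.H.dst (.e1 e)) _ _
    rw [this]
    exact ih h2 fun e he => hk e (by simp [he])

theorem v2_wk {p : List X.EE} {x y} (h : wk X.H (.v2 x) p (.v1 y)) :
    ∃ (q : List X.G2.E) (k : Fin m) (r : List X.G1.E), p = q.map .e2 ++ .e1 (X.d (X.ι k)) :: r.map .e1 ∧ wk X.G2 X.T q.reverse x ∧
      wk X.G1 (X.G1.dst (X.d (X.ι k))) r y ∧ ∀ e ∈ r, X.ok e := by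
  induction p generalizing x with
  | nil => cases h
  | cons e p ih =>
    rcases e with e | e | ⟨t, k⟩ | t
    · obtain ⟨h1, h2, h3 | h3⟩ := X.e1_cases h
      · obtain ⟨⟨k, rfl⟩, h3⟩ := h3
        obtain ⟨r, rfl, hr, hk⟩ := X.v1_wk h2
        refine ⟨[], k, r, rfl, ?_, hr, hk⟩
        injection h3 with h3
        exact h3.symm
      · cases h3.2
    · obtain ⟨q, k, r, rfl, h1, h2, h3⟩ := ih h.2
      have h0 : HV.v2 (X.G2.dst e) = HV.v2 x := h.1
      injection h0 with h0
      refine ⟨e :: q, k, r, rfl, ?_, h2, h3⟩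
      rw [List.reverse_cons]
      exact wk_append.2 ⟨_, h1, rfl, h0⟩
    all_goals
      have h1 := h.1
      cases h1

theorem v2_wk' {q : List X.G2.E} {x y} (h : wk X.G2 y q x) :
    wk X.H (.v2 x) (q.reverse.map .e2) (.v2 y) := by
  induction q generalizing y with
  | nil => exact congrArg HV.v2 (Eq.symm h)
  | cons e q ih =>
    obtain ⟨rfl, h2⟩ := h
    rw [List.reverse_cons, List.map_append]
    exact wk_append.2 ⟨_, ih h2, rfl, rfl⟩

theorem s_wk {p : List X.EE} {t y} (h : wk X.H (.s t) p (.v1 y)) :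
    (∃ q : List X.G1.E, p = .P t :: q.map .e1 ∧ wk X.G1 (X.G1.dst (X.d (X.p t))) q y ∧ ∀ e ∈ q, X.ok e) ∨
    ∃ (k0 : Fin m) (q : List X.G2.E) (k : Fin m) (r : List X.G1.E), p = .u t k0 :: (q.map .e2 ++ .e1 (X.d (X.ι k)) :: r.map .e1) ∧
      wk X.G2 X.T q.reverse (X.Q t) ∧
      wk X.G1 (X.G1.dst (X.d (X.ι k))) r y ∧ ∀ e ∈ r, X.ok e := by
  cases p with
  | nil => cases h
  | cons e p =>
    rcases e with e | e | ⟨t', k⟩ | t'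
    · obtain ⟨h1, h2, h3 | h3⟩ := X.e1_cases h
      · cases h3.2
      · cases h3.2
    · have h1 := h.1
      cases h1
    · have h1 : HV.s t' = HV.s t := h.1
      injection h1 with h1
      subst h1
      obtain ⟨q, k', r, rfl, hq⟩ := X.v2_wk h.2
      exact Or.inr ⟨k, q, k', r, rfl, hq⟩
    · have h1 : HV.s t' = HV.s t := h.1
      injection h1 with h1
      subst h1
      obtain ⟨q, rfl, hq⟩ := X.v1_wk h.2
      exact Or.inl ⟨q, rfl, hq⟩

theorem exists_Hrank : ∃ r, Rk X.H r := by
  obtain ⟨r1, hr1⟩ := exists_rank X.h1.1.1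
  obtain ⟨r2, hr2⟩ := exists_rank X.h2.1
  have := @Finite.of_fintype _ X.G1.fintV
  have := @Finite.of_fintype _ X.G2.fintV
  obtain ⟨K1, hK1⟩ : ∃ K, ∀ v, r1 v ≤ K := by
    obtain ⟨K, hK⟩ := (Set.finite_range r1).bddAbove
    exact ⟨K, fun v => hK ⟨v, rfl⟩⟩
  obtain ⟨K2, hK2⟩ : ∃ K, ∀ v, r2 v ≤ K := by
    obtain ⟨K, hK⟩ := (Set.finite_range r2).bddAbove
    exact ⟨K, fun v => hK ⟨v, rfl⟩⟩
  refine ⟨fun v => match v with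
    | .v1 x => K2 + 2 + r1 x
    | .v2 x => 1 + (K2 - r2 x)
    | .s _ => 0
    | .dead => K2 + 3 + K1, ?_⟩
  rintro (e | e | ⟨t, k⟩ | t)
  · have := hr1 e
    have := hK1 (X.G1.src e)
    by_cases h : ∃ k, e = X.d (X.ι k) <;> by_cases hk : X.keep e <;>
      simp [hsrc, hdst, h, hk] <;> omega
  · have := hr2 e
    have := hK2 (X.G2.dst e)
    simp only [hsrc, hdst]
    omega
  · simp [hsrc, hdst]
  · simp [hsrc, hdst]

theorem hac : X.H.Acyclic :=
  let ⟨_, hr⟩ := X.exists_Hrank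
  acyclic_of_rank hr

end Cfg
end MP

namespace MP
open MultiDigraph
namespace Cfg
variable {m B1 B2 : ℕ} (X : Cfg m B1 B2)

theorem tail_ok {t i q} (hi : i ≠ X.a t) (hq : X.A t i = X.d i :: q) : ∀ e ∈ q, X.ok e := by
  intro e he
  have hmem : e ∈ X.A t i := by rw [hq]; simp [he]
  have hnd : ∀ j, e ≠ X.d j := by
    rintro j rfl
    obtain rfl := X.dA hmem
    have := M_nd X.h1.1.1 (X.hA t) j
    rw [hq] at this
    exact (List.nodup_cons.1 this).1 he
  refine ⟨⟨fun t' h => ?_, fun j hj => absurd hj (hnd j)⟩, hnd⟩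
  by_cases htt : t' = t
  · subst htt
    exact hi (M_idx (X.hA t') hmem h)
  · exact hnd _ (X.ha t' t htt e h i hmem)

theorem head_mem {p : List X.EE} {t y} (h : wk X.H (.s t) p (.v1 y)) :
    ∃ o : Option (Fin m), (o.elim (.P t) (.u t) : X.EE) ∈ p := by
  rcases X.s_wk h with ⟨q, rfl, -⟩ | ⟨k0, q, k, r, rfl, -⟩
  · exact ⟨none, by simp⟩
  · exact ⟨some k0, by simp⟩

theorem mincut (t) : X.H.MinCut (.s t) (.v1 (X.R t)) (m + 1) := by
  constructor
  · obtain ⟨Γ, hΓ⟩ := X.h2.2.2.1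
    choose q hq using X.hh
    let p0 : List X.EE := .P t :: (q t (X.p t)).map .e1
    let pk : Fin m → List X.EE := fun k => .u t k :: ((Γ t k).reverse.map .e2 ++
      .e1 (X.d (X.ι k)) :: (q t (X.ι k)).map .e1)
    have hia : ∀ k, X.ι k ≠ X.a t := fun k => ((X.hr t _).1 ⟨k, rfl⟩).1
    have hip : ∀ k, X.ι k ≠ X.p t := fun k => ((X.hr t _).1 ⟨k, rfl⟩).2
    have hmq : ∀ i e, e ∈ q t i → e ∈ X.A t i := fun i e he => by rw [hq]; simp [he]
    have hwq : ∀ i, wk X.G1 (X.G1.dst (X.d i)) (q t i) (X.R t) := by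
      intro i
      have := M_wk (X.hA t) i
      rw [hq] at this
      exact this.2
    have h0 : wk X.H (.s t) p0 (.v1 (X.R t)) :=
      ⟨rfl, X.v1_wk' (hwq _) (X.tail_ok (X.hpa t) (hq t _))⟩
    have hk : ∀ k, wk X.H (.s t) (pk k) (.v1 (X.R t)) := by
      intro k
      refine ⟨rfl, wk_append.2 ⟨.v2 X.T, X.v2_wk' (M_wk (hΓ t) k), X.src_iota k, ?_⟩⟩
      have : X.H.dst (.e1 (X.d (X.ι k))) = .v1 (X.G1.dst (X.d (X.ι k))) := X.dst_keep (X.keep_iota k)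
      rw [this]
      exact X.v1_wk' (hwq _) (X.tail_ok (hia k) (hq t _))
    have m0 : ∀ e ∈ p0, e = .P t ∨ ∃ x ∈ X.A t (X.p t), e = .e1 x := by
      intro e he
      rcases List.mem_cons.1 he with rfl | he
      · exact Or.inl rfl
      · obtain ⟨x, hx, rfl⟩ := List.mem_map.1 he
        exact Or.inr ⟨x, hmq _ _ hx, rfl⟩
    have mk : ∀ k, ∀ e ∈ pk k, e = .u t k ∨ (∃ x ∈ Γ t k, e = .e2 x) ∨
        ∃ x ∈ X.A t (X.ι k), e = .e1 x := by
      intro k e he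
      rcases List.mem_cons.1 he with rfl | he
      · exact Or.inl rfl
      · rcases List.mem_append.1 he with he | he
        · obtain ⟨x, hx, rfl⟩ := List.mem_map.1 he
          exact Or.inr (Or.inl ⟨x, by simpa using hx, rfl⟩)
        · rcases List.mem_cons.1 he with rfl | he
          · exact Or.inr (Or.inr ⟨_, by rw [hq]; simp, rfl⟩)
          · obtain ⟨x, hx, rfl⟩ := List.mem_map.1 he
            exact Or.inr (Or.inr ⟨x, hmq _ _ hx, rfl⟩)
    have d0 : ∀ k e, e ∈ p0 → e ∉ pk k := by
      intro k e h1 h2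
      rcases m0 e h1 with rfl | ⟨x, hx, rfl⟩
      · rcases mk k _ h2 with h | ⟨_, _, h⟩ | ⟨_, _, h⟩ <;> cases h
      · rcases mk k _ h2 with h | ⟨_, _, h⟩ | ⟨y, hy, h⟩
        · cases h
        · cases h
        · injection h with h
          subst h
          exact hip k (M_idx (X.hA t) hy hx)
    have dk : ∀ k k' e, k ≠ k' → e ∈ pk k → e ∉ pk k' := by
      intro k k' e hkk h1 h2
      rcases mk k _ h1 with rfl | ⟨x, hx, rfl⟩ | ⟨x, hx, rfl⟩ <;>
      rcases mk k' _ h2 with h | ⟨y, hy, h⟩ | ⟨y, hy, h⟩ <;> cases h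
      · exact hkk rfl
      · exact hkk (M_idx (hΓ t) hx hy)
      · exact hkk (X.hι (M_idx (X.hA t) hx hy))
    refine ⟨Fin.cons p0 pk, fun i => isPath_iff.2 ?_, ?_⟩
    · refine Fin.cases ?_ (fun k => ?_) i
      · exact ⟨by simp [p0], h0⟩
      · exact ⟨by simp [pk], hk k⟩
    · intro i j
      refine Fin.cases ?_ (fun k => ?_) i <;> refine Fin.cases ?_ (fun k' => ?_) j
      · intro h; exact absurd rfl h
      · intro _ e h1 h2
        exact d0 k' e h1 h2
      · intro _ e h1 h2
        exact d0 k e h2 h1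
      · intro h e h1 h2
        exact dk k k' e (fun hh => h (by rw [hh])) h1 h2
  · rintro ⟨α, hα⟩
    have := fun i => X.head_mem (M_wk hα i)
    choose o ho using this
    have hinj : Function.Injective o := by
      intro i j hij
      refine M_idx hα (ho i) ?_
      rw [hij]; exact ho j
    have := Fintype.card_le_of_injective o hinj
    simp at this

def pi1 : X.EE → Option X.G1.E
  | .e1 e => some e
  | .e2 _ => none
  | .u _ _ => none
  | .P t => some (X.d (X.p t))

theorem fm1 (q : List X.G1.E) : (q.map (.e1 : _ → X.EE)).filterMap X.pi1 = q := by
  induction q with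
  | nil => rfl
  | cons e q ih =>
    show e :: (q.map (.e1 : _ → X.EE)).filterMap X.pi1 = e :: q
    rw [ih]
theorem fm2 (q : List X.G2.E) : (q.map (.e2 : _ → X.EE)).filterMap X.pi1 = [] := by
  induction q with
  | nil => rfl
  | cons e q ih => simp [pi1]

theorem proj1 {p : List X.EE} {t y} (h : wk X.H (.s t) p (.v1 y)) :
    p.filterMap X.pi1 ≠ [] ∧ wk X.G1 X.S (p.filterMap X.pi1) y ∧
    ∀ x ∈ p.filterMap X.pi1, (x = X.d (X.p t) ∧ .P t ∈ p) ∨ (.e1 x ∈ p ∧ X.keep x) := by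
  rcases X.s_wk h with ⟨q, rfl, h1, h2⟩ | ⟨k0, q, k, r, rfl, h0, h1, h2⟩
  · have : (HE.P t :: q.map (.e1 : _ → X.EE)).filterMap X.pi1 = X.d (X.p t) :: q := by
      show X.d (X.p t) :: (q.map (.e1 : _ → X.EE)).filterMap X.pi1 = _
      rw [fm1]
    rw [this]
    refine ⟨by simp, ⟨X.hdS _, h1⟩, ?_⟩
    intro x hx
    rcases List.mem_cons.1 hx with rfl | hx
    · left; simp
    · right; exact ⟨by simp [hx], (h2 x hx).1⟩
  · have : (HE.u t k0 :: (q.map (.e2 : _ → X.EE) ++ .e1 (X.d (X.ι k)) :: r.map .e1)).filterMap X.pi1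
        = X.d (X.ι k) :: r := by
      rw [List.filterMap_cons_none rfl, List.filterMap_append, fm2, List.nil_append]
      show X.d (X.ι k) :: (r.map (.e1 : _ → X.EE)).filterMap X.pi1 = _
      rw [fm1]
    rw [this]
    refine ⟨by simp, ⟨X.hdS _, h1⟩, ?_⟩
    intro x hx
    right
    rcases List.mem_cons.1 hx with rfl | hx
    · exact ⟨by simp, X.keep_iota k⟩
    · exact ⟨by simp [hx], (h2 x hx).1⟩

theorem infix_fm {E F : Type*} (φ : E → Option F) {p : List E} {x y : E} {x' y' : F}
    (h : [x, y] <:+: p) (hx : φ x = some x') (hy : φ y = some y') :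
    [x', y'] <:+: p.filterMap φ := by
  obtain ⟨s, t, rfl⟩ := h
  exact ⟨s.filterMap φ, t.filterMap φ, by simp [hx, hy]⟩

variable {A' : Fin 2 → Fin (m + 1) → List X.EE}
    (hA' : ∀ t, X.H.MengerSystem (.s t) (.v1 (X.R t)) (m + 1) (A' t))
include hA'

theorem noP {t t' i} (h : HE.P t' ∈ A' t i) : t' = t := by
  rcases X.s_wk (M_wk (hA' t) i) with ⟨q, hq, _⟩ | ⟨k0, q, k, r, hq, _⟩ <;>
  · rw [hq] at h
    simpa using h

theorem noU {t t' i k} (h : HE.u t' k ∈ A' t i) : t' = t := by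
  rcases X.s_wk (M_wk (hA' t) i) with ⟨q, hq, _⟩ | ⟨k0, q, k, r, hq, _⟩ <;>
  · rw [hq] at h
    simp at h
    try exact h.1

theorem keepmem {t i x} (h : HE.e1 x ∈ A' t i) : X.keep x := by
  rcases X.s_wk (M_wk (hA' t) i) with ⟨q, hq, _, h2⟩ | ⟨k0, q, k, r, hq, _, _, h2⟩ <;>
  · rw [hq] at h
    simp at h
    first
      | exact (h2 x h).1
      | rcases h with rfl | h
        · exact X.keep_iota k
        · exact (h2 x h).1

theorem fam1 (t) : X.G1.MengerSystem X.S (X.R t) (m + 2)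
    (Fin.cons (X.A t (X.a t)) (fun i => (A' t i).filterMap X.pi1)) := by
  have hp := fun i => X.proj1 (M_wk (hA' t) i)
  have hd0 : ∀ i e, e ∈ X.A t (X.a t) → e ∉ (A' t i).filterMap X.pi1 := by
    intro i e h1 h2
    rcases (hp i).2.2 e h2 with ⟨rfl, _⟩ | ⟨_, hk⟩
    · exact X.hpa t (X.dA h1)
    · exact hk.1 t h1
  refine ⟨fun i => isPath_iff.2 ?_, ?_⟩
  · refine Fin.cases ?_ (fun k => ?_) i
    · exact ⟨M_ne (X.hA t) _, M_wk (X.hA t) _⟩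
    · exact ⟨(hp k).1, (hp k).2.1⟩
  · intro i j
    refine Fin.cases ?_ (fun k => ?_) i <;> refine Fin.cases ?_ (fun k' => ?_) j
    · intro h; exact absurd rfl h
    · intro _ e h1 h2
      exact hd0 k' e h1 h2
    · intro _ e h1 h2
      exact hd0 k e h2 h1
    · intro hkk e h1 h2
      have hne : k ≠ k' := fun hh => hkk (by rw [hh])
      have hx : ∀ k k', k ≠ k' → HE.P t ∈ A' t k → .e1 (X.d (X.p t)) ∈ A' t k' → False := by
        intro k k' _ _ h
        obtain ⟨j, hj⟩ := (X.keepmem hA' h).2 _ rfl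
        exact ((X.hr t _).1 ⟨j, hj⟩).2 rfl
      rcases (hp k).2.2 e h1 with ⟨rfl, h3⟩ | ⟨h3, _⟩ <;>
      rcases (hp k').2.2 _ h2 with ⟨h5, h4⟩ | ⟨h4, _⟩
      · exact hne (M_idx (hA' t) h3 h4)
      · exact hx _ _ hne h3 h4
      · subst h5
        exact hx _ _ hne.symm h4 h3
      · exact hne (M_idx (hA' t) h3 h4)

theorem head_src {t i e q} (h : A' t i = e :: q) : X.hsrc e = .s t := by
  have := M_wk (hA' t) i
  rw [h] at this
  exact this.1

/-- lifting of predecessors -/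
theorem lift_pred {t f e} {i : Fin (m + 2)}
    (h : [f, e] <:+: (Fin.cons (X.A t (X.a t)) (fun i => (A' t i).filterMap X.pi1) :
      Fin (m + 2) → List X.G1.E) i) (hk : X.keep e) :
    (∀ j, e ≠ X.d j) ∧ ∃ k f', [f', .e1 e] <:+: A' t k ∧ X.pi1 f' = some f := by
  have hM := X.fam1 hA' t
  obtain ⟨r, hr⟩ := exists_rank X.h1.1.1
  have hnd : ∀ j, e ≠ X.d j := by
    rintro j rfl
    exact S_nopred hr (M_wk hM i) h (X.hdS j)
  refine ⟨hnd, ?_⟩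
  have hmem : ∃ k, .e1 e ∈ A' t k := by
    revert h
    refine Fin.cases ?_ (fun k => ?_) i
    · intro h
      exact absurd (inf_r h) (hk.1 t)
    · intro h
      rcases (X.proj1 (M_wk (hA' t) k)).2.2 e (inf_r h) with ⟨h, _⟩ | ⟨h, _⟩
      · exact absurd h (hnd _)
      · exact ⟨k, h⟩
  obtain ⟨k, hk'⟩ := hmem
  rcases wk_pred (M_wk (hA' t) k) hk' with ⟨q, hq, hs⟩ | ⟨f', hf'⟩
  · have := X.head_src hA' hq
    rw [X.src_non hnd] at this
    cases this
  · refine ⟨k, f', hf', ?_⟩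
    have hds : X.hdst f' = .v1 (X.G1.src e) := (wk_infix (M_wk (hA' t) k) hf').trans (X.src_non hnd)
    have hsome : ∃ f0, X.pi1 f' = some f0 := by
      rcases f' with e' | e' | ⟨t', k'⟩ | t'
      · exact ⟨_, rfl⟩
      · cases hds
      · cases hds
      · exact ⟨_, rfl⟩
    obtain ⟨f0, hf0⟩ := hsome
    rw [hf0]
    have h1 : [f0, e] <:+: (Fin.cons (X.A t (X.a t)) (fun i => (A' t i).filterMap X.pi1) :
      Fin (m + 2) → List X.G1.E) k.succ := infix_fm X.pi1 hf' hf0 rfl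
    rw [M_pu X.h1.1.1 hM h1 h]

theorem part1 : ∃ M1 : Set X.G1.E, B1 ≤ M1.ncard ∧ (∀ e ∈ M1, ∀ j, e ≠ X.d j) ∧
    ∀ e ∈ M1, .e1 e ∈ mg (A' 0) (A' 1) := by
  have hB := X.h1.1.2.2.2 (fun t => Fin.cons (X.A t (X.a t)) (fun i => (A' t i).filterMap X.pi1))
    (fun t => X.fam1 hA' t)
  refine ⟨_, hB, ?_⟩
  obtain ⟨r, hr⟩ := exists_rank X.h1.1.1
  rw [← forall₂_and]
  rintro e ⟨i, j, f, g, hfg, h1, h2⟩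
  have hnd : ∀ j, e ≠ X.d j := by
    rintro j rfl
    exact S_nopred hr (M_wk (X.fam1 hA' 0) i) h1 (X.hdS j)
  have hmem : ∀ t (i : Fin (m + 2)), e ∈ (Fin.cons (X.A t (X.a t)) (fun i => (A' t i).filterMap X.pi1) :
      Fin (m + 2) → List X.G1.E) i → e ∈ X.A t (X.a t) ∨ X.keep e := by
    intro t i
    refine Fin.cases ?_ (fun k => ?_) i
    · intro h; exact Or.inl h
    · intro h
      rcases (X.proj1 (M_wk (hA' t) k)).2.2 e h with ⟨h, _⟩ | ⟨_, h⟩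
      · exact absurd h (hnd _)
      · exact Or.inr h
  have hk : X.keep e := by
    rcases hmem 0 i (inf_r h1) with h | h
    · rcases hmem 1 j (inf_r h2) with h' | h'
      · exact absurd (X.ha 0 1 (by simp) e h _ h') (hnd _)
      · exact h'
    · exact h
  refine ⟨hnd, ?_⟩
  obtain ⟨-, k, f', h3, h4⟩ := X.lift_pred hA' h1 hk
  obtain ⟨-, k', g', h3', h4'⟩ := X.lift_pred hA' h2 hk
  refine ⟨k, k', f', g', ?_, h3, h3'⟩
  rintro rfl
  rw [h4] at h4'
  exact hfg (Option.some_injective _ h4')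

end Cfg
end MP

namespace MP
open MultiDigraph

theorem starts {E : Type*} [Finite E] (Rs : E → E → Prop) (rk : E → ℕ)
    (hrk : ∀ x y, Rs x y → rk x < rk y) (W M Z : Set E)
    (hst : ∀ z ∈ W, z ∈ M ∨ ∃ x, Rs x z) (hback : ∀ x y, Rs x y → y ∈ W → x ∈ W)
    (hru : ∀ x y y', Rs x y → Rs x y' → y = y')
    (hZW : Z ⊆ W) (hZ : ∀ z ∈ Z, ∀ y ∈ W, ¬ Rs z y) : Z.ncard ≤ (M ∩ W).ncard := by
  have key : ∀ n z, rk z = n → z ∈ W → ∃ s ∈ M ∩ W, Relation.ReflTransGen Rs s z := by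
    intro n
    induction n using Nat.strong_induction_on with
    | _ n ih =>
      intro z hz hzW
      rcases hst z hzW with h | ⟨x, hx⟩
      · exact ⟨z, ⟨h, hzW⟩, .refl⟩
      · obtain ⟨s, hs, h⟩ := ih (rk x) (hz ▸ hrk x z hx) x rfl (hback x z hx hzW)
        exact ⟨s, hs, h.tail hx⟩
  have key2 : ∀ z : E, ∃ s, z ∈ Z → s ∈ M ∩ W ∧ Relation.ReflTransGen Rs s z := by
    intro z
    by_cases h : z ∈ Z
    · obtain ⟨s, hs⟩ := key _ z rfl (hZW h)
      exact ⟨s, fun _ => hs⟩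
    · exact ⟨z, fun h' => absurd h' h⟩
  choose φ hφ using key2
  have hbt : ∀ x y, Relation.ReflTransGen Rs x y → y ∈ W → x ∈ W := by
    intro x y h
    induction h with
    | refl => exact id
    | tail _ h ih => exact fun hc => ih (hback _ _ h hc)
  have hend : ∀ z ∈ Z, ∀ z' ∈ Z, Relation.ReflTransGen Rs z z' → z = z' := by
    intro z hz z' hz' h
    rcases Relation.ReflTransGen.cases_head h with h | ⟨y, h1, h2⟩
    · exact h
    · exact absurd h1 (hZ z hz y (hbt _ _ h2 (hZW hz')))
  refine Set.ncard_le_ncard_of_injOn φ (fun z hz => (hφ z hz).1) ?_ (Set.toFinite _)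
  intro z hz z' hz' h
  have h1 := (hφ z hz).2
  have h2 := (hφ z' hz').2
  rw [← h] at h2
  rcases Relation.ReflTransGen.total_of_right_unique (fun a b c => hru a b c) h1 h2 with h | h
  · exact hend z hz z' hz' h
  · exact (hend z' hz' z hz h).symm

namespace Cfg
variable {m B1 B2 : ℕ} (X : Cfg m B1 B2)

def W (A' : Fin 2 → Fin (m + 1) → List X.EE) : Set X.EE :=
  {x | (∀ t, ∃ i, x ∈ A' t i) ∧ ((∃ e, x = .e2 e) ∨ ∃ k, x = .e1 (X.d (X.ι k)))}

variable {A' : Fin 2 → Fin (m + 1) → List X.EE}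
    (hA' : ∀ t, X.H.MengerSystem (.s t) (.v1 (X.R t)) (m + 1) (A' t))
include hA'

theorem fam2 (t) : ∃ (κ : Fin m → Fin (m + 1)) (q : Fin m → List X.G2.E) (x : Fin m → Fin m),
    X.G2.MengerSystem X.T (X.Q t) m (fun k => (q k).reverse) ∧ Function.Injective x ∧
    ∀ k, ∃ r, A' t (κ k) = .u t k :: ((q k).map .e2 ++ .e1 (X.d (X.ι (x k))) :: r) := by
  have := fun i => X.head_mem (M_wk (hA' t) i)
  choose o ho using this
  have hinj : Function.Injective o := by
    intro i j hij
    refine M_idx (hA' t) (ho i) ?_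
    rw [hij]; exact ho j
  have hbij : Function.Bijective o :=
    (Fintype.bijective_iff_injective_and_card o).2 ⟨hinj, by simp⟩
  have key : ∀ k : Fin m, ∃ (i : Fin (m + 1)) (q : List X.G2.E) (x : Fin m) (r : List X.EE),
      A' t i = .u t k :: (q.map .e2 ++ .e1 (X.d (X.ι x)) :: r) ∧
      wk X.G2 X.T q.reverse (X.Q t) := by
    intro k
    obtain ⟨i, hi⟩ := hbij.2 (some k)
    have hm := ho i
    rw [hi] at hm
    rcases X.s_wk (M_wk (hA' t) i) with ⟨q, hq, _⟩ | ⟨k0, q, x, r, hq, h1, h2⟩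
    · rw [hq] at hm
      simp at hm
    · have : k = k0 := by
        rw [hq] at hm
        simpa using hm
      subst this
      exact ⟨i, q, x, _, hq, h1⟩
  choose κ q x r hκ hw using key
  have hκi : Function.Injective κ := by
    intro k k' h
    have h1 := hκ k
    rw [h, hκ k'] at h1
    simp at h1
    exact h1.1.symm
  have hxi : Function.Injective x := by
    intro k k' h
    refine hκi (M_idx (hA' t) (e := .e1 (X.d (X.ι (x k)))) ?_ ?_)
    · rw [hκ]; simp
    · rw [hκ, h]; simp
  refine ⟨κ, q, x, ⟨fun k => isPath_iff.2 ⟨?_, hw k⟩, ?_⟩, hxi, fun k => ⟨r k, hκ k⟩⟩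
  · intro h0
    have h0 : (q k).reverse = [] := h0
    have := hw k
    rw [h0] at this
    have hT : X.T = X.Q t := this
    obtain ⟨Γ, hΓ⟩ := X.h2.2.2.1
    have h3 := (hΓ t).1 k
    rw [← hT] at h3
    exact X.h2.1 _ _ h3
  · intro k k' hkk e h1 h2
    refine hkk (hκi (M_idx (hA' t) (e := .e2 e) ?_ ?_))
    · rw [hκ]; simpa using Or.inl (List.mem_reverse.1 h1)
    · rw [hκ]; simpa using Or.inl (List.mem_reverse.1 h2)

theorem part2 : B2 + m ≤ (mg (A' 0) (A' 1) ∩ X.W A').ncard := by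
  have hac := X.hac
  obtain ⟨rk, hrk⟩ := X.exists_Hrank
  have := @Finite.of_fintype _ X.G1.fintE
  have := @Finite.of_fintype _ X.G2.fintE
  have h2 := fun t => X.fam2 hA' t
  choose κ q x hq hx hκ using h2
  choose r hκ using hκ
  have hB := X.h2.2.2.2 (fun t k => (q t k).reverse) hq
  set M2 := mg (fun k => (q 0 k).reverse) (fun k => (q 1 k).reverse) with hM2
  have hqin : ∀ t k e f, [f, e] <:+: (q t k).reverse → [(HE.e2 e : X.EE), .e2 f] <:+: A' t (κ t k) := by
    intro t k e f h
    have h1 : [e, f] <:+: q t k := by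
      have := List.reverse_infix.2 h
      simpa using this
    rw [hκ]
    refine List.infix_cons ((infix_map2 HE.e2 h1).trans ?_)
    exact List.infix_append' [] _ _
  let Z : Set X.EE := HE.e2 '' M2 ∪ Set.range (fun k => HE.e1 (X.d (X.ι k)))
  have hZc : Z.ncard = M2.ncard + m := by
    rw [Set.ncard_union_eq ?_ (Set.toFinite _) (Set.toFinite _),
      Set.ncard_image_of_injective _ (fun a b h => by injection h), ← Set.image_univ,
      Set.ncard_image_of_injective _ ?_, Set.ncard_univ, Nat.card_fin]
    · intro k k' h
      injection h with h
      exact X.hι (X.hdinj h)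
    · rw [Set.disjoint_left]
      rintro _ ⟨e, _, rfl⟩ ⟨k, h⟩
      cases h
  refine (Nat.add_le_add_right hB m).trans (hZc.symm.le.trans ?_)
  let Rs : X.EE → X.EE → Prop := fun x y => ∀ t, ∃ i, [x, y] <:+: A' t i
  refine starts Rs (fun e => rk (X.hsrc e)) ?_ (X.W A') _ Z ?_ ?_ ?_ ?_ ?_
  · intro x y h
    obtain ⟨i, hi⟩ := h 0
    have h1 := wk_infix (M_wk (hA' 0) i) hi
    have h3 : rk (X.hsrc x) < rk (X.hdst x) := hrk x
    have h4 : X.hdst x = X.hsrc y := h1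
    rwa [h4] at h3
  · rintro z ⟨hz, hz'⟩
    have hsrc : ∀ t, X.hsrc z ≠ .s t := by
      intro t h
      rcases hz' with ⟨e, rfl⟩ | ⟨k, rfl⟩
      · cases h
      · rw [X.src_iota] at h
        cases h
    have hp : ∀ t, ∃ i f, [f, z] <:+: A' t i := by
      intro t
      obtain ⟨i, hi⟩ := hz t
      rcases wk_pred (M_wk (hA' t) i) hi with ⟨_, _, h⟩ | ⟨f, hf⟩
      · exact absurd h (hsrc t)
      · exact ⟨i, f, hf⟩
    obtain ⟨i, f, hf⟩ := hp 0
    obtain ⟨j, g, hg⟩ := hp 1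
    by_cases hfg : f = g
    · subst hfg
      right
      refine ⟨f, fun t => ?_⟩
      fin_cases t
      exacts [⟨i, hf⟩, ⟨j, hg⟩]
    · exact Or.inl ⟨i, j, f, g, hfg, hf, hg⟩
  · rintro z y h ⟨_, hy⟩
    have hzm : ∀ t, ∃ i, z ∈ A' t i := fun t => (h t).imp fun i hi => inf_l hi
    refine ⟨hzm, ?_⟩
    have hsy : ∃ w, X.hsrc y = .v2 w := by
      rcases hy with ⟨e, rfl⟩ | ⟨k, rfl⟩
      · exact ⟨_, rfl⟩
      · exact ⟨_, X.src_iota k⟩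
    obtain ⟨w, hw⟩ := hsy
    obtain ⟨i, hi⟩ := h 0
    have h1 : X.hdst z = .v2 w := (wk_infix (M_wk (hA' 0) i) hi).trans hw
    rcases z with e | e | ⟨t, k⟩ | t
    · simp only [hdst] at h1
      split_ifs at h1
    · exact Or.inl ⟨e, rfl⟩
    · exfalso
      obtain ⟨i, hi⟩ := hzm 0
      obtain ⟨j, hj⟩ := hzm 1
      have := (X.noU hA' hi).symm.trans (X.noU hA' hj)
      simp at this
    · cases h1
  · intro z y y' h h'
    obtain ⟨i, hi⟩ := h 0
    obtain ⟨j, hj⟩ := h' 0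
    exact M_su hac (hA' 0) hi hj
  · rintro z (⟨e, ⟨a, b, f, g, _, h1, h2⟩, rfl⟩ | ⟨k, rfl⟩)
    · refine ⟨fun t => ?_, Or.inl ⟨e, rfl⟩⟩
      fin_cases t
      · exact ⟨_, inf_l (hqin 0 _ _ _ h1)⟩
      · exact ⟨_, inf_l (hqin 1 _ _ _ h2)⟩
    · refine ⟨fun t => ?_, Or.inr ⟨k, rfl⟩⟩
      obtain ⟨k', rfl⟩ := Finite.surjective_of_injective (hx t) k
      refine ⟨κ t k', ?_⟩
      rw [hκ]; simp
  · rintro z (⟨e, ⟨a, b, f, g, hfg, h1, h2⟩, rfl⟩ | ⟨k, rfl⟩) y hy hR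
    · obtain ⟨i, hi⟩ := hR 0
      obtain ⟨j, hj⟩ := hR 1
      have e1 := M_su hac (hA' 0) hi (hqin 0 _ _ _ h1)
      have e2 := M_su hac (hA' 1) hj (hqin 1 _ _ _ h2)
      rw [e1] at e2
      injection e2 with e2
      exact hfg e2
    · obtain ⟨i, hi⟩ := hR 0
      have h1 : X.hdst _ = X.hsrc y := wk_infix (M_wk (hA' 0) i) hi
      rw [X.dst_keep (X.keep_iota k)] at h1
      rcases hy.2 with ⟨e, rfl⟩ | ⟨k, rfl⟩
      · cases h1
      · rw [X.src_iota] at h1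
        cases h1

theorem total : B1 + B2 + m ≤ (mg (A' 0) (A' 1)).ncard := by
  have := @Finite.of_fintype _ X.G1.fintE
  have := @Finite.of_fintype _ X.G2.fintE
  obtain ⟨M1, h1, h2, h3⟩ := X.part1 hA'
  have h4 := X.part2 hA'
  have hd : Disjoint (HE.e1 '' M1) (mg (A' 0) (A' 1) ∩ X.W A') := by
    rw [Set.disjoint_left]
    rintro _ ⟨e, he, rfl⟩ ⟨_, _, ⟨e', h⟩ | ⟨k, h⟩⟩
    · cases h
    · injection h with h
      exact h2 e he _ h
  have h5 : (HE.e1 '' M1 ∪ (mg (A' 0) (A' 1) ∩ X.W A')).ncard ≤ (mg (A' 0) (A' 1)).ncard := by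
    refine Set.ncard_le_ncard ?_ (Set.toFinite _)
    rintro _ (⟨e, he, rfl⟩ | h)
    · exact h3 e he
    · exact h.1
  rw [Set.ncard_union_eq hd (Set.toFinite _) (Set.toFinite _),
    Set.ncard_image_of_injective _ (fun a b h => by injection h)] at h5
  omega

end Cfg

theorem atLeast {m B1 B2 : ℕ} (X : Cfg m B1 B2) : MAtLeast (fun _ : Fin 2 => m + 1) (B1 + B2 + m) := by
  refine ⟨X.H, fun t => .s t, fun t => .v1 (X.R t), ⟨X.hac, ?_, X.mincut⟩, ?_, ?_⟩
  · intro t t' h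
    have h : (HV.v1 (X.R t) : X.VV) = HV.v1 (X.R t') := h
    injection h with h
    have := X.h1.1.2.1
    fin_cases t <;> fin_cases t'
    · rfl
    · exact absurd h this
    · exact absurd h.symm this
    · rfl
  · intro t t' h
    have h : (HV.s t : X.VV) = HV.s t' := h
    injection h
  · intro A' hA'
    rw [mc_eq]
    exact X.total hA'


theorem main (m : ℕ) : MAtLeast (fun _ : Fin 2 => m + 1)
    (MstarNum (fun _ : Fin 2 => m + 2) + MstarNum (fun _ : Fin 2 => m) + m) := by
  obtain ⟨G1, S, R, d, h1, hN⟩ := exists_nrm (c := m + 2) (by omega) (star_exists (m + 2))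
  obtain ⟨G2, T, Q, h2⟩ := star_exists m
  obtain ⟨A, hA, hh, a, ha⟩ := claimA (by omega) h1 hN
  obtain ⟨p, ι, hι, hpa, hr⟩ := exists_choice a
  exact atLeast ⟨G1, G2, S, R, T, Q, d, A, a, p, ι, h1, h2, hA, hh, ha, hι, hpa, hr⟩
end MP


/-- For every integer `n ≥ 2`,
`M(n, n) ≥ M*(n+1, n+1) + M*(n−1, n−1) + (n − 1)`. -/
theorem M_ge_Mstar_succ_add_Mstar_pred (n : ℕ) (hn : 2 ≤ n) :
    MstarNum ![n + 1, n + 1] + MstarNum ![n - 1, n - 1] + (n - 1) ≤ Mnum ![n, n] := by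
  obtain ⟨m, rfl⟩ : ∃ m, n = m + 1 := ⟨n - 1, by omega⟩
  have h := MP.le_Mnum (MP.main m)
  rw [← MP.vec2, ← MP.vec2, ← MP.vec2] at h
  simpa using h
end
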